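/- arXiv:1205.4344 — 2 statements merged into one kernel-verified Lean document; each statement's English description precedes it below -/
import Mathlib

section
/- Let A = (a_{i,j}) : ℂ^m → ℂ^{n×k} be an (n×k)-matrix whose entries a_{i,j} are nonzero homogeneous polynomials of degrees d_{i,j}, with n ≤ k and m = k − n + 1, and suppose rk A(x) = n for all x ≠ 0. Then the multiplicity of degeneration m(A) is greater than or equal to Σ (−1)^{k−|J|} C(m + d^J_{b_1,…,b_n} − 1, m), where the sum is over all nonempty subsets J ⊆ {1,…,k} and all n-tuples of nonnegative integers (b_1,…,b_n) with b_1 + … + b_n = |J|, C(·,·) denotes the binomial coefficient, and d^J_{b_1,…,b_n} = min over decompositions J = J_1 ⊔ … ⊔ J_n with |J_i| = b_i of Σ_{i = 1,…,n, j ∈ J_i} d_{i,j}. -/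
/-!
STATEMENT 4 (homogeneous case: lower bound).
The entries `a_{i,j}` are nonzero homogeneous polynomials of degrees `d_{i,j}` on `ℂ^m`,
with `n ≤ k` and `m = k − n + 1`, and `rk A(x) = n` for all `x ≠ 0`.  The multiplicity of
degeneration `m(A) = dim_ℂ O_{ℂ^m,0}/⟨maximal n×n minors⟩` (modelled by the dimension of
the quotient of the power series ring by the ideal of maximal minors) is at least
`Σ (−1)^{k−|J|} C(m + d^J_{b_1,…,b_n} − 1, m)`.
-/

open Set

noncomputable section

/-- The ideal of `ℂ[[x_1,…,x_m]]` generated by the maximal `n×n` minors of an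
`n×k`-matrix of polynomials. -/
def minorsIdeal {m n k : ℕ} (a : Fin n → Fin k → MvPolynomial (Fin m) ℂ) :
    Ideal (MvPowerSeries (Fin m) ℂ) :=
  Ideal.span {g | ∃ σ : Fin n → Fin k, Function.Injective σ ∧
    g = ((Matrix.det (Matrix.of fun i i' => a i (σ i')) : MvPolynomial (Fin m) ℂ) :
      MvPowerSeries (Fin m) ℂ)}

/-- `d^J_{b_1,…,b_n}`: the minimum, over all decompositions of `J` into disjoint sets
`J_i` with `|J_i| = b_i` (encoded by assignments `f` with fibers of cardinality `b i`
over `J`), of `Σ_{i, j ∈ J_i} d_{i,j}`. -/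
def dMin {n k : ℕ} (d : Fin n → Fin k → ℕ) (J : Finset (Fin k)) (b : Fin n → ℕ) : ℕ :=
  sInf {s | ∃ f : Fin k → Fin n,
    (∀ i, (J.filter (fun j => f j = i)).card = b i) ∧ s = ∑ j ∈ J, d (f j) j}

section EulerCharacteristic

open Classical in
/-- The Iverson bracket of a proposition. -/
def iverson (p : Prop) : ℤ := if p then 1 else 0

theorem iverson_pos {p : Prop} (h : p) : iverson p = 1 := if_pos h

theorem iverson_neg {p : Prop} (h : ¬p) : iverson p = 0 := if_neg h

@[simp] theorem iverson_true : iverson True = 1 := iverson_pos trivial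

@[simp] theorem iverson_false : iverson False = 0 := iverson_neg id

theorem prod_iverson {ι : Type*} (s : Finset ι) (p : ι → Prop) :
    ∏ i ∈ s, iverson (p i) = iverson (∀ i ∈ s, p i) := by
  by_cases h : ∀ i ∈ s, p i
  · rw [iverson_pos h, Finset.prod_eq_one fun i hi => iverson_pos (h i hi)]
  · rw [iverson_neg h]
    push Not at h
    obtain ⟨i, hi, hpi⟩ := h
    exact Finset.prod_eq_zero hi (iverson_neg hpi)

open Classical in
theorem sum_mul_iverson {ι : Type*} (s : Finset ι) (c : ι → ℤ) (p : ι → Prop) :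
    ∑ i ∈ s, c i * iverson (p i) = ∑ i ∈ s with p i, c i := by
  rw [Finset.sum_filter]
  exact Finset.sum_congr rfl fun i _ => by unfold iverson; split_ifs <;> simp

theorem eventually_indicator_eq_of_isOpen_convex {I : Set ℝ} (ho : IsOpen I) (hc : Convex ℝ I)
    (hb : BddBelow I) (hne : I.Nonempty) (L : ℝ) :
    ∀ᶠ y in nhdsWithin L (Ioi L), iverson (y ∈ I) =
      iverson (L ∈ I) + iverson (sInf I = L) := by
  have hoc := hc.ordConnected
  by_cases hL : L ∈ I
  · have hne' : sInf I ≠ L := by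
      rintro rfl
      obtain ⟨l, hl, hl'⟩ := exists_Ioc_subset_of_mem_nhds (ho.mem_nhds hL) ⟨sInf I - 1, by simp⟩
      have h1 : (l + sInf I) / 2 ∈ I := hl' ⟨by linarith, by linarith⟩
      have := csInf_le hb h1
      linarith
    filter_upwards [nhdsWithin_le_nhds (ho.mem_nhds hL)] with y hy
    simp [hy, hL, hne']
  · rcases lt_trichotomy (sInf I) L with h | h | h
    · obtain ⟨z, hz, hzL⟩ := exists_lt_of_csInf_lt hne h
      filter_upwards [self_mem_nhdsWithin] with y hy
      have : y ∉ I := fun hyI => hL (hoc.out hz hyI ⟨hzL.le, le_of_lt hy⟩)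
      simp [this, hL, h.ne]
    · obtain ⟨z, hz⟩ := hne
      have hLz : L < z := by
        rcases (h ▸ csInf_le hb hz : L ≤ z).lt_or_eq with h' | h'
        · exact h'
        · exact absurd (h' ▸ hz) hL
      filter_upwards [Ioo_mem_nhdsGT hLz] with y hy
      obtain ⟨z', hz', hz'y⟩ := exists_lt_of_csInf_lt ⟨z, hz⟩ (h ▸ hy.1 : sInf I < y)
      have : y ∈ I := hoc.out hz' hz ⟨hz'y.le, hy.2.le⟩
      simp [this, hL, h]
    · filter_upwards [Ioo_mem_nhdsGT h] with y hy
      have : y ∉ I := fun hyI => absurd (csInf_le hb hyI) (not_le.2 hy.2)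
      simp [this, hL, h.ne']

theorem sum_nonempty_eq_zero_of_bddBelow {ι : Type*} (s : Finset ι) (c : ι → ℤ) (C : ι → Set ℝ)
    (ho : ∀ a ∈ s, IsOpen (C a)) (hc : ∀ a ∈ s, Convex ℝ (C a))
    (hb : ∀ a ∈ s, BddBelow (C a)) (hne : ∀ a ∈ s, (C a).Nonempty)
    (h : ∀ x, ∑ a ∈ s, c a * iverson (x ∈ C a) = 0) :
    ∑ a ∈ s, c a = 0 := by
  have key : ∀ L : ℝ, ∑ a ∈ s with sInf (C a) = L, c a = 0 := by
    intro L
    have hev : ∀ᶠ y in nhdsWithin L (Ioi L), ∀ a ∈ s, iverson (y ∈ C a) =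
        iverson (L ∈ C a) + iverson (sInf (C a) = L) := by
      rw [Filter.eventually_all_finset]
      exact fun a ha => eventually_indicator_eq_of_isOpen_convex (ho a ha) (hc a ha) (hb a ha)
        (hne a ha) L
    obtain ⟨y, hy⟩ := hev.exists
    have h1 := h y
    rw [Finset.sum_congr rfl (fun a ha => by rw [hy a ha, mul_add]), Finset.sum_add_distrib,
      h L, zero_add] at h1
    rwa [sum_mul_iverson] at h1
  rw [← Finset.sum_fiberwise_of_maps_to (t := s.image fun a => sInf (C a))
    (g := fun a => sInf (C a)) (fun a ha => Finset.mem_image_of_mem _ ha)]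
  exact Finset.sum_eq_zero fun L _ => key L

theorem sum_nonempty_eq_zero_real {ι : Type*} (s : Finset ι) (c : ι → ℤ) (C : ι → Set ℝ)
    (ho : ∀ a ∈ s, IsOpen (C a)) (hc : ∀ a ∈ s, Convex ℝ (C a))
    (h : ∀ x, ∑ a ∈ s, c a * iverson (x ∈ C a) = 0) :
    ∑ a ∈ s, c a * iverson (C a).Nonempty = 0 := by
  classical
  have hch : ∀ a, ∃ x : ℝ, (C a).Nonempty → x ∈ C a := fun a => by
    by_cases hn : (C a).Nonempty
    · exact ⟨hn.some, fun _ => hn.some_mem⟩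
    · exact ⟨0, fun h => absurd h hn⟩
  choose p hp using hch
  obtain ⟨B, hB⟩ := (s.finite_toSet.image p).bddBelow
  have hB' : ∀ a ∈ s, B - 1 < p a := fun a ha => by
    have := hB (mem_image_of_mem p ha)
    linarith
  rw [sum_mul_iverson]
  refine sum_nonempty_eq_zero_of_bddBelow _ c (fun a => C a ∩ Ioi (B - 1)) ?_ ?_ ?_ ?_ ?_
  · intro a ha
    exact (ho a (Finset.mem_filter.1 ha).1).inter isOpen_Ioi
  · intro a ha
    exact (hc a (Finset.mem_filter.1 ha).1).inter (convex_Ioi _)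
  · intro a ha
    exact bddBelow_Ioi.mono inter_subset_right
  · intro a ha
    rw [Finset.mem_filter] at ha
    exact ⟨p a, hp a ha.2, hB' a ha.1⟩
  · intro x
    rw [Finset.sum_filter_of_ne]
    · by_cases hx : x ∈ Ioi (B - 1)
      · simpa only [mem_inter_iff, hx, and_true] using h x
      · simp [mem_inter_iff, hx]
    · intro a _ ha
      by_contra hn
      rw [not_nonempty_iff_eq_empty] at hn
      simp [hn] at ha

theorem sum_nonempty_eq_zero {ι : Type*} (s : Finset ι) (c : ι → ℤ) :
    ∀ (n : ℕ) (C : ι → Set (Fin n → ℝ)), (∀ a ∈ s, IsOpen (C a)) → (∀ a ∈ s, Convex ℝ (C a)) →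
    (∀ x, ∑ a ∈ s, c a * iverson (x ∈ C a) = 0) →
    ∑ a ∈ s, c a * iverson (C a).Nonempty = 0 := by
  intro n
  induction n with
  | zero =>
    intro C _ _ h
    refine Eq.trans ?_ (h default)
    refine Finset.sum_congr rfl fun a _ => ?_
    have : (C a).Nonempty ↔ default ∈ C a :=
      ⟨fun ⟨x, hx⟩ => Subsingleton.elim x default ▸ hx, fun hx => ⟨_, hx⟩⟩
    simp [this]
  | succ n ih =>
    intro C ho hc h
    have hcont : Continuous fun q : ℝ × (Fin n → ℝ) => (Fin.cons q.1 q.2 : Fin (n + 1) → ℝ) := by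
      refine continuous_pi fun i => ?_
      refine Fin.cases ?_ (fun i => ?_) i
      · exact continuous_fst
      · exact (continuous_apply i).comp continuous_snd
    have hcomb : ∀ (r s : ℝ) (q q' : ℝ × (Fin n → ℝ)),
        (Fin.cons (r * q.1 + s * q'.1) (r • q.2 + s • q'.2) : Fin (n + 1) → ℝ) =
        r • (Fin.cons q.1 q.2 : Fin (n + 1) → ℝ) + s • Fin.cons q'.1 q'.2 := by
      intro r s q q'
      ext i
      refine Fin.cases ?_ (fun i => ?_) i <;> simp
    have hp := ih (fun a => {y | ∃ t : ℝ, (Fin.cons t y : Fin (n + 1) → ℝ) ∈ C a}) ?_ ?_ ?_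
    · refine Eq.trans ?_ hp
      refine Finset.sum_congr rfl fun a _ => ?_
      have : (C a).Nonempty ↔ {y | ∃ t : ℝ, (Fin.cons t y : Fin (n + 1) → ℝ) ∈ C a}.Nonempty :=
        ⟨fun ⟨x, hx⟩ => ⟨Fin.tail x, x 0, by simpa using hx⟩, fun ⟨y, t, hx⟩ => ⟨_, hx⟩⟩
      simp only [this]
    · intro a ha
      have : {y | ∃ t : ℝ, (Fin.cons t y : Fin (n + 1) → ℝ) ∈ C a} =
          ⋃ t : ℝ, (fun y : Fin n → ℝ => (Fin.cons t y : Fin (n + 1) → ℝ)) ⁻¹' C a := by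
        ext; simp
      rw [this]
      exact isOpen_iUnion fun t => (ho a ha).preimage
        (hcont.comp (continuous_const.prodMk continuous_id))
    · rintro a ha y ⟨t, ht⟩ y' ⟨t', ht'⟩ r s hr hs hrs
      exact ⟨r * t + s * t', by
        rw [hcomb r s (t, y) (t', y')]; exact hc a ha ht ht' hr hs hrs⟩
    · intro y
      have := sum_nonempty_eq_zero_real s c (fun a => {t | (Fin.cons t y : Fin (n + 1) → ℝ) ∈ C a})
        (fun a ha => (ho a ha).preimage (hcont.comp (continuous_id.prodMk continuous_const)))
        (fun a ha t ht t' ht' r s hr hs hrs => ?_) (fun t => h _)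
      · refine Eq.trans ?_ this
        refine Finset.sum_congr rfl fun a _ => ?_
        by_cases ht : ∃ t : ℝ, (Fin.cons t y : Fin (n + 1) → ℝ) ∈ C a <;> simp [Set.Nonempty, ht]
      · have := hc a ha ht ht' hr hs hrs
        rw [← hcomb r s (t, y) (t', y), ← add_smul, hrs, one_smul] at this
        exact this

/-- Euler characteristic (with compact supports) of a combination of indicators of open convex
sets which is a combination of indicators of points. -/
theorem sum_nonempty_eq_sum_points {ι κ : Type*} (s : Finset ι) (c : ι → ℤ) {n : ℕ}
    (C : ι → Set (Fin n → ℝ)) (ho : ∀ a ∈ s, IsOpen (C a)) (hc : ∀ a ∈ s, Convex ℝ (C a))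
    (T : Finset κ) (N : κ → ℤ) (p : κ → Fin n → ℝ)
    (h : ∀ x, ∑ a ∈ s, c a * iverson (x ∈ C a) =
      ∑ q ∈ T, N q * iverson (x = p q)) :
    ∑ a ∈ s, c a * iverson (C a).Nonempty = (-1) ^ n * ∑ q ∈ T, N q := by
  let S : Fin 3 → ℝ → Set ℝ := ![fun _ => univ, fun r => Ioi r, fun r => Iio r]
  let e : Fin 3 → ℤ := ![1, -1, -1]
  have hSo : ∀ u r, IsOpen (S u r) := by
    intro u r; fin_cases u
    · exact isOpen_univ
    · exact isOpen_Ioi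
    · exact isOpen_Iio
  have hSc : ∀ u r, Convex ℝ (S u r) := by
    intro u r; fin_cases u
    · exact convex_univ
    · exact convex_Ioi r
    · exact convex_Iio r
  have hSn : ∀ u r, (S u r).Nonempty := by
    intro u r; fin_cases u
    · exact univ_nonempty
    · exact nonempty_Ioi
    · exact nonempty_Iio
  have hpt : ∀ x r : ℝ, ∑ u, e u * iverson (x ∈ S u r) = iverson (x = r) := by
    intro x r
    rcases lt_trichotomy x r with h | h | h
    · simp [Fin.sum_univ_three, S, e, h, h.ne, iverson_neg h.not_gt]
    · simp [Fin.sum_univ_three, S, e, h]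
    · simp [Fin.sum_univ_three, S, e, h, h.ne', iverson_neg h.not_gt]
  have hpoint : ∀ x r : Fin n → ℝ, ∑ σ : Fin n → Fin 3, (∏ i, e (σ i)) *
      iverson (x ∈ Set.pi univ (fun i => S (σ i) (r i))) = iverson (x = r) := by
    intro x r
    have h1 : iverson (x = r) = ∏ i, iverson (x i = r i) := by
      rw [prod_iverson]; simp [funext_iff]
    rw [h1, ← Finset.prod_congr rfl (fun i _ => hpt (x i) (r i)), Finset.prod_univ_sum,
      Fintype.piFinset_univ]
    refine Finset.sum_congr rfl fun σ _ => ?_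
    rw [Finset.prod_mul_distrib, prod_iverson]
    simp [Set.mem_pi]
  have hE : ∑ σ : Fin n → Fin 3, ∏ i, e (σ i) = (-1) ^ n := by
    rw [← Fintype.piFinset_univ, ← Finset.prod_univ_sum]
    simp [Fin.sum_univ_three, e]
  have key := sum_nonempty_eq_zero (s.disjSum (T ×ˢ (Finset.univ : Finset (Fin n → Fin 3))))
    (Sum.elim c fun qσ => - (N qσ.1 * ∏ i, e (qσ.2 i))) n
    (Sum.elim C fun qσ => Set.pi univ (fun i => S (qσ.2 i) (p qσ.1 i))) ?_ ?_ ?_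
  · rw [Finset.sum_disjSum, Finset.sum_product] at key
    simp only [Sum.elim_inl, Sum.elim_inr] at key
    have h2 : ∀ q (σ : Fin n → Fin 3), (Set.pi univ (fun i => S (σ i) (p q i))).Nonempty :=
      fun q σ => Set.univ_pi_nonempty_iff.2 fun i => hSn _ _
    simp only [h2, iverson_true, mul_one, Finset.sum_neg_distrib, ← Finset.mul_sum, hE, ← Finset.sum_mul] at key
    linarith
  · rintro (a | a) ha
    · exact ho a (Finset.inl_mem_disjSum.1 ha)
    · exact isOpen_set_pi finite_univ fun i _ => hSo _ _
  · rintro (a | a) ha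
    · exact hc a (Finset.inl_mem_disjSum.1 ha)
    · exact convex_pi fun i _ => hSc _ _
  · intro x
    rw [Finset.sum_disjSum, Finset.sum_product]
    simp only [Sum.elim_inl, Sum.elim_inr, neg_mul, Finset.sum_neg_distrib, mul_assoc,
      ← Finset.mul_sum, hpoint]
    rw [← h x]
    ring

end EulerCharacteristic

section Potentials

variable {V : Type*}

/-- The cost of a walk. -/
def walkCost (c : V → V → ℝ) : List V → ℝ
  | [] => 0
  | [_] => 0
  | x :: y :: l => c x y + walkCost c (y :: l)

theorem walkCost_append (c : V → V → ℝ) (l₁ l₂ : List V) (y : V) :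
    walkCost c (l₁ ++ y :: l₂) = walkCost c (l₁ ++ [y]) + walkCost c (y :: l₂) := by
  induction l₁ with
  | nil => simp [walkCost]
  | cons x l₁ ih =>
    cases l₁ with
    | nil => simp [walkCost]
    | cons x' l₁ =>
      simp only [List.cons_append, walkCost] at ih ⊢
      rw [ih, add_assoc]

variable [Fintype V] [DecidableEq V]

theorem walkCost_add_eq_sum_formPerm (c : V → V → ℝ) (h0 : ∀ v, c v v = 0) (l : List V) :
    ∀ x : V, (x :: l).Nodup → walkCost c (x :: l) + c ((x :: l).getLast (by simp)) x =
      ∑ v, c v ((x :: l).formPerm v) := by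
  induction l with
  | nil => intro x _; simp [walkCost, h0]
  | cons y l ih =>
    intro x hx
    have hy : (y :: l).Nodup := (List.nodup_cons.1 hx).2
    have hxy : x ∉ y :: l := (List.nodup_cons.1 hx).1
    set z := (y :: l).getLast (by simp) with hz
    have hzm : z ∈ y :: l := List.getLast_mem _
    have hxz : x ≠ z := fun h => hxy (h ▸ hzm)
    have hσx : (y :: l).formPerm x = x := List.formPerm_apply_of_notMem hxy
    have hσz : (y :: l).formPerm z = y := List.formPerm_apply_getLast _ _
    have hdiff : ∑ v, (c v ((x :: y :: l).formPerm v) - c v ((y :: l).formPerm v)) =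
        (c x y - c x x) + (c z x - c z y) := by
      rw [Fintype.sum_eq_add x z hxz]
      · rw [List.formPerm_cons_cons]
        simp [hσx, hσz]
      · rintro v ⟨hvx, hvz⟩
        have h1 : (y :: l).formPerm v ≠ x := fun h => hvx ((y :: l).formPerm.injective (h.trans hσx.symm))
        have h2 : (y :: l).formPerm v ≠ y := fun h => hvz ((y :: l).formPerm.injective (h.trans hσz.symm))
        rw [List.formPerm_cons_cons, Equiv.Perm.mul_apply, Equiv.swap_apply_of_ne_of_ne h1 h2, sub_self]
    rw [Finset.sum_sub_distrib, ← ih y hy, h0] at hdiff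
    have : (x :: y :: l).getLast (by simp) = z := by simp [hz]
    rw [this]
    simp only [walkCost]
    linarith

/-- A cost function all of whose permutations have nonnegative total cost has a potential. -/
theorem exists_potential (c : V → V → ℝ) (h0 : ∀ v, c v v = 0)
    (h : ∀ π : Equiv.Perm V, 0 ≤ ∑ v, c v (π v)) : ∃ u : V → ℝ, ∀ x y, u y ≤ c y x + u x := by
  have hfin : ∀ y : V, Set.Finite {l : List V | (y :: l).Nodup} := fun y =>
    ((Set.finite_coe_iff (s := {l : List V | l.Nodup})).1 (inferInstanceAs (Finite {l : List V // l.Nodup}))).subset fun l hl => (List.nodup_cons.1 hl).2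
  have hmin : ∀ y : V, ∃ l : List V, (y :: l).Nodup ∧
      ∀ l' : List V, (y :: l').Nodup → walkCost c (y :: l) ≤ walkCost c (y :: l') := fun y => by
    obtain ⟨l, hl, hl'⟩ := Set.exists_min_image _ (fun l => walkCost c (y :: l)) (hfin y)
      ⟨[], by simp⟩
    exact ⟨l, hl, hl'⟩
  choose p hp hp' using hmin
  refine ⟨fun y => walkCost c (y :: p y), fun x y => ?_⟩
  beta_reduce
  by_cases hy : y ∈ x :: p x
  · obtain ⟨l₁, l₂, hl⟩ := List.append_of_mem hy
    have hnd := hp x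
    rw [hl] at hnd ⊢
    have hyl : (y :: l₂).Nodup := (List.nodup_append.1 hnd).2.1
    have h1 := hp' y l₂ hyl
    rw [walkCost_append]
    have h2 : 0 ≤ c y x + walkCost c (l₁ ++ [y]) := by
      have hnd' : (l₁ ++ [y]).Nodup := by
        refine hnd.sublist ?_
        simp
      cases l₁ with
      | nil =>
        simp only [List.nil_append, List.cons.injEq] at hl
        simp [walkCost, hl.1, h0]
      | cons x' l₁ =>
        simp only [List.cons_append, List.cons.injEq] at hl hnd' ⊢
        have := walkCost_add_eq_sum_formPerm c h0 _ _ hnd'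
        have hlast : (x' :: (l₁ ++ [y])).getLast (by simp) = y := by simp
        rw [hlast] at this
        rw [hl.1, add_comm, this]
        exact h _
    linarith
  · exact hp' y (x :: p x) (List.nodup_cons.2 ⟨hy, hp x⟩)

end Potentials

section GenericReals

theorem exists_linearIndependent_rat_real (ι : Type) [Finite ι] :
    ∃ b : ι → ℝ, LinearIndependent ℚ b := by
  have h1 : Cardinal.mk ι ≤ Module.rank ℚ ℝ := by
    rw [Real.rank_rat_real]
    exact (Cardinal.mk_lt_aleph0.trans Cardinal.aleph0_lt_continuum).le
  obtain ⟨s, hs, hs'⟩ := le_rank_iff_exists_linearIndependent.1 h1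
  obtain ⟨e⟩ := Cardinal.eq.1 hs
  exact ⟨fun i => (e.symm i : ℝ), hs'.comp _ e.symm.injective⟩

theorem exists_linearIndependent_rat_near (ι : Type) [Finite ι] (d : ι → ℝ) {δ : ℝ} (hδ : 0 < δ) :
    ∃ b : ι → ℝ, LinearIndependent ℚ b ∧ ∀ i, d i < b i ∧ b i < d i + δ := by
  obtain ⟨b, hb⟩ := exists_linearIndependent_rat_real ι
  have h : ∀ i, ∃ q : ℚ, q ≠ 0 ∧ d i < q * b i ∧ q * b i < d i + δ := by
    intro i
    have hbi : b i ≠ 0 := hb.ne_zero i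
    have hdense := (Rat.isDenseEmbedding_coe_real.dense.sdiff_singleton 0)
    have hopen : IsOpen {x : ℝ | d i < x * b i ∧ x * b i < d i + δ} :=
      (isOpen_lt (f := fun _ => d i) (g := fun x => x * b i) (by fun_prop) (by fun_prop)).inter
        (isOpen_lt (f := fun x => x * b i) (g := fun _ => d i + δ) (by fun_prop) (by fun_prop))
    obtain ⟨x, hx, ⟨q, rfl⟩, hq⟩ := hdense.inter_open_nonempty _ hopen
      ⟨(d i + δ / 2) / b i, by
        simp only [mem_ofPred_eq, div_mul_cancel₀ _ hbi]; constructor <;> linarith⟩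
    exact ⟨q, by rintro rfl; simp at hq, hx⟩
  choose q hq hq' using h
  refine ⟨fun i => q i • b i, ?_, fun i => ?_⟩
  · exact hb.units_smul fun i => Units.mk0 (q i) (hq i)
  · simpa only [Rat.smul_def] using hq' i

end GenericReals

section FiniteDifference

open PowerSeries in
theorem sum_powerset_choose (S : Type*) [Fintype S] [DecidableEq S] (g : S → ℕ) (m : ℕ) (hm : 0 < m)
    (s : Finset S) (hs : m ≤ s.card) :
    ∑ J ∈ s.powerset, (-1 : ℤ) ^ (s.card - J.card) * ((m + ∑ j ∈ J, g j - 1).choose m : ℤ) =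
      if s.card = m then ∏ j ∈ s, (g j : ℤ) else 0 := by
  have hcoeff : ∀ a r : ℕ, coeff (R := ℤ) (r + 1) (invOneSubPow ℤ a).val = ((r + 1 + a - 1).choose (r + 1) : ℤ) := by
    intro a r
    cases a with
    | zero => simp [invOneSubPow_zero, coeff_one]
    | succ a =>
      rw [invOneSubPow_val_succ_eq_mk_add_choose, coeff_mk]
      rw [show r + 1 + (a + 1) - 1 = a + (r + 1) by omega, Nat.choose_symm_add]
  have hconst : ∀ a : ℕ, constantCoeff (R := ℤ) (invOneSubPow ℤ a).val = 1 := by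
    intro a
    cases a with
    | zero => simp [invOneSubPow_zero]
    | succ a => rw [invOneSubPow_val_succ_eq_mk_add_choose]; simp [← coeff_zero_eq_constantCoeff_apply]
  have hv : ∀ a : ℕ, ∃ v : PowerSeries ℤ, (invOneSubPow ℤ a).val - 1 = X * v ∧ constantCoeff v = (a : ℤ) := by
    intro a
    obtain ⟨v, hv⟩ := X_dvd_iff.2 (show constantCoeff (R := ℤ) ((invOneSubPow ℤ a).val - 1) = 0 by simp [hconst])
    refine ⟨v, hv, ?_⟩
    have := congrArg (coeff (R := ℤ) 1) hv
    rw [show (1 : ℕ) = 0 + 1 from rfl, coeff_succ_X_mul, map_sub, hcoeff] at this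
    simpa [coeff_one] using this.symm
  choose v hv hv0 using hv
  have hmul : ∀ J : Finset S, ∏ j ∈ J, (invOneSubPow ℤ (g j)).val = (invOneSubPow ℤ (∑ j ∈ J, g j)).val := by
    intro J
    induction J using Finset.induction_on with
    | empty => simp [invOneSubPow_zero]
    | insert a J ha ih => rw [Finset.prod_insert ha, Finset.sum_insert ha, ih, invOneSubPow_add, Units.val_mul]
  obtain ⟨r, rfl⟩ : ∃ r, m = r + 1 := ⟨m - 1, by omega⟩
  have key : ∑ J ∈ s.powerset, (-1 : ℤ) ^ (s.card - J.card) * ((r + 1 + ∑ j ∈ J, g j - 1).choose (r + 1) : ℤ) =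
      coeff (R := ℤ) (r + 1) (∏ j ∈ s, ((invOneSubPow ℤ (g j)).val - 1)) := by
    simp only [sub_eq_add_neg]
    rw [Finset.prod_add, map_sum]
    refine Finset.sum_congr rfl fun J hJ => ?_
    rw [Finset.mem_powerset] at hJ
    rw [hmul, Finset.prod_const, Finset.card_sdiff_of_subset hJ, ← hcoeff]
    rw [show ((-1 : PowerSeries ℤ)) ^ (s.card - J.card) = C ((-1 : ℤ) ^ (s.card - J.card)) by simp,
      mul_comm _ (C _), coeff_C_mul]
  rw [key]
  simp only [hv, Finset.prod_mul_distrib, Finset.prod_const]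
  rw [coeff_X_pow_mul']
  rcases hs.lt_or_eq with h | h
  · rw [if_neg (by omega), if_neg (by omega)]
  · rw [if_pos h.ge, if_pos h.symm, ← h]
    simp [hv0]

end FiniteDifference

section Tropical

variable {R K : Type} [Fintype R] [Fintype K] [DecidableEq R] [DecidableEq K] (W : R → K → ℝ)

open Classical in
/-- The rows at which the minimum of `W i j + w i` is attained. -/
def tightRows (w : R → ℝ) (j : K) : Finset R := {i | ∀ l, W i j + w i ≤ W l j + w l}

variable {W} in
theorem mem_tightRows {w : R → ℝ} {j : K} {i : R} :
    i ∈ tightRows W w j ↔ ∀ l, W i j + w i ≤ W l j + w l := by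
  simp [tightRows]

theorem tightRows_nonempty [Nonempty R] (w : R → ℝ) (j : K) : (tightRows W w j).Nonempty := by
  obtain ⟨i, -, hi⟩ := Finset.exists_min_image Finset.univ (fun i => W i j + w i) Finset.univ_nonempty
  exact ⟨i, mem_tightRows.2 fun l => hi l (Finset.mem_univ _)⟩

/-- The minimum of `W i j + w i` is attained only at `i`. -/
def StrictMin (w : R → ℝ) (i : R) (j : K) : Prop := ∀ l, l ≠ i → W i j + w i < W l j + w l

variable {W} in
theorem StrictMin.tightRows_eq {w : R → ℝ} {i : R} {j : K} (h : StrictMin W w i j) :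
    tightRows W w j = {i} := by
  ext l
  rw [mem_tightRows, Finset.mem_singleton]
  constructor
  · intro hl
    by_contra hne
    exact absurd (hl i) (not_le.2 (h l hne))
  · rintro rfl l'
    by_cases hl : l' = l
    · rw [hl]
    · exact (h l' hl).le

variable {W} in
theorem strictMin_of_card_eq_one {w : R → ℝ} {j : K} (h : (tightRows W w j).card < 2) {i : R}
    (hi : i ∈ tightRows W w j) : StrictMin W w i j := by
  intro l hl
  refine lt_of_le_of_ne (mem_tightRows.1 hi l) fun he => ?_
  have hl' : l ∈ tightRows W w j := mem_tightRows.2 fun l' => he ▸ mem_tightRows.1 hi l'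
  exact absurd (Finset.one_lt_card.2 ⟨l, hl', i, hi, hl⟩) (by omega)

variable (hW : LinearIndependent ℚ fun p : R × K => W p.1 p.2)

include hW

theorem sum_card_tightRows_inter_lt (w : R → ℝ) (M : Finset R) (J : Finset K)
    (hM : M.Nonempty) (hJ : J.Nonempty) :
    ∑ j ∈ J, (tightRows W w j ∩ M).card < M.card + J.card := by
  classical
  obtain ⟨i₀, hi₀⟩ := hM
  let E : Finset (Σ _ : K, R) := J.sigma fun j => tightRows W w j ∩ M
  have hE : E.card = ∑ j ∈ J, (tightRows W w j ∩ M).card := Finset.card_sigma _ _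
  rw [← hE]
  have hv : ∀ j, ∃ v : ℝ, ∀ i ∈ tightRows W w j, W i j + w i = v := by
    intro j
    by_cases h : (tightRows W w j).Nonempty
    · obtain ⟨i, hi⟩ := h
      exact ⟨W i j + w i, fun i' hi' => le_antisymm (mem_tightRows.1 hi' i) (mem_tightRows.1 hi i')⟩
    · rw [Finset.not_nonempty_iff_eq_empty] at h
      exact ⟨0, by simp [h]⟩
  choose v hv using hv
  let t : Finset ℝ := J.image (fun j => v j - w i₀) ∪ (M.erase i₀).image (fun i => w i - w i₀)
  have ht : t.card ≤ J.card + (M.card - 1) := by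
    refine (Finset.card_union_le _ _).trans (add_le_add Finset.card_image_le ?_)
    exact Finset.card_image_le.trans (Finset.card_erase_of_mem hi₀).le
  have hind : LinearIndependent ℚ fun e : E => W e.1.2 e.1.1 :=
    hW.comp (fun e : E => (e.1.2, e.1.1)) fun e e' h => by
      rw [Prod.mk.injEq] at h
      exact Subtype.ext (Sigma.ext h.2 (heq_of_eq h.1))
  have hspan : Submodule.span ℚ (Set.range fun e : E => W e.1.2 e.1.1) ≤ Submodule.span ℚ (t : Set ℝ) := by
    rw [Submodule.span_le]
    rintro _ ⟨⟨⟨j, i⟩, he⟩, rfl⟩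
    simp only [E, Finset.mem_sigma, Finset.mem_inter] at he
    have h1 : W i j = (v j - w i₀) - (w i - w i₀) := by rw [← hv j i he.2.1]; ring
    beta_reduce
    rw [SetLike.mem_coe, h1]
    refine Submodule.sub_mem _ (Submodule.subset_span ?_) ?_
    · exact Finset.mem_union_left _ (Finset.mem_image_of_mem _ he.1)
    · by_cases hi : i = i₀
      · simp [hi]
      · exact Submodule.subset_span (Finset.mem_union_right _
          (Finset.mem_image_of_mem _ (Finset.mem_erase.2 ⟨hi, he.2.2⟩)))
  have h1 := finrank_span_eq_card hind
  have h2 := Submodule.finrank_mono hspan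
  have h3 := finrank_span_finset_le_card (R := ℚ) t
  rw [Set.finrank] at h3
  rw [Fintype.card_coe] at h1
  have := Finset.card_pos.2 ⟨i₀, hi₀⟩
  have := Finset.card_pos.2 hJ
  omega

theorem card_lt_of_two_le_inter (w : R → ℝ) (M : Finset R) (hM : M.Nonempty) (J : Finset K)
    (hJ : ∀ j ∈ J, 2 ≤ (tightRows W w j ∩ M).card) : J.card < M.card := by
  rcases J.eq_empty_or_nonempty with rfl | hJne
  · simpa using hM
  · have h1 := sum_card_tightRows_inter_lt W hW w M J hM hJne
    have h2 := Finset.card_nsmul_le_sum J _ 2 hJ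
    rw [smul_eq_mul] at h2
    omega

theorem card_lt_of_two_le [Nonempty R] (w : R → ℝ) (J : Finset K)
    (hJ : ∀ j ∈ J, 2 ≤ (tightRows W w j).card) : J.card < Fintype.card R :=
  card_lt_of_two_le_inter W hW w Finset.univ Finset.univ_nonempty J (by simpa using hJ)

theorem card_tightRows_eq_two [Nonempty R] (w : R → ℝ) (Q : Finset K)
    (hQ : ∀ j ∈ Q, 2 ≤ (tightRows W w j).card) (hc : Q.card + 1 = Fintype.card R) {j : K}
    (hj : j ∈ Q) : (tightRows W w j).card = 2 := by
  have h1 := sum_card_tightRows_inter_lt W hW w Finset.univ Q Finset.univ_nonempty ⟨j, hj⟩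
  simp only [Finset.inter_univ, Finset.card_univ] at h1
  rw [← Finset.add_sum_erase _ _ hj] at h1
  have h2 := Finset.card_nsmul_le_sum (Q.erase j) _ 2 fun l hl => hQ l (Finset.mem_of_mem_erase hl)
  rw [smul_eq_mul, Finset.card_erase_of_mem hj] at h2
  have := hQ j hj
  omega

theorem card_tightRows_lt_two [Nonempty R] (w : R → ℝ) (Q : Finset K)
    (hQ : ∀ j ∈ Q, 2 ≤ (tightRows W w j).card) (hc : Q.card + 1 = Fintype.card R) {j : K}
    (hj : j ∉ Q) : (tightRows W w j).card < 2 := by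
  by_contra! h
  have := card_lt_of_two_le W hW w (insert j Q) (by simpa [h] using hQ)
  rw [Finset.card_insert_of_notMem hj] at this
  omega

/-- Any two complementary sets of rows are linked by a tie in one of the columns of `Q`. -/
theorem exists_tie_across (w : R → ℝ) (Q : Finset K)
    (hQ : ∀ j ∈ Q, 2 ≤ (tightRows W w j).card) (hc : Q.card + 1 = Fintype.card R)
    (M : Finset R) (hM : M.Nonempty) (hM' : Mᶜ.Nonempty) :
    ∃ j ∈ Q, ∃ i ∈ M, ∃ l ∈ Mᶜ, i ∈ tightRows W w j ∧ l ∈ tightRows W w j := by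
  by_contra! hcon
  have h1 := card_lt_of_two_le_inter W hW w M hM {j ∈ Q | tightRows W w j ⊆ M} fun j hj => by
    rw [Finset.mem_filter] at hj
    rw [Finset.inter_eq_left.2 hj.2]
    exact hQ j hj.1
  have h2 := card_lt_of_two_le_inter W hW w Mᶜ hM' {j ∈ Q | ¬ tightRows W w j ⊆ M} fun j hj => by
    rw [Finset.mem_filter, Finset.not_subset] at hj
    obtain ⟨hjQ, l, hl, hlM⟩ := hj
    rw [Finset.inter_eq_left.2]
    · exact hQ j hjQ
    · intro i hi
      by_contra hiM
      exact hcon j hjQ i (by simpa using hiM) l (by simpa using hlM) hi hl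
  have h3 := Finset.card_filter_add_card_filter_not (s := Q) (fun j => tightRows W w j ⊆ M)
  have h4 := Finset.card_add_card_compl M
  omega

/-- A point with ties in `|R| - 1` columns is determined by these columns up to translation. -/
theorem eq_of_ties [Nonempty R] (w w' : R → ℝ) (Q : Finset K)
    (hQ : ∀ j ∈ Q, 2 ≤ (tightRows W w j).card) (hQ' : ∀ j ∈ Q, 2 ≤ (tightRows W w' j).card)
    (hc : Q.card + 1 = Fintype.card R) (i l : R) : w i - w' i = w l - w' l := by
  obtain ⟨i₀, -, hi₀⟩ := Finset.exists_max_image Finset.univ (fun i => w i - w' i) Finset.univ_nonempty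
  let M : Finset R := {i | w i - w' i = w i₀ - w' i₀}
  have hmem : ∀ i, i ∈ M ↔ w i - w' i = w i₀ - w' i₀ := fun i => by simp [M]
  have hM : M.Nonempty := ⟨i₀, by simp [M]⟩
  have key : ∀ j i, i ∈ tightRows W w j → i ∈ M → tightRows W w' j ⊆ M := by
    intro j i hi hiM l hl
    rw [hmem] at hiM ⊢
    have h1 := mem_tightRows.1 hi l
    have h2 := mem_tightRows.1 hl i
    have h3 := hi₀ l (Finset.mem_univ _)
    linarith
  by_cases hM' : Mᶜ.Nonempty
  · exfalso
    have h1 := card_lt_of_two_le_inter W hW w' M hM {j ∈ Q | tightRows W w' j ⊆ M} fun j hj => by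
      rw [Finset.mem_filter] at hj
      rw [Finset.inter_eq_left.2 hj.2]
      exact hQ' j hj.1
    have h2 := card_lt_of_two_le_inter W hW w Mᶜ hM' {j ∈ Q | ¬ tightRows W w' j ⊆ M} fun j hj => by
      rw [Finset.mem_filter] at hj
      rw [Finset.inter_eq_left.2]
      · exact hQ j hj.1
      · intro i hi
        rw [Finset.mem_compl]
        exact fun hiM => hj.2 (key j i hi hiM)
    have h3 := Finset.card_filter_add_card_filter_not (s := Q) (fun j => tightRows W w' j ⊆ M)
    have h4 := Finset.card_add_card_compl M
    omega
  · have hall : ∀ i, i ∈ M := fun i => by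
      by_contra h
      exact hM' ⟨i, Finset.mem_compl.2 h⟩
    rw [(hmem i).1 (hall i), (hmem l).1 (hall l)]

end Tropical

section Assignments

variable {R K : Type} [Fintype R] [Fintype K] [DecidableEq R] [DecidableEq K] (W : R → K → ℝ)

theorem sum_comp_eq_of_card_fiber_eq {J : Finset K} {f f' : K → R}
    (hm : ∀ i, (J.filter (fun j => f j = i)).card = (J.filter (fun j => f' j = i)).card)
    (w : R → ℝ) : ∑ j ∈ J, w (f j) = ∑ j ∈ J, w (f' j) := by
  have h : ∀ g : K → R, ∑ j ∈ J, w (g j) = ∑ i, ((J.filter (fun j => g j = i)).card : ℝ) * w i := by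
    intro g
    rw [← Finset.sum_fiberwise J g]
    refine Finset.sum_congr rfl fun i _ => ?_
    rw [Finset.sum_congr rfl (fun j hj => by rw [(Finset.mem_filter.1 hj).2]), Finset.sum_const,
      nsmul_eq_mul]
  rw [h, h]
  exact Finset.sum_congr rfl fun i _ => by rw [hm]

variable {W} in
theorem sum_lt_of_strictMin {w : R → ℝ} {J : Finset K} {f f' : K → R}
    (hm : ∀ i, (J.filter (fun j => f j = i)).card = (J.filter (fun j => f' j = i)).card)
    (hf : ∀ j ∈ J, StrictMin W w (f j) j) (hne : ∃ j ∈ J, f j ≠ f' j) :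
    ∑ j ∈ J, W (f j) j < ∑ j ∈ J, W (f' j) j := by
  have h1 := sum_comp_eq_of_card_fiber_eq hm w
  have h2 : ∑ j ∈ J, (W (f j) j + w (f j)) < ∑ j ∈ J, (W (f' j) j + w (f' j)) := by
    refine Finset.sum_lt_sum (fun j hj => ?_) ?_
    · by_cases h : f' j = f j
      · rw [h]
      · exact (hf j hj _ h).le
    · obtain ⟨j, hj, h⟩ := hne
      exact ⟨j, hj, hf j hj _ h.symm⟩
  rw [Finset.sum_add_distrib, Finset.sum_add_distrib] at h2
  linarith

theorem exists_card_fiber_eq [Nonempty R] (J : Finset K) (b : R → ℕ) (hb : ∑ i, b i = J.card) :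
    ∃ f : K → R, ∀ i, (J.filter (fun j => f j = i)).card = b i := by
  have e : J ≃ Σ i, Fin (b i) := Fintype.equivOfCardEq (by simp [hb])
  refine ⟨fun j => if h : j ∈ J then (e ⟨j, h⟩).1 else Classical.arbitrary R, fun i => ?_⟩
  rw [Finset.card_filter, ← Finset.sum_coe_sort J]
  simp only [Finset.coe_mem, dif_pos]
  rw [Equiv.sum_comp e (fun x => if x.1 = i then 1 else 0), ← Finset.univ_sigma_univ,
    Finset.sum_sigma, Finset.sum_eq_single i]
  · simp
  · intro l _ hl; simp [hl]
  · simp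

variable {W} in
theorem sum_ne_of_linearIndependent (hW : LinearIndependent ℚ fun p : R × K => W p.1 p.2)
    {J : Finset K} {f f' : K → R} (hne : ∃ j ∈ J, f j ≠ f' j) :
    ∑ j ∈ J, W (f j) j ≠ ∑ j ∈ J, W (f' j) j := by
  intro h
  obtain ⟨j, hj, hjne⟩ := hne
  have h1 : ∀ g : K → R, ∑ p : R × K, (if p.2 ∈ J ∧ g p.2 = p.1 then (1 : ℚ) else 0) • W p.1 p.2 =
      ∑ j ∈ J, W (g j) j := by
    intro g
    rw [Fintype.sum_prod_type_right, ← Finset.sum_subset (Finset.subset_univ J)]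
    · refine Finset.sum_congr rfl fun l hl => ?_
      rw [Finset.sum_eq_single (g l)]
      · simp [hl]
      · intro i _ hi; simp [hi.symm]
      · simp
    · intro l _ hl
      simp [hl]
  have h2 := Fintype.linearIndependent_iff.1 hW
    (fun p => (if p.2 ∈ J ∧ f p.2 = p.1 then (1 : ℚ) else 0) - (if p.2 ∈ J ∧ f' p.2 = p.1 then 1 else 0))
    (by simp only [sub_smul, Finset.sum_sub_distrib, h1, h, sub_self]) (f j, j)
  simp [hj, hjne.symm] at h2

variable (hW : LinearIndependent ℚ fun p : R × K => W p.1 p.2)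
include hW

/-- Every prescribed size of the fibers is realized by an assignment which picks the unique
minimum of `W i j + w i` for a suitable `w`. -/
theorem exists_strictMin_of_card_fiber [Nonempty R] (J : Finset K) (b : R → ℕ)
    (hb : ∑ i, b i = J.card) : ∃ (f : K → R) (w : R → ℝ),
      (∀ i, (J.filter (fun j => f j = i)).card = b i) ∧ ∀ j ∈ J, StrictMin W w (f j) j := by
  classical
  let F : Finset (K → R) := {f | ∀ i, (J.filter (fun j => f j = i)).card = b i}
  have hF : ∀ f, f ∈ F ↔ ∀ i, (J.filter (fun j => f j = i)).card = b i := fun f => by simp [F]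
  have hFne : F.Nonempty := by
    obtain ⟨f, hf⟩ := exists_card_fiber_eq J b hb
    exact ⟨f, (hF f).2 hf⟩
  obtain ⟨f, hfF, hfmin⟩ := Finset.exists_min_image F (fun f => ∑ j ∈ J, W (f j) j) hFne
  obtain ⟨g, hg, hgap⟩ : ∃ g > 0, ∀ f' ∈ F, (∃ j ∈ J, f j ≠ f' j) →
      ∑ j ∈ J, W (f j) j + g ≤ ∑ j ∈ J, W (f' j) j := by
    let F' := F.filter fun f' => ∃ j ∈ J, f j ≠ f' j
    by_cases hF' : F'.Nonempty
    · obtain ⟨f₁, hf₁, hf₁min⟩ := Finset.exists_min_image F' (fun f => ∑ j ∈ J, W (f j) j) hF'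
      rw [Finset.mem_filter] at hf₁
      refine ⟨∑ j ∈ J, W (f₁ j) j - ∑ j ∈ J, W (f j) j, ?_, fun f' hf' hne => ?_⟩
      · exact sub_pos.2 (lt_of_le_of_ne (hfmin _ hf₁.1) (sum_ne_of_linearIndependent hW hf₁.2))
      · have := hf₁min f' (Finset.mem_filter.2 ⟨hf', hne⟩)
        linarith
    · exact ⟨1, one_pos, fun f' hf' hne => absurd ⟨f', Finset.mem_filter.2 ⟨hf', hne⟩⟩ hF'⟩
  set δ : ℝ := g / (J.card + 1) with hδ
  have hδ0 : 0 < δ := by positivity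
  have hδJ : J.card * δ ≤ g := by
    rw [hδ, mul_div_assoc', div_le_iff₀ (by positivity)]
    nlinarith
  let c : J → J → ℝ := fun y x => W (f x) y - W (f y) y - if f x = f y then 0 else δ
  have hc : ∀ y x : J, f x = f y → c y x = 0 := fun y x h => by simp [c, h]
  obtain ⟨u, hu⟩ := exists_potential c (fun v => hc v v rfl) (fun π => by
    by_cases hπ : ∀ v : J, f (π v) = f v
    · exact (Finset.sum_eq_zero fun v _ => hc _ _ (hπ v)).ge
    · push Not at hπ
      obtain ⟨v₀, hv₀⟩ := hπ
      let f' : K → R := fun j => if h : j ∈ J then f (π ⟨j, h⟩) else f j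
      have hf'v : ∀ v : J, f' v = f (π v) := fun v => by simp [f']
      have hf' : f' ∈ F := by
        rw [hF] at hfF ⊢
        intro i
        rw [← hfF i, Finset.card_filter, Finset.card_filter, ← Finset.sum_coe_sort J,
          ← Finset.sum_coe_sort J]
        simp only [hf'v]
        exact Equiv.sum_comp π (fun v : J => if f v = i then 1 else 0)
      have h1 := hgap f' hf' ⟨v₀, v₀.2, by rw [hf'v]; exact hv₀.symm⟩
      rw [← Finset.sum_coe_sort J, ← Finset.sum_coe_sort J] at h1
      simp only [hf'v] at h1
      have h2 : ∑ v : J, (if f (π v) = f v then 0 else δ) ≤ J.card * δ := by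
        have := Finset.sum_le_card_nsmul (Finset.univ : Finset J)
          (fun v => if f (π v) = f v then 0 else δ) δ (fun v _ => by split_ifs <;> linarith)
        simpa using this
      simp only [c, Finset.sum_sub_distrib]
      linarith)
  have huf : ∀ x y : J, f x = f y → u x = u y := fun x y h =>
    le_antisymm (by simpa [hc x y h.symm] using hu y x) (by simpa [hc y x h] using hu x y)
  obtain ⟨B, hB⟩ := (Set.finite_range fun p : J × R => W (f p.1) p.1 + u p.1 - W p.2 p.1).bddAbove
  let w : R → ℝ := fun i => if h : ∃ v : J, f v = i then u h.choose else B + 1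
  have hwf : ∀ v : J, w (f v) = u v := fun v => by
    have h : ∃ v' : J, f v' = f v := ⟨v, rfl⟩
    simp only [w, dif_pos h]
    exact huf _ _ h.choose_spec
  refine ⟨f, w, (hF f).1 hfF, fun j hj l hl => ?_⟩
  have hwj := hwf ⟨j, hj⟩
  simp only at hwj
  rw [hwj]
  by_cases h : ∃ v : J, f v = l
  · obtain ⟨v, rfl⟩ := h
    have := hu v ⟨j, hj⟩
    simp only [c, if_neg hl] at this
    rw [hwf]
    linarith
  · have h1 := hB ⟨(⟨j, hj⟩, l), rfl⟩
    simp only [w, dif_neg h]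
    simp only at h1
    linarith

end Assignments

section Vertices

/-- A choice of a row at which the minimum of `W i j + w i` is attained. -/
def argRow {R K : Type} [Fintype R] [Fintype K] [DecidableEq R] [DecidableEq K] [Nonempty R]
    (W : R → K → ℝ) (w : R → ℝ) (j : K) : R := (tightRows_nonempty W w j).choose

theorem argRow_mem {R K : Type} [Fintype R] [Fintype K] [DecidableEq R] [DecidableEq K] [Nonempty R]
    (W : R → K → ℝ) (w : R → ℝ) (j : K) : argRow W w j ∈ tightRows W w j :=
  (tightRows_nonempty W w j).choose_spec

variable {ν k : ℕ} (W : Fin (ν + 1) → Fin k → ℝ)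

/-- The point `w` has ties in all columns of `Q`. -/
def IsTiePoint (Q : Finset (Fin k)) (w : Fin (ν + 1) → ℝ) : Prop :=
  w 0 = 0 ∧ ∀ j ∈ Q, 2 ≤ (tightRows W w j).card

open Classical in
/-- The sets of `ν` columns which are simultaneously tied at some point. -/
def vertexSets : Finset (Finset (Fin k)) :=
  {Q | Q.card = ν ∧ ∃ w, IsTiePoint W Q w}

open Classical in
/-- A point with ties in all columns of `Q`, if there is one. -/
def vertexPoint (Q : Finset (Fin k)) : Fin (ν + 1) → ℝ :=
  if h : ∃ w, IsTiePoint W Q w then h.choose else 0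

variable {W} in
theorem isTiePoint_vertexPoint {Q : Finset (Fin k)} (hQ : Q ∈ vertexSets W) :
    IsTiePoint W Q (vertexPoint W Q) := by
  have h : ∃ w, IsTiePoint W Q w := by
    simp only [vertexSets, Finset.mem_filter] at hQ
    exact hQ.2.2
  rw [vertexPoint, dif_pos h]
  exact h.choose_spec

variable {W} in
theorem card_of_mem_vertexSets {Q : Finset (Fin k)} (hQ : Q ∈ vertexSets W) : Q.card = ν := by
  simp only [vertexSets, Finset.mem_filter] at hQ
  exact hQ.2.1

variable {W} in
theorem dMin_eq_of_strictMin {d : Fin (ν + 1) → Fin k → ℕ} {δ : ℝ} (hδ : k * δ ≤ 1)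
    (hdW : ∀ i j, (d i j : ℝ) ≤ W i j ∧ W i j < d i j + δ) {J : Finset (Fin k)}
    {b : Fin (ν + 1) → ℕ} {f : Fin k → Fin (ν + 1)} {w : Fin (ν + 1) → ℝ}
    (hf : ∀ i, (J.filter (fun j => f j = i)).card = b i)
    (hfw : ∀ j ∈ J, StrictMin W w (f j) j) : dMin d J b = ∑ j ∈ J, d (f j) j := by
  refine IsLeast.csInf_eq ⟨⟨f, hf, rfl⟩, ?_⟩
  rintro _ ⟨f', hf', rfl⟩
  by_cases hne : ∃ j ∈ J, f j ≠ f' j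
  · have h1 := sum_lt_of_strictMin (f' := f') (fun i => (hf i).trans (hf' i).symm) hfw hne
    have h2 : ∑ j ∈ J, (d (f j) j : ℝ) ≤ ∑ j ∈ J, W (f j) j :=
      Finset.sum_le_sum fun j _ => (hdW _ _).1
    have h3 : ∑ j ∈ J, W (f' j) j ≤ ∑ j ∈ J, ((d (f' j) j : ℝ) + δ) :=
      Finset.sum_le_sum fun j _ => (hdW _ _).2.le
    rw [Finset.sum_add_distrib, Finset.sum_const, nsmul_eq_mul] at h3
    obtain ⟨j₀, hj₀, -⟩ := hne
    have hδ0 : 0 ≤ δ := by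
      have := hdW (f j₀) j₀
      linarith
    have h4 : (J.card : ℝ) * δ ≤ k * δ := by
      refine mul_le_mul_of_nonneg_right ?_ hδ0
      exact_mod_cast (Finset.card_le_univ J).trans (by simp)
    have h5 : ∑ j ∈ J, (d (f j) j : ℝ) < ∑ j ∈ J, (d (f' j) j : ℝ) + 1 := by linarith
    exact Nat.lt_succ_iff.1 (by exact_mod_cast h5)
  · push Not at hne
    exact (Finset.sum_congr rfl fun j hj => by rw [hne j hj]).le

variable {W} in
theorem argRow_eq_of_strictMin {w : Fin (ν + 1) → ℝ} {i : Fin (ν + 1)} {j : Fin k}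
    (h : StrictMin W w i j) : argRow W w j = i := by
  have := argRow_mem W w j
  rwa [h.tightRows_eq, Finset.mem_singleton] at this

theorem strictMin_sub_const {w : Fin (ν + 1) → ℝ} {i : Fin (ν + 1)} {j : Fin k}
    (h : StrictMin W w i j) (r : ℝ) : StrictMin W (fun l => w l - r) i j := fun l hl => by
  have := h l hl
  linarith

theorem isOpen_strictMin_cons (i : Fin (ν + 1)) (j : Fin k) :
    IsOpen {y : Fin ν → ℝ | StrictMin W (Fin.cons 0 y) i j} := by
  have : {y : Fin ν → ℝ | StrictMin W (Fin.cons 0 y) i j} =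
      ⋂ l ∈ {l | l ≠ i}, {y : Fin ν → ℝ | W i j + (Fin.cons 0 y : Fin (ν + 1) → ℝ) i <
        W l j + (Fin.cons 0 y : Fin (ν + 1) → ℝ) l} := by
    ext y; simp [StrictMin]
  rw [this]
  have hc : ∀ l, Continuous fun y : Fin ν → ℝ => (Fin.cons 0 y : Fin (ν + 1) → ℝ) l := fun l => by
    refine Fin.cases ?_ (fun l => ?_) l
    · simpa using continuous_const
    · simpa using continuous_apply l
  exact (Set.toFinite _).isOpen_biInter fun l _ =>
    isOpen_lt (continuous_const.add (hc i)) (continuous_const.add (hc l))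

theorem convex_strictMin_cons (i : Fin (ν + 1)) (j : Fin k) :
    Convex ℝ {y : Fin ν → ℝ | StrictMin W (Fin.cons 0 y) i j} := by
  intro y hy y' hy' r s hr hs hrs l hl
  have h1 := hy l hl
  have h2 := hy' l hl
  have h3 : ∀ l, (Fin.cons 0 (r • y + s • y') : Fin (ν + 1) → ℝ) l =
      r * (Fin.cons 0 y : Fin (ν + 1) → ℝ) l + s * (Fin.cons 0 y' : Fin (ν + 1) → ℝ) l := fun l => by
    refine Fin.cases ?_ (fun l => ?_) l <;> simp
  rw [h3, h3]
  obtain rfl : s = 1 - r := by linarith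
  rcases hr.eq_or_lt with rfl | hr
  · simpa using h2
  · have h4 := mul_lt_mul_of_pos_left h1 hr
    have h5 := mul_le_mul_of_nonneg_left h2.le hs
    linarith

variable {W} in
/-- The pointwise evaluation of the signed count of sectors. -/
theorem sum_choose_strictMin (hW : LinearIndependent ℚ fun p : Fin (ν + 1) × Fin k => W p.1 p.2)
    {d : Fin (ν + 1) → Fin k → ℕ} {δ : ℝ} (hδ : k * δ ≤ 1)
    (hdW : ∀ i j, (d i j : ℝ) ≤ W i j ∧ W i j < d i j + δ) {m : ℕ} (hm : 0 < m) (hmk : m + ν = k)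
    (f : (Σ _ : Finset (Fin k), Fin (ν + 1) → ℕ) → Fin k → Fin (ν + 1))
    (w₀ : (Σ _ : Finset (Fin k), Fin (ν + 1) → ℕ) → Fin (ν + 1) → ℝ)
    (hf : ∀ a, ∑ i, a.2 i = a.1.card →
      (∀ i, (a.1.filter (fun j => f a j = i)).card = a.2 i) ∧ ∀ j ∈ a.1, StrictMin W (w₀ a) (f a j) j)
    (w : Fin (ν + 1) → ℝ) (Q : Finset (Fin k)) (hQ : ∀ j, j ∈ Q ↔ 2 ≤ (tightRows W w j).card) :
    ∑ J : Finset (Fin k), ∑ b ∈ Finset.Nat.antidiagonalTuple (ν + 1) J.card,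
      (-1 : ℤ) ^ (k - J.card) * (Nat.choose (m + dMin d J b - 1) m : ℤ) *
        iverson (∀ j ∈ J, StrictMin W w (f ⟨J, b⟩ j) j) =
      if Q.card = ν then (-1) ^ ν * ∏ j ∈ Qᶜ, (d (argRow W w j) j : ℤ) else 0 := by
  have hstrict : ∀ j ∈ Qᶜ, StrictMin W w (argRow W w j) j := fun j hj => by
    rw [Finset.mem_compl, hQ, not_le] at hj
    exact strictMin_of_card_eq_one hj (argRow_mem W w j)
  have hQlt : Q.card < ν + 1 := by
    simpa using card_lt_of_two_le W hW w Q fun j hj => (hQ j).1 hj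
  have hQc : Q.card + Qᶜ.card = k := by simp
  have hin : ∀ J : Finset (Fin k), ∑ b ∈ Finset.Nat.antidiagonalTuple (ν + 1) J.card,
      (-1 : ℤ) ^ (k - J.card) * (Nat.choose (m + dMin d J b - 1) m : ℤ) *
        iverson (∀ j ∈ J, StrictMin W w (f ⟨J, b⟩ j) j) =
      if J ∈ Qᶜ.powerset then (-1) ^ Q.card * ((-1) ^ (Qᶜ.card - J.card) *
        (Nat.choose (m + ∑ j ∈ J, d (argRow W w j) j - 1) m : ℤ)) else 0 := by
    intro J
    split_ifs with hJ
    · rw [Finset.mem_powerset] at hJ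
      let b₀ : Fin (ν + 1) → ℕ := fun i => (J.filter (fun j => argRow W w j = i)).card
      have hb₀ : ∑ i, b₀ i = J.card :=
        (Finset.card_eq_sum_card_fiberwise fun _ _ => Finset.mem_univ _).symm
      rw [Finset.sum_eq_single b₀]
      · have hfb := hf ⟨J, b₀⟩ hb₀
        have hfeq : ∀ j ∈ J, f ⟨J, b₀⟩ j = argRow W w j := by
          by_contra! hne
          have h1 := sum_lt_of_strictMin (f' := argRow W w) hfb.1 hfb.2 hne
          obtain ⟨j, hj, hjne⟩ := hne
          have h2 := sum_lt_of_strictMin (W := W) (f' := f ⟨J, b₀⟩) (fun i => (hfb.1 i).symm)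
            (fun j hj => hstrict j (hJ hj)) ⟨j, hj, hjne.symm⟩
          exact absurd h1 h2.not_gt
        rw [iverson_pos (fun j hj => by rw [hfeq j hj]; exact hstrict j (hJ hj)), mul_one,
          dMin_eq_of_strictMin hδ hdW (fun i => rfl) fun j hj => hstrict j (hJ hj), ← mul_assoc,
          ← pow_add]
        have := Finset.card_le_card hJ
        congr 3
        omega
      · intro b hb hbne
        rw [iverson_neg, mul_zero]
        intro hst
        have hfb := hf ⟨J, b⟩ (Finset.Nat.mem_antidiagonalTuple.1 hb)
        refine hbne (funext fun i => ?_)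
        refine (hfb.1 i).symm.trans ?_
        simp only [b₀]
        congr 1
        exact Finset.filter_congr fun j hj => by rw [argRow_eq_of_strictMin (hst j hj)]
      · exact fun h => absurd (Finset.Nat.mem_antidiagonalTuple.2 hb₀) h
    · refine Finset.sum_eq_zero fun b _ => ?_
      rw [iverson_neg, mul_zero]
      intro hst
      refine hJ (Finset.mem_powerset.2 fun j hj => ?_)
      rw [Finset.mem_compl, hQ, (hst j hj).tightRows_eq]
      simp
  rw [Finset.sum_congr rfl fun J _ => hin J, ← Finset.sum_filter, Finset.filter_mem_eq_inter,
    Finset.univ_inter, ← Finset.mul_sum, sum_powerset_choose (Fin k) _ m hm _ (by omega)]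
  by_cases h : Q.card = ν
  · rw [if_pos (by omega), if_pos h, h]
  · rw [if_neg (by omega), if_neg h, mul_zero]

variable {W} in
theorem sum_choose_eq_sum_vertexSets
    (hW : LinearIndependent ℚ fun p : Fin (ν + 1) × Fin k => W p.1 p.2)
    {d : Fin (ν + 1) → Fin k → ℕ} {δ : ℝ} (hδ : k * δ ≤ 1)
    (hdW : ∀ i j, (d i j : ℝ) ≤ W i j ∧ W i j < d i j + δ) {m : ℕ} (hm : 0 < m) (hmk : m + ν = k) :
    ∑ J ∈ Finset.univ.filter (fun J : Finset (Fin k) => J.Nonempty),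
      ∑ b ∈ Finset.Nat.antidiagonalTuple (ν + 1) J.card,
        (-1 : ℤ) ^ (k - J.card) * (Nat.choose (m + dMin d J b - 1) m : ℤ) =
    ∑ Q ∈ vertexSets W, ∏ j ∈ Qᶜ, (d (argRow W (vertexPoint W Q) j) j : ℤ) := by
  have hch : ∀ a : Σ _ : Finset (Fin k), Fin (ν + 1) → ℕ, ∃ (f : Fin k → Fin (ν + 1))
      (w : Fin (ν + 1) → ℝ), ∑ i, a.2 i = a.1.card →
      (∀ i, (a.1.filter (fun j => f j = i)).card = a.2 i) ∧ ∀ j ∈ a.1, StrictMin W w (f j) j := by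
    intro a
    by_cases h : ∑ i, a.2 i = a.1.card
    · obtain ⟨f, w, hfw⟩ := exists_strictMin_of_card_fiber W hW a.1 a.2 h
      exact ⟨f, w, fun _ => hfw⟩
    · exact ⟨fun _ => 0, 0, fun h' => absurd h' h⟩
  choose f w₀ hf using hch
  rw [Finset.sum_subset (Finset.subset_univ _)]
  swap
  · intro J _ hJ
    rw [Finset.mem_filter, not_and, Finset.not_nonempty_iff_eq_empty] at hJ
    rw [hJ (Finset.mem_univ _)]
    refine Finset.sum_eq_zero fun b hb => ?_
    have : dMin d ∅ b = 0 := by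
      refine Nat.sInf_eq_zero.2 (Or.inl ⟨fun _ => 0, fun i => ?_, by simp⟩)
      have h1 := Finset.Nat.mem_antidiagonalTuple.1 hb
      rw [Finset.card_empty, Finset.sum_eq_zero_iff] at h1
      simpa using (h1 i (Finset.mem_univ _)).symm
    rw [this, Nat.choose_eq_zero_of_lt (by omega)]
    simp
  rw [← Finset.sum_sigma (Finset.univ : Finset (Finset (Fin k)))
    (fun J => Finset.Nat.antidiagonalTuple (ν + 1) J.card)
    (fun a => (-1 : ℤ) ^ (k - a.1.card) * (Nat.choose (m + dMin d a.1 a.2 - 1) m : ℤ))]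
  have key := sum_nonempty_eq_sum_points
    ((Finset.univ : Finset (Finset (Fin k))).sigma fun J => Finset.Nat.antidiagonalTuple (ν + 1) J.card)
    (fun a => (-1 : ℤ) ^ (k - a.1.card) * (Nat.choose (m + dMin d a.1 a.2 - 1) m : ℤ))
    (fun a => {y : Fin ν → ℝ | ∀ j ∈ a.1, StrictMin W (Fin.cons 0 y) (f a j) j})
    (fun a _ => ?_) (fun a _ => ?_) (vertexSets W)
    (fun Q => (-1) ^ ν * ∏ j ∈ Qᶜ, (d (argRow W (vertexPoint W Q) j) j : ℤ))
    (fun Q => Fin.tail (vertexPoint W Q)) (fun x => ?_)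
  · rw [← Finset.mul_sum, ← mul_assoc, ← pow_add, Even.neg_one_pow ⟨ν, rfl⟩, one_mul] at key
    rw [← key]
    refine Finset.sum_congr rfl fun a ha => ?_
    rw [iverson_pos, mul_one]
    have hfa := (hf a (Finset.Nat.mem_antidiagonalTuple.1 (Finset.mem_sigma.1 ha).2)).2
    refine ⟨fun i => w₀ a i.succ - w₀ a 0, fun j hj => ?_⟩
    convert strictMin_sub_const W (hfa j hj) (w₀ a 0) using 1
    ext i
    refine Fin.cases ?_ (fun i => ?_) i <;> simp
  · have : {y : Fin ν → ℝ | ∀ j ∈ a.1, StrictMin W (Fin.cons 0 y) (f a j) j} =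
        ⋂ j ∈ (a.1 : Set (Fin k)), {y : Fin ν → ℝ | StrictMin W (Fin.cons 0 y) (f a j) j} := by
      ext; simp
    rw [this]
    exact (Set.toFinite _).isOpen_biInter fun j _ => isOpen_strictMin_cons W _ j
  · intro y hy y' hy' r s hr hs hrs j hj
    exact convex_strictMin_cons W _ j (hy j hj) (hy' j hj) hr hs hrs
  · rw [Finset.sum_sigma]
    let Q : Finset (Fin k) := {j | 2 ≤ (tightRows W (Fin.cons 0 x) j).card}
    have hQ : ∀ j, j ∈ Q ↔ 2 ≤ (tightRows W (Fin.cons 0 x) j).card := fun j => by simp [Q]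
    refine (sum_choose_strictMin hW hδ hdW hm hmk f w₀ hf (Fin.cons 0 x) Q hQ).trans ?_
    have hpt : ∀ Q' ∈ vertexSets W, x = Fin.tail (vertexPoint W Q') →
        vertexPoint W Q' = Fin.cons 0 x := by
      intro Q' hQ' hx
      rw [hx, ← (isTiePoint_vertexPoint hQ').1, Fin.cons_self_tail]
    have hsub : ∀ Q' ∈ vertexSets W, x = Fin.tail (vertexPoint W Q') → Q' ⊆ Q := by
      intro Q' hQ' hx j hj
      rw [hQ, ← hpt Q' hQ' hx]
      exact (isTiePoint_vertexPoint hQ').2 j hj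
    split_ifs with hc
    · have htie : IsTiePoint W Q (Fin.cons 0 x) := ⟨rfl, fun j hj => (hQ j).1 hj⟩
      have hQV : Q ∈ vertexSets W := by
        simp only [vertexSets, Finset.mem_filter]
        exact ⟨Finset.mem_univ _, hc, _, htie⟩
      have hv : vertexPoint W Q = Fin.cons 0 x := by
        have hvt := isTiePoint_vertexPoint hQV
        ext i
        have h := eq_of_ties W hW _ _ Q hvt.2 htie.2 (by simp [hc]) i 0
        rw [hvt.1, htie.1, sub_zero] at h
        linarith
      rw [Finset.sum_eq_single Q]
      · rw [iverson_pos (by rw [hv, Fin.tail_cons]), mul_one, hv]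
      · intro Q' hQ' hne
        rw [iverson_neg, mul_zero]
        intro hx
        exact hne (Finset.eq_of_subset_of_card_le (hsub Q' hQ' hx)
          (by rw [hc, card_of_mem_vertexSets hQ']))
      · exact fun h => absurd hQV h
    · symm
      refine Finset.sum_eq_zero fun Q' hQ' => ?_
      rw [iverson_neg, mul_zero]
      intro hx
      have h1 := Finset.card_le_card (hsub Q' hQ' hx)
      rw [card_of_mem_vertexSets hQ'] at h1
      have h2 : Q.card < ν + 1 := by
        simpa using card_lt_of_two_le W hW (Fin.cons 0 x) Q fun j hj => (hQ j).1 hj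
      omega

end Vertices

section Semicontinuity

theorem MvPolynomial.mk_mem_smul_top_of_map_eq_zero {R K σ : Type*} [CommRing R] [Field K]
    (U : Ideal (MvPolynomial σ R)) (ev : R →+* K)
    {f : MvPolynomial σ R} (hf : MvPolynomial.map ev f = 0) :
    Ideal.Quotient.mk U f ∈ (RingHom.ker ev) • (⊤ : Submodule R (MvPolynomial σ R ⧸ U)) := by
  rw [f.as_sum, map_sum]
  refine Submodule.sum_mem _ fun α _ => ?_
  have h1 : MvPolynomial.monomial α (f.coeff α) = f.coeff α • MvPolynomial.monomial α (1 : R) := by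
    rw [MvPolynomial.smul_monomial, smul_eq_mul, mul_one]
  have h2 : ev (f.coeff α) = 0 := by
    rw [← MvPolynomial.coeff_map, hf, MvPolynomial.coeff_zero]
  rw [h1]
  exact Submodule.smul_mem_smul (N := (⊤ : Submodule R (MvPolynomial σ R ⧸ U)))
    (n := Ideal.Quotient.mk U (MvPolynomial.monomial α (1 : R))) ((RingHom.mem_ker).2 h2) trivial

variable {R : Type*} [CommRing R] {K : Type*} [Field K] [Algebra K R] {σ : Type*}

theorem AlgHom.surjective_to_base (ev : R →ₐ[K] K) : Function.Surjective ev := fun c =>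
  ⟨algebraMap K R c, by rw [ev.commutes]; rfl⟩

/-- The ideal obtained by specializing the coefficients. -/
abbrev specialIdeal (U : Ideal (MvPolynomial σ R)) (ev : R →ₐ[K] K) : Ideal (MvPolynomial σ K) :=
  U.map (MvPolynomial.map (ev : R →+* K))

/-- The map of quotient rings induced by a specialization of the coefficients. -/
def specialMap (U : Ideal (MvPolynomial σ R)) (ev : R →ₐ[K] K) :
    (MvPolynomial σ R ⧸ U) →+* (MvPolynomial σ K ⧸ specialIdeal U ev) :=
  Ideal.quotientMap _ (MvPolynomial.map (ev : R →+* K)) Ideal.le_comap_map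

theorem specialMap_mk (U : Ideal (MvPolynomial σ R)) (ev : R →ₐ[K] K) (f : MvPolynomial σ R) :
    specialMap U ev (Ideal.Quotient.mk U f) =
      Ideal.Quotient.mk _ (MvPolynomial.map (ev : R →+* K) f) := Ideal.quotientMap_mk

theorem specialMap_surjective (U : Ideal (MvPolynomial σ R)) (ev : R →ₐ[K] K) :
    Function.Surjective (specialMap U ev) :=
  Ideal.quotientMap_surjective (MvPolynomial.map_surjective _ ev.surjective_to_base)

theorem specialMap_smul (U : Ideal (MvPolynomial σ R)) (ev : R →ₐ[K] K) (r : R)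
    (x : MvPolynomial σ R ⧸ U) : specialMap U ev (r • x) = ev r • specialMap U ev x := by
  obtain ⟨x, rfl⟩ := Ideal.Quotient.mk_surjective x
  change specialMap U ev (Ideal.Quotient.mk U (r • x)) = _
  rw [specialMap_mk, specialMap_mk, MvPolynomial.smul_eq_C_mul, map_mul, MvPolynomial.map_C]
  change _ = Ideal.Quotient.mk _ (ev r • _)
  rw [MvPolynomial.smul_eq_C_mul]
  rfl

theorem specialMap_mem_span {ι : Type*} (U : Ideal (MvPolynomial σ R)) (ev : R →ₐ[K] K)
    {g : ι → MvPolynomial σ R ⧸ U} {x : MvPolynomial σ R ⧸ U}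
    (hx : x ∈ Submodule.span R (Set.range g)) :
    specialMap U ev x ∈ Submodule.span K (Set.range fun i => specialMap U ev (g i)) := by
  induction hx using Submodule.span_induction with
  | mem x hx =>
    obtain ⟨i, rfl⟩ := hx
    exact Submodule.subset_span ⟨i, rfl⟩
  | zero => rw [map_zero]; exact zero_mem _
  | add x y _ _ hx hy => rw [map_add]; exact add_mem hx hy
  | smul r x _ hx => rw [specialMap_smul]; exact Submodule.smul_mem _ _ hx

theorem finite_specialIdeal (U : Ideal (MvPolynomial σ R))
    [Module.Finite R (MvPolynomial σ R ⧸ U)] (ev : R →ₐ[K] K) :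
    Module.Finite K (MvPolynomial σ K ⧸ specialIdeal U ev) := by
  obtain ⟨s, g, hg⟩ := Module.Finite.exists_fin (R := R) (M := MvPolynomial σ R ⧸ U)
  refine ⟨Submodule.fg_def.2 ⟨_, Set.finite_range fun i => specialMap U ev (g i),
    eq_top_iff.2 fun y _ => ?_⟩⟩
  obtain ⟨x, rfl⟩ := specialMap_surjective U ev y
  exact specialMap_mem_span U ev (hg ▸ trivial)

/-- Generic members of a finite family of affine schemes have at most the length of a special
member. -/
theorem exists_finrank_specialIdeal_le (U : Ideal (MvPolynomial σ R))
    [Module.Finite R (MvPolynomial σ R ⧸ U)] (ev₀ : R →ₐ[K] K) :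
    ∃ Δ : R, ev₀ Δ ≠ 0 ∧ ∀ ev : R →ₐ[K] K, ev Δ ≠ 0 →
      Module.finrank K (MvPolynomial σ K ⧸ specialIdeal U ev) ≤
        Module.finrank K (MvPolynomial σ K ⧸ specialIdeal U ev₀) := by
  classical
  have hsurj := MvPolynomial.map_surjective (σ := σ) (ev₀ : R →+* K) ev₀.surjective_to_base
  have := finite_specialIdeal U ev₀
  set b := Module.finBasis K (MvPolynomial σ K ⧸ specialIdeal U ev₀)
  choose g hg using fun i => specialMap_surjective U ev₀ (b i)
  set N' : Submodule R (MvPolynomial σ R ⧸ U) := Submodule.span R (Set.range g)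
  have hle : (⊤ : Submodule R ((MvPolynomial σ R ⧸ U) ⧸ N')) ≤
      RingHom.ker (ev₀ : R →+* K) • ⊤ := by
    rintro y -
    obtain ⟨x, rfl⟩ := Submodule.Quotient.mk_surjective _ y
    set c := b.repr (specialMap U ev₀ x)
    obtain ⟨h, hh⟩ := Ideal.Quotient.mk_surjective (x - ∑ i, algebraMap K R (c i) • g i)
    have h0 : MvPolynomial.map (ev₀ : R →+* K) h ∈ specialIdeal U ev₀ := by
      rw [← Ideal.Quotient.eq_zero_iff_mem, ← specialMap_mk, hh, map_sub, map_sum, sub_eq_zero]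
      refine (b.sum_repr _).symm.trans (Finset.sum_congr rfl fun i _ => ?_)
      rw [specialMap_smul, hg, ev₀.commutes]
      rfl
    obtain ⟨u, hu, huh⟩ := (Ideal.mem_map_iff_of_surjective _ hsurj).1 h0
    have h1 := MvPolynomial.mk_mem_smul_top_of_map_eq_zero U (ev₀ : R →+* K) (f := h - u)
      (by rw [map_sub, huh, sub_self])
    rw [map_sub, (Ideal.Quotient.eq_zero_iff_mem).2 hu, sub_zero, hh] at h1
    have h2 := Submodule.mem_map_of_mem (f := N'.mkQ) h1
    rw [Submodule.map_smul'', Submodule.map_top, Submodule.range_mkQ] at h2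
    have h3 : N'.mkQ (x - ∑ i, algebraMap K R (c i) • g i) = Submodule.Quotient.mk x := by
      rw [Submodule.mkQ_apply, Submodule.Quotient.eq, sub_sub_cancel_left]
      exact neg_mem (Submodule.sum_mem _ fun i _ =>
        Submodule.smul_mem N' (algebraMap K R (c i)) (Submodule.subset_span ⟨i, rfl⟩))
    rwa [h3] at h2
  obtain ⟨r, hr, hr0⟩ := Submodule.exists_sub_one_mem_and_smul_eq_zero_of_fg_of_le_smul
    (RingHom.ker (ev₀ : R →+* K)) _ Module.Finite.fg_top hle
  refine ⟨r, ?_, fun ev hev => ?_⟩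
  · have : ev₀ (r - 1) = 0 := hr
    rw [map_sub, map_one, sub_eq_zero] at this
    rw [this]
    exact one_ne_zero
  · have hspan : ⊤ ≤ Submodule.span K (Set.range fun i => specialMap U ev (g i)) := by
      rintro y -
      obtain ⟨x, rfl⟩ := specialMap_surjective U ev y
      have h1 : r • x ∈ N' := by
        rw [← Submodule.Quotient.mk_eq_zero, Submodule.Quotient.mk_smul]
        exact hr0 _ trivial
      have h2 := specialMap_mem_span U ev h1
      rw [specialMap_smul] at h2
      exact (Submodule.smul_mem_iff _ hev).1 h2
    have := finrank_le_of_span_eq_top (eq_top_iff.2 hspan)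
    simpa using this

/-- A quotient of a polynomial ring in which every variable is integral is a finite module. -/
theorem finite_quotient_of_monic {R σ : Type*} [CommRing R] [Finite σ]
    (U : Ideal (MvPolynomial σ R))
    (h : ∀ l, ∃ q : Polynomial R, q.Monic ∧ Polynomial.aeval (MvPolynomial.X l) q ∈ U) :
    Module.Finite R (MvPolynomial σ R ⧸ U) := by
  have hint : Algebra.IsIntegral R (MvPolynomial σ R ⧸ U) := by
    refine ⟨fun x => ?_⟩
    have hx : x ∈ (⊤ : Subalgebra R (MvPolynomial σ R ⧸ U)) := trivial
    obtain ⟨x, rfl⟩ := Ideal.Quotient.mk_surjective x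
    induction x using MvPolynomial.induction_on with
    | C r => exact isIntegral_algebraMap (R := R) (x := r)
    | add p q hp hq => rw [map_add]; exact (hp trivial).add (hq trivial)
    | mul_X p l hp =>
      rw [map_mul]
      refine (hp trivial).mul ?_
      obtain ⟨q, hq, hqU⟩ := h l
      refine ⟨q, hq, ?_⟩
      rw [← Polynomial.aeval_def]
      have := Polynomial.aeval_algHom_apply (Ideal.Quotient.mkₐ R U) (MvPolynomial.X l) q
      rw [Ideal.Quotient.mkₐ_eq_mk] at this
      rw [this]
      exact Ideal.Quotient.eq_zero_iff_mem.2 hqU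
  exact Algebra.IsIntegral.finite

/-- The length of a finite affine scheme bounds its number of points. -/
theorem card_le_finrank_of_eval_eq_zero {σ ι : Type*} [Finite ι]
    (U : Ideal (MvPolynomial σ K)) [Module.Finite K (MvPolynomial σ K ⧸ U)] (p : ι → σ → K)
    (hp : Function.Injective p) (h : ∀ i, ∀ f ∈ U, MvPolynomial.eval (p i) f = 0) :
    Nat.card ι ≤ Module.finrank K (MvPolynomial σ K ⧸ U) := by
  refine le_trans ?_ (card_algHom_le_finrank K (MvPolynomial σ K ⧸ U) K)
  set F : ι → (MvPolynomial σ K ⧸ U →ₐ[K] K) := fun i =>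
    Ideal.Quotient.liftₐ U (MvPolynomial.aeval (p i)) fun f hf => by
      rw [MvPolynomial.aeval_eq_eval]; exact h i f hf
  refine Nat.card_le_card_of_injective F fun i i' hi => hp (funext fun l => ?_)
  have := congrArg (fun φ => φ (Ideal.Quotient.mk U (MvPolynomial.X l))) hi
  simpa [F] using this
end Semicontinuity

section PowerSeries

theorem MvPowerSeries.mem_span_X_pow {σ R : Type*} [CommRing R] (e : ℕ) (s : Finset σ)
    (f : MvPowerSeries σ R) (hf : ∀ α, MvPowerSeries.coeff α f ≠ 0 → ∃ l ∈ s, e ≤ α l) :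
    f ∈ Ideal.span (Set.range fun l => (MvPowerSeries.X l : MvPowerSeries σ R) ^ e) := by
  classical
  induction s using Finset.induction_on generalizing f with
  | empty =>
    have : f = 0 := MvPowerSeries.ext fun α => by
      by_contra h
      simpa using hf α h
    rw [this]
    exact zero_mem _
  | insert l s _ ih =>
    set g : MvPowerSeries σ R := fun α => if e ≤ α l then MvPowerSeries.coeff α f else 0
    have hg : ∀ α, MvPowerSeries.coeff α g = if e ≤ α l then MvPowerSeries.coeff α f else 0 :=
      fun α => rfl
    have h1 : (MvPowerSeries.X l : MvPowerSeries σ R) ^ e ∣ g :=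
      MvPowerSeries.X_pow_dvd_iff.2 fun α hα => by rw [hg, if_neg (by omega)]
    have h2 : f - g ∈ Ideal.span (Set.range fun l => (MvPowerSeries.X l : MvPowerSeries σ R) ^ e) := by
      refine ih _ fun α hα => ?_
      rw [map_sub, hg] at hα
      by_cases hl : e ≤ α l
      · simp [hl] at hα
      · rw [if_neg hl, sub_zero] at hα
        obtain ⟨l', hl', h⟩ := hf α hα
        rcases Finset.mem_insert.1 hl' with rfl | hl'
        · exact absurd h hl
        · exact ⟨l', hl', h⟩
    have h3 := Ideal.mem_of_dvd (Ideal.span (Set.range fun l => (MvPowerSeries.X l : MvPowerSeries σ R) ^ e)) h1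
      (Ideal.subset_span ⟨l, rfl⟩)
    simpa using add_mem h2 h3

variable {m : ℕ}

/-- The extension of an ideal of polynomials to power series. -/
abbrev extendedIdeal (I : Ideal (MvPolynomial (Fin m) ℂ)) : Ideal (MvPowerSeries (Fin m) ℂ) :=
  I.map MvPolynomial.coeToMvPowerSeries.ringHom

theorem finite_extendedIdeal (I : Ideal (MvPolynomial (Fin m) ℂ))
    (h : ∀ l, ∃ e, MvPolynomial.X l ^ e ∈ I) :
    Module.Finite ℂ (MvPowerSeries (Fin m) ℂ ⧸ extendedIdeal I) := by
  have hfin : Module.Finite ℂ (MvPolynomial (Fin m) ℂ ⧸ I) :=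
    finite_quotient_of_monic I fun l => (h l).imp' (fun e => Polynomial.X ^ e) fun e he =>
      ⟨Polynomial.monic_X_pow e, by simpa using he⟩
  choose e he using h
  set E := ∑ l, e l
  set F : MvPolynomial (Fin m) ℂ ⧸ I →+* MvPowerSeries (Fin m) ℂ ⧸ extendedIdeal I :=
    Ideal.quotientMap _ MvPolynomial.coeToMvPowerSeries.ringHom Ideal.le_comap_map
  have hF : ∀ p, F (Ideal.Quotient.mk I p) = Ideal.Quotient.mk _ (p : MvPowerSeries (Fin m) ℂ) :=
    fun p => Ideal.quotientMap_mk
  have hXE : ∀ l, (MvPowerSeries.X l : MvPowerSeries (Fin m) ℂ) ^ E ∈ extendedIdeal I := fun l => by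
    refine Ideal.mem_of_dvd _ (pow_dvd_pow _ (Finset.single_le_sum (fun _ _ => Nat.zero_le _)
      (Finset.mem_univ l) : e l ≤ E)) ?_
    have := Ideal.mem_map_of_mem MvPolynomial.coeToMvPowerSeries.ringHom (he l)
    simpa using this
  have hsurj : Function.Surjective F := fun y => by
    obtain ⟨f, rfl⟩ := Ideal.Quotient.mk_surjective y
    refine ⟨Ideal.Quotient.mk _ (MvPowerSeries.truncTotal (m * E + 1) f), ?_⟩
    rw [hF, Ideal.Quotient.mk_eq_mk_iff_sub_mem, ← neg_mem_iff, neg_sub]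
    refine Ideal.span_le.2 ?_ (MvPowerSeries.mem_span_X_pow E Finset.univ _ fun α hα => ?_)
    · rintro _ ⟨l, rfl⟩
      exact hXE l
    · by_contra hlt
      push Not at hlt
      refine hα ?_
      have : α.degree < m * E + 1 := by
        rw [Finsupp.degree_eq_sum, Nat.lt_succ_iff]
        refine (Finset.sum_le_card_nsmul _ _ E fun l _ => (hlt l (Finset.mem_univ l)).le).trans ?_
        simp
      rw [map_sub, MvPolynomial.coeff_coe, MvPowerSeries.coeff_truncTotal _ this, sub_self]
  refine Module.Finite.of_surjective (⟨⟨F, map_add F⟩, fun c x => ?_⟩ :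
    MvPolynomial (Fin m) ℂ ⧸ I →ₗ[ℂ] MvPowerSeries (Fin m) ℂ ⧸ extendedIdeal I) hsurj
  obtain ⟨p, rfl⟩ := Ideal.Quotient.mk_surjective x
  change F (Ideal.Quotient.mk I (c • p)) = c • F (Ideal.Quotient.mk I p)
  rw [hF, hF, MvPolynomial.coe_smul]
  rfl

theorem finrank_sup_le_finrank_extendedIdeal (I : Ideal (MvPolynomial (Fin m) ℂ))
    (h : ∀ l, ∃ e, MvPolynomial.X l ^ e ∈ I) (N : ℕ) :
    Module.finrank ℂ (MvPolynomial (Fin m) ℂ ⧸ I ⊔ MvPolynomial.idealOfVars (Fin m) ℂ ^ N) ≤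
      Module.finrank ℂ (MvPowerSeries (Fin m) ℂ ⧸ extendedIdeal I) := by
  have := finite_extendedIdeal I h
  set T := MvPowerSeries.truncTotalAlgHom (Fin m) ℂ N
  set G : MvPowerSeries (Fin m) ℂ →+* MvPolynomial (Fin m) ℂ ⧸
      I ⊔ MvPolynomial.idealOfVars (Fin m) ℂ ^ N :=
    (Ideal.Quotient.factor le_sup_right).comp T.toRingHom
  have hG : ∀ p : MvPolynomial (Fin m) ℂ, G p = Ideal.Quotient.mk _ p := fun p => by
    have h1 : T (p : MvPowerSeries (Fin m) ℂ) = Ideal.Quotient.mk _ p := by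
      have := T.commutes p
      rw [MvPowerSeries.algebraMap_apply'] at this
      simpa using this
    change Ideal.Quotient.factor le_sup_right (T p) = _
    rw [h1, Ideal.Quotient.factor_mk]
  set F := Ideal.Quotient.lift (extendedIdeal I) G (by
    have : extendedIdeal I ≤ RingHom.ker G := Ideal.map_le_iff_le_comap.2 fun p hp => by
      rw [Ideal.mem_comap, RingHom.mem_ker, MvPolynomial.coeToMvPowerSeries.ringHom_apply, hG,
        Ideal.Quotient.eq_zero_iff_mem]
      exact le_sup_left (a := I) hp
    exact fun a ha => this ha) with hF
  have hsurj : Function.Surjective F := fun y => by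
    obtain ⟨p, rfl⟩ := Ideal.Quotient.mk_surjective y
    exact ⟨Ideal.Quotient.mk _ (p : MvPowerSeries (Fin m) ℂ), hG p⟩
  refine LinearMap.finrank_le_finrank_of_surjective (f := (⟨⟨F, map_add F⟩, fun c x => ?_⟩ :
    MvPowerSeries (Fin m) ℂ ⧸ extendedIdeal I →ₗ[ℂ] MvPolynomial (Fin m) ℂ ⧸
      I ⊔ MvPolynomial.idealOfVars (Fin m) ℂ ^ N)) hsurj
  obtain ⟨f, rfl⟩ := Ideal.Quotient.mk_surjective x
  change G (c • f) = c • G f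
  have h1 := hG (MvPolynomial.C c)
  rw [MvPolynomial.coe_C] at h1
  rw [MvPowerSeries.smul_eq_C_mul, map_mul, h1]
  obtain ⟨q, hq⟩ := Ideal.Quotient.mk_surjective (G f)
  rw [← hq, ← map_mul, ← MvPolynomial.smul_eq_C_mul]
  rfl

/-- The ideal generated by the maximal minors of a matrix. -/
def maxMinors {R : Type*} [CommRing R] {n k : ℕ} (a : Fin n → Fin k → R) : Ideal R :=
  Ideal.span {g | ∃ σ : Fin n → Fin k, Function.Injective σ ∧
    g = Matrix.det (Matrix.of fun i i' => a i (σ i'))}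

theorem extendedIdeal_maxMinors {n k : ℕ} (a : Fin n → Fin k → MvPolynomial (Fin m) ℂ) :
    extendedIdeal (maxMinors a) = minorsIdeal a := by
  rw [extendedIdeal, maxMinors, Ideal.map_span, minorsIdeal]
  congr 1
  ext g
  constructor
  · rintro ⟨_, ⟨σ, hσ, rfl⟩, rfl⟩
    exact ⟨σ, hσ, rfl⟩
  · rintro ⟨σ, hσ, rfl⟩
    exact ⟨_, ⟨σ, hσ, rfl⟩, rfl⟩

theorem maxMinors_map {R S : Type*} [CommRing R] [CommRing S] (f : R →+* S) {n k : ℕ}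
    (a : Fin n → Fin k → R) : (maxMinors a).map f = maxMinors fun i j => f (a i j) := by
  rw [maxMinors, maxMinors, Ideal.map_span]
  have hdet : ∀ σ : Fin n → Fin k, f (Matrix.det (Matrix.of fun i i' => a i (σ i'))) =
      Matrix.det (Matrix.of fun i i' => f (a i (σ i'))) := fun σ => f.map_det _
  congr 1
  ext g
  constructor
  · rintro ⟨_, ⟨σ, hσ, rfl⟩, rfl⟩
    exact ⟨σ, hσ, hdet σ⟩
  · rintro ⟨σ, hσ, rfl⟩
    exact ⟨_, ⟨σ, hσ, rfl⟩, hdet σ⟩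

theorem exists_det_ne_zero_of_rank_eq {K : Type*} [Field K] {n k : ℕ} (M : Matrix (Fin n) (Fin k) K)
    (hM : M.rank = n) : ∃ σ : Fin n → Fin k, Function.Injective σ ∧
      (Matrix.of fun i i' => M i (σ i')).det ≠ 0 := by
  obtain ⟨κ, c, hc, hspan, hli⟩ := exists_linearIndependent' K M.col
  have : Fintype κ := Fintype.ofInjective c hc
  have hcard : Fintype.card κ = n := by
    rw [← finrank_span_eq_card hli, hspan, ← Matrix.rank_eq_finrank_span_cols, hM]
  set e := Fintype.equivFinOfCardEq hcard
  refine ⟨c ∘ e.symm, hc.comp e.symm.injective, fun h0 => ?_⟩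
  have hcol : LinearIndependent K (Matrix.of fun i i' => M i ((c ∘ e.symm) i')).col :=
    hli.comp e.symm e.symm.injective
  rw [Matrix.linearIndependent_cols_iff_isUnit, Matrix.isUnit_iff_isUnit_det, h0] at hcol
  exact not_isUnit_zero hcol

theorem exists_X_pow_mem_maxMinors {n k : ℕ} (a : Fin n → Fin k → MvPolynomial (Fin m) ℂ)
    (hrank : ∀ x : Fin m → ℂ, x ≠ 0 →
      (Matrix.of fun i j => MvPolynomial.eval x (a i j)).rank = n) (l : Fin m) :
    ∃ e, MvPolynomial.X l ^ e ∈ maxMinors a := by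
  have : MvPolynomial.X l ∈ (maxMinors a).radical := by
    rw [← MvPolynomial.vanishingIdeal_zeroLocus_eq_radical (K := ℂ),
      MvPolynomial.mem_vanishingIdeal_iff]
    intro x hx
    rw [MvPolynomial.mem_zeroLocus_iff] at hx
    by_contra hne
    have hx0 : x ≠ 0 := by
      rintro rfl
      simp at hne
    obtain ⟨σ, hσ, hdet⟩ := exists_det_ne_zero_of_rank_eq _ (hrank x hx0)
    refine hdet ?_
    have := hx _ (Ideal.subset_span ⟨σ, hσ, rfl⟩)
    rw [MvPolynomial.aeval_eq_eval, RingHom.map_det] at this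
    exact this
  exact this
end PowerSeries

section Families

theorem MvPolynomial.map_pow_idealOfVars {σ R S : Type*} [CommRing R] [CommRing S] (f : R →+* S)
    (N : ℕ) : (MvPolynomial.idealOfVars σ R ^ N).map (MvPolynomial.map f) =
      MvPolynomial.idealOfVars σ S ^ N := by
  rw [Ideal.map_pow, Ideal.map_span, ← Set.range_comp]
  congr 3
  funext l
  exact MvPolynomial.map_X f l

variable {m n k : ℕ}

/-- The member with parameter `s` of a polynomial family of matrices of polynomials. -/
def famAt (C : Fin n → Fin k → MvPolynomial (Fin m) (Polynomial ℂ)) (s : ℂ) :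
    Fin n → Fin k → MvPolynomial (Fin m) ℂ :=
  fun i j => MvPolynomial.map (Polynomial.evalRingHom s) (C i j)

/-- Truncated lengths of degeneracy loci of generic members are bounded by that of a special
member. -/
theorem finite_setOf_not_finrank_le (C : Fin n → Fin k → MvPolynomial (Fin m) (Polynomial ℂ))
    (N : ℕ) : {s : ℂ | ¬ Module.finrank ℂ (MvPolynomial (Fin m) ℂ ⧸
      maxMinors (famAt C s) ⊔ MvPolynomial.idealOfVars (Fin m) ℂ ^ N) ≤
      Module.finrank ℂ (MvPolynomial (Fin m) ℂ ⧸
      maxMinors (famAt C 0) ⊔ MvPolynomial.idealOfVars (Fin m) ℂ ^ N)}.Finite := by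
  set U := maxMinors C ⊔ MvPolynomial.idealOfVars (Fin m) (Polynomial ℂ) ^ N
  have hU : ∀ s : ℂ, specialIdeal U (Polynomial.aeval s) =
      maxMinors (famAt C s) ⊔ MvPolynomial.idealOfVars (Fin m) ℂ ^ N := fun s => by
    rw [specialIdeal, Ideal.map_sup, maxMinors_map, MvPolynomial.map_pow_idealOfVars,
      Polynomial.coe_aeval_eq_evalRingHom]
    rfl
  have hfin : Module.Finite (Polynomial ℂ) (MvPolynomial (Fin m) (Polynomial ℂ) ⧸ U) :=
    finite_quotient_of_monic U fun l => ⟨Polynomial.X ^ N, Polynomial.monic_X_pow N, by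
      rw [map_pow, Polynomial.aeval_X]
      exact le_sup_right (a := maxMinors C)
        (Ideal.pow_mem_pow (Ideal.subset_span (Set.mem_range_self l)) N)⟩
  obtain ⟨Δ, h0, hΔ⟩ := exists_finrank_specialIdeal_le U (Polynomial.aeval (0 : ℂ))
  have hΔ0 : Δ ≠ 0 := by
    rintro rfl
    exact h0 (map_zero _)
  refine (Polynomial.finite_setOfPred_isRoot hΔ0).subset fun s hs => ?_
  by_contra hr
  refine hs ?_
  rw [← hU, ← hU]
  exact hΔ _ fun h => hr (by simpa using h)

/-- The algebra of convergent sequences. -/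
def convSeq : Subalgebra ℂ (ℕ → ℂ) where
  carrier := {f | ∃ L, Filter.Tendsto f Filter.atTop (nhds L)}
  mul_mem' := fun ⟨L, hL⟩ ⟨L', hL'⟩ => ⟨L * L', hL.mul hL'⟩
  add_mem' := fun ⟨L, hL⟩ ⟨L', hL'⟩ => ⟨L + L', hL.add hL'⟩
  algebraMap_mem' := fun c => ⟨c, tendsto_const_nhds⟩

/-- The limit of a convergent sequence. -/
def convSeqLim : convSeq →ₐ[ℂ] ℂ where
  toFun f := f.2.choose
  map_one' := tendsto_nhds_unique (1 : convSeq).2.choose_spec tendsto_const_nhds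
  map_mul' f g := tendsto_nhds_unique (f * g).2.choose_spec (f.2.choose_spec.mul g.2.choose_spec)
  map_zero' := tendsto_nhds_unique (0 : convSeq).2.choose_spec tendsto_const_nhds
  map_add' f g := tendsto_nhds_unique (f + g).2.choose_spec (f.2.choose_spec.add g.2.choose_spec)
  commutes' c := tendsto_nhds_unique (algebraMap ℂ convSeq c).2.choose_spec tendsto_const_nhds

theorem tendsto_convSeqLim (f : convSeq) : Filter.Tendsto f.1 Filter.atTop (nhds (convSeqLim f)) :=
  f.2.choose_spec

theorem convSeqLim_eq {f : convSeq} {L : ℂ} (h : Filter.Tendsto f.1 Filter.atTop (nhds L)) :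
    convSeqLim f = L := tendsto_nhds_unique (tendsto_convSeqLim f) h

/-- A term of a convergent sequence. -/
def convSeqEval (r : ℕ) : convSeq →ₐ[ℂ] ℂ := (Pi.evalAlgHom ℂ (fun _ => ℂ) r).comp convSeq.val

open scoped Pointwise in
/-- The limit of a family of degeneracy loci has at least the length given by the number of points
converging to the origin. -/
theorem card_le_finrank_of_specializations {R : Type*} [CommRing R] [Algebra ℂ R]
    (lim : R →ₐ[ℂ] ℂ) (ev : ℕ → R →ₐ[ℂ] ℂ) (hev : ∀ Δ, lim Δ ≠ 0 → ∃ r, ev r Δ ≠ 0)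
    {ι : Type} [Fintype ι] (C : Fin n → Fin k → MvPolynomial (Fin m) (Polynomial ℂ)) (T : R)
    (hT : lim T = 0) (P : ι → Fin m → R) (hP : ∀ i l, lim (P i l) = 0)
    (hinj : ∀ r, Function.Injective fun i l => ev r (P i l))
    (hzero : ∀ r i, ∀ f ∈ maxMinors (famAt C (ev r T)),
      MvPolynomial.eval (fun l => ev r (P i l)) f = 0) :
    Fintype.card ι ≤ Module.finrank ℂ (MvPolynomial (Fin m) ℂ ⧸
      maxMinors (famAt C 0) ⊔ MvPolynomial.idealOfVars (Fin m) ℂ ^ Fintype.card ι) := by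
  classical
  set φ : Polynomial ℂ →+* R := ((Polynomial.aeval T : Polynomial ℂ →ₐ[ℂ] R) : Polynomial ℂ →+* R)
  set prods : (ι → Fin m) → MvPolynomial (Fin m) R := fun β =>
    ∏ i, (MvPolynomial.X (β i) - MvPolynomial.C (P i (β i)))
  set D : Fin n → Fin k → MvPolynomial (Fin m) R := fun i j => MvPolynomial.map φ (C i j)
  set U : Ideal (MvPolynomial (Fin m) R) := maxMinors D ⊔ Ideal.span (Set.range prods)
  have hD : ∀ (ev : R →ₐ[ℂ] ℂ), (maxMinors D).map (MvPolynomial.map (ev : R →+* ℂ)) =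
      maxMinors (famAt C (ev T)) := fun ev => by
    rw [maxMinors_map]
    congr 1
    funext i j
    have : (ev : R →+* ℂ).comp φ = Polynomial.evalRingHom (ev T) := by
      refine Polynomial.ringHom_ext (fun c => ?_) ?_
      · simp [φ]
      · simp [φ]
    rw [MvPolynomial.map_map, this]
    rfl
  have hfin : Module.Finite R (MvPolynomial (Fin m) R ⧸ U) :=
    finite_quotient_of_monic U fun l => ⟨∏ i, (Polynomial.X - Polynomial.C (P i l)),
      Polynomial.monic_prod_of_monic _ _ fun i _ => Polynomial.monic_X_sub_C _, by
      refine le_sup_right (a := maxMinors D) (Ideal.subset_span ⟨fun _ => l, ?_⟩)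
      simp [prods, MvPolynomial.algebraMap_eq]⟩
  obtain ⟨Δ, h0, hΔ⟩ := exists_finrank_specialIdeal_le U lim
  obtain ⟨r, hr⟩ := hev Δ h0
  have h1 := hΔ (ev r) hr
  have := finite_specialIdeal U (ev r)
  have := finite_specialIdeal U lim
  have h2 : Nat.card ι ≤ Module.finrank ℂ (MvPolynomial (Fin m) ℂ ⧸ specialIdeal U (ev r)) := by
    refine card_le_finrank_of_eval_eq_zero _ _ (hinj r) fun i => ?_
    have hle : specialIdeal U (ev r) ≤ RingHom.ker (MvPolynomial.eval fun l => ev r (P i l)) := by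
      rw [specialIdeal, Ideal.map_sup, hD]
      refine sup_le (fun f hf => hzero r i f hf) ?_
      rw [Ideal.map_span, Ideal.span_le]
      rintro _ ⟨_, ⟨β, rfl⟩, rfl⟩
      rw [SetLike.mem_coe, RingHom.mem_ker, map_prod, map_prod]
      refine Finset.prod_eq_zero (Finset.mem_univ i) ?_
      rw [map_sub, map_sub, MvPolynomial.map_X, MvPolynomial.map_C, MvPolynomial.eval_X,
        MvPolynomial.eval_C, sub_eq_zero]
      rfl
    exact fun f hf => hle hf
  have h3 : maxMinors (famAt C 0) ⊔ MvPolynomial.idealOfVars (Fin m) ℂ ^ Fintype.card ι ≤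
      specialIdeal U lim := by
    rw [specialIdeal, Ideal.map_sup, hD, hT]
    refine sup_le_sup le_rfl ?_
    have hpow : MvPolynomial.idealOfVars (Fin m) ℂ ^ Fintype.card ι =
        Ideal.span (∏ _i : ι, Set.range (MvPolynomial.X : Fin m → MvPolynomial (Fin m) ℂ)) := by
      rw [← Ideal.prod_span, Finset.prod_const, Finset.card_univ]
    rw [hpow, Ideal.map_span]
    refine Ideal.span_mono fun f hf => ?_
    obtain ⟨g, hg, rfl⟩ := Set.mem_fintype_prod _ _ |>.1 hf
    choose β hβ using hg
    refine ⟨_, ⟨β, rfl⟩, ?_⟩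
    rw [map_prod]
    refine Finset.prod_congr rfl fun i _ => ?_
    rw [map_sub, MvPolynomial.map_X, MvPolynomial.map_C]
    have : (lim : R →+* ℂ) (P i (β i)) = 0 := hP i (β i)
    rw [this, map_zero, sub_zero, hβ]
  have hfin' : Module.Finite ℂ (MvPolynomial (Fin m) ℂ ⧸
      maxMinors (famAt C 0) ⊔ MvPolynomial.idealOfVars (Fin m) ℂ ^ Fintype.card ι) :=
    finite_quotient_of_monic _ fun l => ⟨Polynomial.X ^ Fintype.card ι,
      Polynomial.monic_X_pow _, by
      rw [map_pow, Polynomial.aeval_X]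
      exact le_sup_right (a := maxMinors (famAt C 0))
        (Ideal.pow_mem_pow (Ideal.subset_span (Set.mem_range_self l)) _)⟩
  rw [← Nat.card_eq_fintype_card]
  rw [← Nat.card_eq_fintype_card] at h3 hfin'
  exact h2.trans (h1.trans (LinearMap.finrank_le_finrank_of_surjective
    (f := (Ideal.Quotient.factorₐ ℂ h3).toLinearMap) (Ideal.Quotient.factor_surjective h3)))

/-- Points of a family of degeneracy loci converging to the origin are counted by the length of the
limit. -/
theorem card_le_finrank_of_tendsto {ι : Type} [Fintype ι]
    (C : Fin n → Fin k → MvPolynomial (Fin m) (Polynomial ℂ)) (t : ℕ → ℂ)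
    (ht : Filter.Tendsto t Filter.atTop (nhds 0)) (p : ℕ → ι → Fin m → ℂ)
    (hp : ∀ i l, Filter.Tendsto (fun r => p r i l) Filter.atTop (nhds 0))
    (hinj : ∀ r, Function.Injective (p r))
    (hzero : ∀ r i, ∀ f ∈ maxMinors (famAt C (t r)), MvPolynomial.eval (p r i) f = 0) :
    Fintype.card ι ≤ Module.finrank ℂ (MvPolynomial (Fin m) ℂ ⧸
      maxMinors (famAt C 0) ⊔ MvPolynomial.idealOfVars (Fin m) ℂ ^ Fintype.card ι) :=
  card_le_finrank_of_specializations convSeqLim convSeqEval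
    (fun Δ h => ((tendsto_convSeqLim Δ).eventually_ne h).exists) C ⟨t, 0, ht⟩ (convSeqLim_eq ht)
    (fun i l => ⟨fun r => p r i l, 0, hp i l⟩) (fun i l => convSeqLim_eq (hp i l)) hinj hzero

end Families

section LinearForms

/-- The linear form of the moment curve with parameter `j`. -/
def momentForm (m j : ℕ) (z : Fin m → ℂ) : ℂ := ∑ l : Fin m, (j : ℂ) ^ (l : ℕ) * z l

/-- The polynomial with given coefficients. -/
def coeffPoly {m : ℕ} (z : Fin m → ℂ) : Polynomial ℂ := ∑ l : Fin m, Polynomial.monomial (l : ℕ) (z l)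

theorem coeff_coeffPoly {m : ℕ} (z : Fin m → ℂ) (l : Fin m) : (coeffPoly z).coeff l = z l := by
  rw [coeffPoly, Polynomial.finsetSum_coeff, Finset.sum_eq_single l]
  · simp
  · intro l' _ h
    rw [Polynomial.coeff_monomial, if_neg (fun h' => h (Fin.ext h'))]
  · simp

theorem eval_coeffPoly {m : ℕ} (z : Fin m → ℂ) (j : ℕ) :
    (coeffPoly z).eval (j : ℂ) = momentForm m j z := by
  rw [coeffPoly, Polynomial.eval_finsetSum, momentForm]
  exact Finset.sum_congr rfl fun l _ => by rw [Polynomial.eval_monomial, mul_comm]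

theorem degree_coeffPoly_lt {m : ℕ} (z : Fin m → ℂ) : (coeffPoly z).degree < m := by
  rw [Polynomial.degree_lt_iff_coeff_zero]
  intro N hN
  rw [coeffPoly, Polynomial.finsetSum_coeff]
  refine Finset.sum_eq_zero fun l _ => ?_
  rw [Polynomial.coeff_monomial, if_neg (by omega)]

theorem momentForm_smul (m j : ℕ) (t : ℂ) (z : Fin m → ℂ) :
    momentForm m j (t • z) = t * momentForm m j z := by
  rw [momentForm, momentForm, Finset.mul_sum]
  exact Finset.sum_congr rfl fun l _ => by simp; ring

theorem momentForm_add (m j : ℕ) (z z' : Fin m → ℂ) :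
    momentForm m j (z + z') = momentForm m j z + momentForm m j z' := by
  rw [momentForm, momentForm, momentForm, ← Finset.sum_add_distrib]
  exact Finset.sum_congr rfl fun l _ => by simp; ring

variable {m k : ℕ} {S : Finset (Fin k)}

theorem injective_cast_fin (S : Finset (Fin k)) :
    Set.InjOn (fun j : Fin k => ((j : ℕ) : ℂ)) S :=
  fun _ _ _ _ h => Fin.ext (Nat.cast_injective h)

theorem coeffPoly_eq_interpolate (hS : S.card = m) (z : Fin m → ℂ) :
    coeffPoly z = Lagrange.interpolate S (fun j : Fin k => ((j : ℕ) : ℂ))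
      fun j => momentForm m j z := by
  have := Lagrange.eq_interpolate (f := coeffPoly z) (injective_cast_fin S)
    (by rw [hS]; exact degree_coeffPoly_lt z)
  simpa only [eval_coeffPoly] using this

theorem eq_of_momentForm_eq (hS : S.card = m) {z z' : Fin m → ℂ}
    (h : ∀ j ∈ S, momentForm m j z = momentForm m j z') : z = z' := by
  have : coeffPoly z = coeffPoly z' := by
    rw [coeffPoly_eq_interpolate hS, coeffPoly_eq_interpolate hS]
    exact Lagrange.interpolate_eq_of_values_eq_on (s := S) (v := fun j : Fin k => ((j : ℕ) : ℂ)) _ _ h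
  funext l
  rw [← coeff_coeffPoly z, this, coeff_coeffPoly]

theorem exists_momentForm_eq (hS : S.card = m) (v : Fin k → ℂ) :
    ∃ z : Fin m → ℂ, ∀ j ∈ S, momentForm m j z = v j := by
  set P := Lagrange.interpolate S (fun j : Fin k => ((j : ℕ) : ℂ)) v
  have hdeg : P.degree < m := by
    have := Lagrange.degree_interpolate_lt v (injective_cast_fin S)
    rwa [hS] at this
  refine ⟨fun l => P.coeff l, fun j hj => ?_⟩
  have hP : coeffPoly (fun l : Fin m => P.coeff l) = P := by
    ext N
    by_cases hN : N < m
    · exact coeff_coeffPoly _ ⟨N, hN⟩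
    · rw [Polynomial.coeff_eq_zero_of_degree_lt (n := N),
        Polynomial.coeff_eq_zero_of_degree_lt (n := N)]
      · exact hdeg.trans_le (by exact_mod_cast not_lt.1 hN)
      · exact (degree_coeffPoly_lt _).trans_le (by exact_mod_cast not_lt.1 hN)
  rw [← eval_coeffPoly, hP]
  exact Lagrange.eval_interpolate_at_node v (injective_cast_fin S) hj

theorem exists_momentForm_eq_rat_sum (hS : S.card = m) (q : Fin k) :
    ∃ r : Fin k → ℚ, ∀ z : Fin m → ℂ, momentForm m q z = ∑ j ∈ S, (r j : ℂ) * momentForm m j z := by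
  refine ⟨fun j => ∏ i ∈ S.erase j, (((j : ℕ) : ℚ) - ((i : ℕ) : ℚ))⁻¹ * (((q : ℕ) : ℚ) - ((i : ℕ) : ℚ)),
    fun z => ?_⟩
  rw [← eval_coeffPoly, coeffPoly_eq_interpolate hS, Lagrange.interpolate_apply,
    Polynomial.eval_finsetSum]
  refine Finset.sum_congr rfl fun j _ => ?_
  rw [Polynomial.eval_mul, Polynomial.eval_C, mul_comm, Lagrange.basis, Polynomial.eval_prod]
  congr 1
  push_cast
  refine Finset.prod_congr rfl fun i _ => ?_
  simp [Lagrange.basisDivisor]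

end LinearForms

section LocalSolutions

theorem HasDerivAt.comp_fst {E F : Type*} [NormedAddCommGroup E] [NormedSpace ℂ E]
    [NormedAddCommGroup F] [NormedSpace ℂ F] {g : ℂ → E × F} {g' : E × F} {x : ℂ}
    (h : HasDerivAt g g' x) : HasDerivAt (fun τ => (g τ).1) g'.1 x :=
  (ContinuousLinearMap.fst ℂ E F).hasFDerivAt.comp_hasDerivAt x h

theorem HasDerivAt.comp_snd {E F : Type*} [NormedAddCommGroup E] [NormedSpace ℂ E]
    [NormedAddCommGroup F] [NormedSpace ℂ F] {g : ℂ → E × F} {g' : E × F} {x : ℂ}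
    (h : HasDerivAt g g' x) : HasDerivAt (fun τ => (g τ).2) g'.2 x :=
  (ContinuousLinearMap.snd ℂ E F).hasFDerivAt.comp_hasDerivAt x h

variable {m ν k : ℕ}

theorem eq_zero_iff_of_ties {Q : Finset (Fin k)} {T : Fin k → Finset (Fin (ν + 1))}
    (hQ : ∀ j ∈ Q, (T j).card = 2)
    (hconn : ∀ M : Finset (Fin (ν + 1)), M.Nonempty → Mᶜ.Nonempty →
      ∃ j ∈ Q, ∃ i ∈ M, ∃ l ∈ Mᶜ, i ∈ T j ∧ l ∈ T j)
    {L : Fin (ν + 1) → Fin k → ℂ} (hL : ∀ j ∈ Q, ∀ i ∈ T j, L i j ≠ 0)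
    {y : Fin (ν + 1) → ℂ} (hy : ∀ j ∈ Q, ∑ i ∈ T j, y i * L i j = 0) (i : Fin (ν + 1)) :
    y i = 0 ↔ y 0 = 0 := by
  classical
  set M : Finset (Fin (ν + 1)) := {i | y i = 0 ↔ y 0 = 0} with hM
  by_contra hi
  obtain ⟨j, hj, i, hiM, l, hlM, hij, hlj⟩ := hconn M ⟨0, by simp [hM]⟩ ⟨i, by simp [hM, hi]⟩
  have hil : i ≠ l := by
    rintro rfl
    exact Finset.mem_compl.1 hlM hiM
  have hT : T j = {i, l} := (Finset.eq_of_subset_of_card_le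
    (by intro x; simp only [Finset.mem_insert, Finset.mem_singleton]; rintro (rfl | rfl) <;> assumption)
    (by rw [hQ j hj, Finset.card_pair hil])).symm
  have h1 := hy j hj
  rw [hT, Finset.sum_pair hil] at h1
  refine Finset.mem_compl.1 hlM ?_
  rw [hM, Finset.mem_filter] at hiM ⊢
  refine ⟨Finset.mem_univ _, Iff.trans ⟨fun h => ?_, fun h => ?_⟩ hiM.2⟩
  · rw [h, zero_mul, add_zero] at h1
    exact (mul_eq_zero.1 h1).resolve_right (hL j hj i hij)
  · rw [h, zero_mul, zero_add] at h1
    exact (mul_eq_zero.1 h1).resolve_right (hL j hj l hlj)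

theorem exists_ties_solution {Q : Finset (Fin k)} (hQν : Q.card = ν)
    {T : Fin k → Finset (Fin (ν + 1))} (hQ : ∀ j ∈ Q, (T j).card = 2)
    (hconn : ∀ M : Finset (Fin (ν + 1)), M.Nonempty → Mᶜ.Nonempty →
      ∃ j ∈ Q, ∃ i ∈ M, ∃ l ∈ Mᶜ, i ∈ T j ∧ l ∈ T j)
    {L : Fin (ν + 1) → Fin k → ℂ} (hL : ∀ j ∈ Q, ∀ i ∈ T j, L i j ≠ 0) :
    ∃ y : Fin (ν + 1) → ℂ, y 0 = 1 ∧ (∀ i, y i ≠ 0) ∧ ∀ j ∈ Q, ∑ i ∈ T j, y i * L i j = 0 := by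
  let F : (Fin (ν + 1) → ℂ) →ₗ[ℂ] (Q → ℂ) :=
    LinearMap.pi fun j => ∑ i ∈ T j, (L i j) • LinearMap.proj i
  have hF : ∀ y j, F y j = ∑ i ∈ T j, y i * L i j := fun y j => by
    simp [F, mul_comm]
  obtain ⟨y, hy, hy0⟩ := (Submodule.ne_bot_iff _).1
    (LinearMap.ker_ne_bot_of_finrank_lt (f := F) (by simp [hQν]))
  have hyQ : ∀ j ∈ Q, ∑ i ∈ T j, y i * L i j = 0 := fun j hj => by
    have := congrFun (LinearMap.mem_ker.1 hy) ⟨j, hj⟩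
    rwa [hF] at this
  have hiff := eq_zero_iff_of_ties hQ hconn hL hyQ
  have h00 : y 0 ≠ 0 := fun h => hy0 (funext fun i => (hiff i).2 h)
  refine ⟨fun i => (y 0)⁻¹ * y i, inv_mul_cancel₀ h00,
    fun i => mul_ne_zero (inv_ne_zero h00) fun h => h00 ((hiff i).1 h), fun j hj => ?_⟩
  simp_rw [mul_assoc]
  rw [← Finset.mul_sum, hyQ j hj, mul_zero]

theorem eventually_exists_solution (hmk : m + ν = k) {Q : Finset (Fin k)} (hQν : Q.card = ν)
    {T : Fin k → Finset (Fin (ν + 1))} (hQ : ∀ j ∈ Q, (T j).card = 2)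
    (hconn : ∀ M : Finset (Fin (ν + 1)), M.Nonempty → Mᶜ.Nonempty →
      ∃ j ∈ Q, ∃ i ∈ M, ∃ l ∈ Mᶜ, i ∈ T j ∧ l ∈ T j)
    {L a : Fin (ν + 1) → Fin k → (Fin m → ℂ) → ℂ} (hLd : ∀ i j, ContDiff ℂ 1 (L i j))
    (had : ∀ i j, ContDiff ℂ 1 (a i j)) {p : Fin m → ℂ}
    (hL : ∀ j ∈ Q, ∀ i ∈ T j, L i j p ≠ 0) {f : Fin k → Fin (ν + 1)}
    (hf : ∀ j ∉ Q, T j = {f j}) (h0 : ∀ j ∉ Q, L (f j) j p = 0)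
    (hD : ∀ v, (∀ j ∉ Q, fderiv ℂ (L (f j) j) p v = 0) → v = 0)
    {V : Set (Fin m → ℂ)} (hV : V ∈ nhds p) :
    ∀ᶠ e : (Fin (ν + 1) → Fin k → ℂ) × (Fin (ν + 1) → Fin k → ℂ) in
      nhds (fun i j => if i ∈ T j then 1 else 0, 0),
      ∃ z ∈ V, ∃ y : Fin (ν + 1) → ℂ, y ≠ 0 ∧
        ∀ j, ∑ i, y i * (e.1 i j * (L i j z + e.2 i j * a i j z)) = 0 := by
  classical
  obtain ⟨y, hy0, hyne, hy⟩ := exists_ties_solution hQν hQ hconn hL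
  set θ : Fin (ν + 1) → Fin k → ℂ := fun i j => if i ∈ T j then 1 else 0 with hθ
  have hsum : ∀ (j : Fin k) (g : Fin (ν + 1) → ℂ), ∑ i, θ i j * g i = ∑ i ∈ T j, g i :=
    fun j g => by simp [hθ]
  let Ψ : ((Fin (ν + 1) → Fin k → ℂ) × (Fin (ν + 1) → Fin k → ℂ)) ×
      ((Fin m → ℂ) × (Fin (ν + 1) → ℂ)) → ((Fin (ν + 1) → Fin k → ℂ) ×
      (Fin (ν + 1) → Fin k → ℂ)) × ((Fin k → ℂ) × ℂ) := fun x =>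
    (x.1, (fun j => ∑ i, x.2.2 i * (x.1.1 i j * (L i j x.2.1 + x.1.2 i j * a i j x.2.1)),
      x.2.2 0 - 1))
  set x₀ : ((Fin (ν + 1) → Fin k → ℂ) × (Fin (ν + 1) → Fin k → ℂ)) ×
      ((Fin m → ℂ) × (Fin (ν + 1) → ℂ)) := ((θ, 0), (p, y))
  have hΨ : ContDiff ℂ 1 Ψ := by
    refine contDiff_fst.prodMk (ContDiff.prodMk (contDiff_pi.2 fun j => ?_) (by fun_prop))
    refine ContDiff.sum fun i _ => ?_
    have h1 : ContDiff ℂ 1 fun x : ((Fin (ν + 1) → Fin k → ℂ) × (Fin (ν + 1) → Fin k → ℂ)) ×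
      ((Fin m → ℂ) × (Fin (ν + 1) → ℂ)) => L i j x.2.1 := (hLd i j).comp (by fun_prop)
    have h2 : ContDiff ℂ 1 fun x : ((Fin (ν + 1) → Fin k → ℂ) × (Fin (ν + 1) → Fin k → ℂ)) ×
      ((Fin m → ℂ) × (Fin (ν + 1) → ℂ)) => a i j x.2.1 := (had i j).comp (by fun_prop)
    fun_prop
  have hΨ₀ : Ψ x₀ = ((θ, 0), 0) := by
    refine Prod.ext rfl (Prod.ext (funext fun j => ?_) ?_)
    · change ∑ i, y i * (θ i j * (L i j p + 0 * a i j p)) = 0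
      have : ∀ i, y i * (θ i j * (L i j p + 0 * a i j p)) = θ i j * (y i * L i j p) :=
        fun i => by ring
      rw [Finset.sum_congr rfl fun i _ => this i, hsum]
      by_cases hj : j ∈ Q
      · exact hy j hj
      · rw [hf j hj, Finset.sum_singleton, h0 j hj, mul_zero]
    · change y 0 - 1 = 0
      rw [hy0, sub_self]
  have hstrict := hΨ.contDiffAt.hasStrictFDerivAt (x := x₀) one_ne_zero
  have hinj : Function.Injective (fderiv ℂ Ψ x₀) := by
    refine (injective_iff_map_eq_zero _).2 ?_
    intro x hx
    have hline : HasDerivAt (fun τ : ℂ => x₀ + τ • x) x 0 := by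
      have h := HasDerivAt.const_add x₀ (HasDerivAt.smul_const (hasDerivAt_id (0 : ℂ)) x)
      rwa [one_smul] at h
    have h1 : HasDerivAt (fun τ : ℂ => Ψ (x₀ + τ • x)) 0 0 := by
      rw [← hx]
      have hF : HasFDerivAt Ψ (fderiv ℂ Ψ x₀) (x₀ + (0 : ℂ) • x) := by
        rw [zero_smul, add_zero]
        exact hstrict.hasFDerivAt
      exact hF.comp_hasDerivAt (0 : ℂ) hline
    obtain ⟨u, v, w⟩ := x
    have hu : u = 0 := by
      have h2 := h1.comp_fst
      have h3 := hline.comp_fst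
      exact h3.unique h2
    subst hu
    have hw0 : w 0 = 0 := by
      have h2 := h1.comp_snd.comp_snd
      have h3 : HasDerivAt (fun τ : ℂ => y 0 + τ * w 0 - 1) (w 0) 0 := by
        simpa using (((hasDerivAt_id (0 : ℂ)).mul_const (w 0)).const_add (y 0)).sub_const 1
      exact h3.unique h2
    have hcol : ∀ j, ∑ i ∈ T j, (w i * L i j p + y i * fderiv ℂ (L i j) p v) = 0 := fun j => by
      have h2 := hasDerivAt_pi.1 h1.comp_snd.comp_fst j
      have h3 : HasDerivAt (fun τ : ℂ => ∑ i, (y i + τ * w i) * (θ i j * (L i j (p + τ • v))))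
          (∑ i, (w i * (θ i j * L i j p) + y i * (θ i j * fderiv ℂ (L i j) p v))) 0 := by
        refine HasDerivAt.fun_sum fun i _ => ?_
        have h4 : HasDerivAt (fun τ : ℂ => y i + τ * w i) (w i) 0 := by
          simpa using ((hasDerivAt_id (0 : ℂ)).mul_const (w i)).const_add (y i)
        have h5 : HasDerivAt (fun τ : ℂ => p + τ • v) v 0 := by
          simpa using ((hasDerivAt_id (0 : ℂ)).smul_const v).const_add p
        have h6 : HasDerivAt (fun τ : ℂ => L i j (p + τ • v)) (fderiv ℂ (L i j) p v) 0 := by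
          refine HasFDerivAt.comp_hasDerivAt (0 : ℂ) ?_ h5
          simpa using ((hLd i j).differentiable one_ne_zero p).hasFDerivAt
        have h8 := h4.fun_mul (h6.const_mul (θ i j))
        rwa [zero_smul, add_zero, zero_mul, add_zero] at h8
      have h7 : (∑ i, (w i * (θ i j * L i j p) + y i * (θ i j * fderiv ℂ (L i j) p v))) = 0 := by
        refine h3.unique (h2.congr_of_eventuallyEq (Filter.Eventually.of_forall fun τ => ?_))
        simp [Ψ, x₀]
      rw [← hsum, ← h7]
      exact Finset.sum_congr rfl fun i _ => by ring
    have hv : v = 0 := hD v fun j hj => by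
      have := hcol j
      rw [hf j hj, Finset.sum_singleton, h0 j hj, mul_zero, zero_add] at this
      exact (mul_eq_zero.1 this).resolve_left (hyne _)
    subst hv
    have hw : w = 0 := funext fun i => by
      refine (eq_zero_iff_of_ties hQ hconn hL (fun j hj => ?_) i).2 hw0
      simpa using hcol j
    rw [hw]
    rfl
  have hsurj : (fderiv ℂ Ψ x₀).range = ⊤ := by
    refine LinearMap.range_eq_top.2 ?_
    refine (LinearMap.injective_iff_surjective_of_finrank_eq_finrank
      (f := (fderiv ℂ Ψ x₀).toLinearMap) ?_).1 hinj
    simp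
    omega
  have hmap := hstrict.map_nhds_eq_of_surj hsurj
  rw [hΨ₀] at hmap
  have hnb : {x : ((Fin (ν + 1) → Fin k → ℂ) × (Fin (ν + 1) → Fin k → ℂ)) ×
      ((Fin m → ℂ) × (Fin (ν + 1) → ℂ)) | x.2.1 ∈ V} ∈ nhds x₀ :=
    (continuous_snd.fst.continuousAt (x := x₀)).preimage_mem_nhds hV
  have himg := Filter.image_mem_map (m := Ψ) hnb
  rw [hmap] at himg
  have hcont : Filter.Tendsto (fun e : (Fin (ν + 1) → Fin k → ℂ) × (Fin (ν + 1) → Fin k → ℂ) =>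
      (e, (0 : (Fin k → ℂ) × ℂ))) (nhds (θ, 0)) (nhds ((θ, 0), 0)) :=
    (Continuous.prodMk continuous_id continuous_const).tendsto' _ _ rfl
  filter_upwards [hcont himg] with e he
  obtain ⟨⟨e', z, y'⟩, hz, hx⟩ := he
  obtain rfl : e' = e := congrArg Prod.fst hx
  have h2 := congrArg Prod.snd hx
  refine ⟨z, hz, y', ?_, fun j => congrFun (congrArg Prod.fst h2) j⟩
  rintro rfl
  have h3 : (0 : Fin (ν + 1) → ℂ) 0 - 1 = (0 : ℂ) := congrArg Prod.snd h2
  simp at h3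

end LocalSolutions

section ProductForms

variable {m ν k : ℕ} {d : Fin (ν + 1) → Fin k → ℕ}

/-- The product of the translates of the `j`-th linear form by the constants `c i j s`. -/
def prodForm (m : ℕ) (c : ∀ i j, Fin (d i j) → ℂ) (i : Fin (ν + 1)) (j : Fin k)
    (z : Fin m → ℂ) : ℂ := ∏ s, (momentForm m j z - c i j s)

theorem contDiff_momentForm (m j : ℕ) : ContDiff ℂ 1 (momentForm m j) := by
  unfold momentForm
  fun_prop

theorem contDiff_prodForm (c : ∀ i j, Fin (d i j) → ℂ) (i : Fin (ν + 1)) (j : Fin k) :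
    ContDiff ℂ 1 (prodForm m c i j) :=
  contDiff_prod fun _ _ => (contDiff_momentForm m j).sub contDiff_const

/-- The constants `c i j s` are linearly independent over the rational numbers. -/
def IndependentConstants (c : ∀ i j, Fin (d i j) → ℂ) : Prop :=
  LinearIndependent ℚ fun p : Σ q : Fin (ν + 1) × Fin k, Fin (d q.1 q.2) => c p.1.1 p.1.2 p.2

theorem exists_independentConstants (d : Fin (ν + 1) → Fin k → ℕ) :
    ∃ c : ∀ i j, Fin (d i j) → ℂ, IndependentConstants c := by
  obtain ⟨b, hb⟩ := exists_linearIndependent_rat_real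
    (Σ q : Fin (ν + 1) × Fin k, Fin (d q.1 q.2))
  refine ⟨fun i j s => (b ⟨(i, j), s⟩ : ℂ), ?_⟩
  exact hb.map' (Complex.ofRealCLM.toLinearMap.restrictScalars ℚ)
    (LinearMap.ker_eq_bot.2 Complex.ofReal_injective)

variable {c : ∀ i j, Fin (d i j) → ℂ}

theorem IndependentConstants.injective (hc : IndependentConstants c) (i : Fin (ν + 1))
    (j : Fin k) : Function.Injective (c i j) := fun s s' h => by
  have := LinearIndependent.injective hc (a₁ := ⟨(i, j), s⟩) (a₂ := ⟨(i, j), s'⟩) h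
  simpa using this

theorem IndependentConstants.momentForm_ne (hc : IndependentConstants c) {S : Finset (Fin k)}
    (hS : S.card = m) {z : Fin m → ℂ} (hz : ∀ j ∈ S, ∃ i s, momentForm m j z = c i j s)
    {q : Fin k} (hq : q ∉ S) (i : Fin (ν + 1)) (s : Fin (d i q)) : momentForm m q z ≠ c i q s := by
  intro h
  obtain ⟨r, hr⟩ := exists_momentForm_eq_rat_sum hS q
  refine LinearIndependent.notMem_span_image hc (s := {p | p.1.2 ∈ S}) (x := ⟨(i, q), s⟩) hq ?_
  change c i q s ∈ _
  rw [← h, hr z]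
  refine Submodule.sum_mem _ fun j hj => ?_
  obtain ⟨i', s', h'⟩ := hz j hj
  rw [h', ← Rat.smul_def]
  exact Submodule.smul_mem _ _ (Submodule.subset_span ⟨⟨(i', j), s'⟩, hj, rfl⟩)

theorem fderiv_prodForm {i : Fin (ν + 1)} {j : Fin k} (hc : Function.Injective (c i j))
    {s : Fin (d i j)} {p : Fin m → ℂ} (hp : momentForm m j p = c i j s) :
    ∃ μ : ℂ, μ ≠ 0 ∧ ∀ v, fderiv ℂ (prodForm m c i j) p v = μ * momentForm m j v := by
  let R : (Fin m → ℂ) → ℂ := fun z => ∏ s' ∈ Finset.univ.erase s, (momentForm m j z - c i j s')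
  have hR : ContDiff ℂ 1 R :=
    contDiff_prod fun _ _ => (contDiff_momentForm m j).sub contDiff_const
  refine ⟨R p, Finset.prod_ne_zero_iff.2 fun s' hs' => ?_, fun v => ?_⟩
  · rw [hp, sub_ne_zero]
    exact fun h => Finset.ne_of_mem_erase hs' (hc h).symm
  have h1 : HasDerivAt (fun τ : ℂ => p + τ • v) v 0 := by
    simpa using ((hasDerivAt_id (0 : ℂ)).smul_const v).const_add p
  have hfd : ∀ g : (Fin m → ℂ) → ℂ, ContDiff ℂ 1 g →
      HasDerivAt (fun τ : ℂ => g (p + τ • v)) (fderiv ℂ g p v) 0 := fun g hg => by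
    have hF : HasFDerivAt g (fderiv ℂ g p) (p + (0 : ℂ) • v) := by
      rw [zero_smul, add_zero]
      exact (hg.differentiable one_ne_zero p).hasFDerivAt
    exact hF.comp_hasDerivAt (0 : ℂ) h1
  have h2 := hfd _ (contDiff_prodForm c i j)
  have h3 : HasDerivAt (fun τ : ℂ => τ * momentForm m j v) (momentForm m j v) 0 := by
    simpa using (hasDerivAt_id (0 : ℂ)).mul_const (momentForm m j v)
  have h4 := h3.fun_mul (hfd R hR)
  rw [zero_smul, add_zero, zero_mul, zero_mul, add_zero, mul_comm] at h4
  refine h2.unique (h4.congr_of_eventuallyEq (Filter.Eventually.of_forall fun τ => ?_))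
  change prodForm m c i j (p + τ • v) = τ * momentForm m j v * R (p + τ • v)
  rw [prodForm, ← Finset.mul_prod_erase _ _ (Finset.mem_univ s)]
  congr 1
  rw [momentForm_add, momentForm_smul, hp]
  ring

theorem eventually_exists_solution_prodForm (hmk : m + ν = k)
    {W : Fin (ν + 1) → Fin k → ℝ}
    (hW : LinearIndependent ℚ fun p : Fin (ν + 1) × Fin k => W p.1 p.2)
    (hc : IndependentConstants c) {a : Fin (ν + 1) → Fin k → (Fin m → ℂ) → ℂ}
    (had : ∀ i j, ContDiff ℂ 1 (a i j)) {Q : Finset (Fin k)} {w : Fin (ν + 1) → ℝ}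
    (hQν : Q.card = ν) (hw : IsTiePoint W Q w)
    {p : Fin m → ℂ} (hp : ∀ j ∉ Q, ∃ s, momentForm m j p = c (argRow W w j) j s)
    {V : Set (Fin m → ℂ)} (hV : V ∈ nhds p) :
    ∀ᶠ e : (Fin (ν + 1) → Fin k → ℂ) × (Fin (ν + 1) → Fin k → ℂ) in
      nhds (fun i j => if i ∈ tightRows W w j then 1 else 0, 0),
      ∃ z ∈ V, ∃ y : Fin (ν + 1) → ℂ, y ≠ 0 ∧
        ∀ j, ∑ i, y i * (e.1 i j * (prodForm m c i j z + e.2 i j * a i j z)) = 0 := by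
  have hcard : Q.card + 1 = Fintype.card (Fin (ν + 1)) := by simp [hQν]
  have hS : Qᶜ.card = m := by
    rw [Finset.card_compl, Fintype.card_fin]
    omega
  have hz : ∀ j ∈ Qᶜ, ∃ i s, momentForm m j p = c i j s := fun j hj =>
    ⟨_, hp j (Finset.mem_compl.1 hj)⟩
  refine eventually_exists_solution hmk hQν
    (fun j hj => card_tightRows_eq_two W hW w Q hw.2 hcard hj)
    (fun M hM hM' => exists_tie_across W hW w Q hw.2 hcard M hM hM')
    (contDiff_prodForm c) had (fun j hj i _ => ?_) (f := argRow W w) (fun j hj => ?_)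
    (fun j hj => ?_) (fun v hv => ?_) hV
  · refine Finset.prod_ne_zero_iff.2 fun s _ => sub_ne_zero.2 ?_
    exact hc.momentForm_ne hS hz (by simpa using hj) i s
  · have h1 := card_tightRows_lt_two W hW w Q hw.2 hcard hj
    refine (Finset.eq_of_subset_of_card_le ?_ ?_).symm
    · exact Finset.singleton_subset_iff.2 (argRow_mem W w j)
    · rw [Finset.card_singleton]
      omega
  · obtain ⟨s, hs⟩ := hp j hj
    exact Finset.prod_eq_zero (Finset.mem_univ s) (sub_eq_zero.2 hs)
  · refine eq_of_momentForm_eq hS fun j hj => ?_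
    rw [Finset.mem_compl] at hj
    obtain ⟨s, hs⟩ := hp j hj
    obtain ⟨μ, hμ, h⟩ := fderiv_prodForm (hc.injective _ j) hs
    have h0 := hv j hj
    rw [h v] at h0
    rw [(mul_eq_zero.1 h0).resolve_left hμ]
    simp [momentForm]

end ProductForms

section Perturbation

variable {m ν k : ℕ} {d : Fin (ν + 1) → Fin k → ℕ}

theorem exists_int_near_tiePoint {W : Fin (ν + 1) → Fin k → ℝ}
    (hW : LinearIndependent ℚ fun p : Fin (ν + 1) × Fin k => W p.1 p.2) {δ : ℝ} (hδ : 0 ≤ δ)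
    (hdW : ∀ i j, (d i j : ℝ) ≤ W i j ∧ W i j < d i j + δ) {Q : Finset (Fin k)}
    (hQ : Q.card = ν) {w : Fin (ν + 1) → ℝ} (hw : IsTiePoint W Q w) :
    ∃ u : Fin (ν + 1) → ℤ, ∀ i, |w i - u i| ≤ ν * δ := by
  have key : ∀ t : ℕ, t ≤ ν → ∃ M : Finset (Fin (ν + 1)), M.card = t + 1 ∧
      ∃ u : Fin (ν + 1) → ℤ, ∀ i ∈ M, |w i - u i| ≤ t * δ := by
    intro t
    induction t with
    | zero =>
      intro _
      exact ⟨{0}, by simp, 0, by simp [hw.1]⟩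
    | succ t ih =>
      intro ht
      obtain ⟨M, hM, u, hu⟩ := ih (by omega)
      obtain ⟨j, -, i, hi, l, hl, hij, hlj⟩ := exists_tie_across W hW w Q hw.2 (by simp [hQ]) M
        (Finset.card_pos.1 (by omega))
        (Finset.card_pos.1 (by rw [Finset.card_compl, Fintype.card_fin]; omega))
      rw [Finset.mem_compl] at hl
      refine ⟨insert l M, by rw [Finset.card_insert_of_notMem hl, hM],
        Function.update u l (u i + d i j - d l j), fun i' hi' => ?_⟩
      rcases Finset.mem_insert.1 hi' with rfl | hi'M
      · have h1 := abs_le.1 (hu i hi)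
        have h2 := mem_tightRows.1 hij i'
        have h3 := mem_tightRows.1 hlj i
        have h4 := hdW i j
        have h5 := hdW i' j
        rw [Function.update_self, abs_le]
        push_cast
        constructor <;> linarith [h1.1, h1.2, h4.1, h4.2, h5.1, h5.2]
      · rw [Function.update_of_ne (by rintro rfl; exact hl hi'M)]
        refine (hu i' hi'M).trans ?_
        push_cast
        linarith
  obtain ⟨M, hM, u, hu⟩ := key ν le_rfl
  have hMu : M = Finset.univ := Finset.card_eq_iff_eq_univ _ |>.1 (by simp [hM])
  exact ⟨u, fun i => hu i (by simp [hMu])⟩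

/-- At a tie point, the rows which are tight for the perturbed degrees are also tight for the
degrees themselves, up to a perturbation of the tie point. -/
theorem exists_weights_of_isTiePoint {W : Fin (ν + 1) → Fin k → ℝ}
    (hW : LinearIndependent ℚ fun p : Fin (ν + 1) × Fin k => W p.1 p.2) {δ : ℝ} (hδ : 0 ≤ δ)
    (hνδ : (2 * ν + 1) * δ ≤ 1) (hdW : ∀ i j, (d i j : ℝ) ≤ W i j ∧ W i j < d i j + δ)
    {Q : Finset (Fin k)} (hQ : Q.card = ν) {w : Fin (ν + 1) → ℝ} (hw : IsTiePoint W Q w) :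
    ∃ u : Fin (ν + 1) → ℝ, ∀ j, ∀ i ∈ tightRows W w j, ∀ l,
      (d i j : ℝ) + u i ≤ d l j + u l := by
  obtain ⟨u, hu⟩ := exists_int_near_tiePoint hW hδ hdW hQ hw
  refine ⟨fun i => u i, fun j i hi l => ?_⟩
  have h1 := mem_tightRows.1 hi l
  have h2 := abs_le.1 (hu i)
  have h3 := abs_le.1 (hu l)
  have h4 := (hdW i j).1
  have h5 := (hdW l j).2
  have h6 : (d i j : ℝ) + u i < d l j + u l + 1 := by linarith [h2.1, h3.2]
  have h7 : (d i j : ℤ) + u i < d l j + u l + 1 := by exact_mod_cast h6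
  have h8 := Int.lt_add_one_iff.1 h7
  dsimp only
  exact_mod_cast h8

theorem rescaling_identity {η t s W' w' v u v₀ : ℝ} (hη : 0 < η) (ht : 0 < t) (d' : ℕ)
    (y L a : ℂ) :
    (y * ((η ^ w' * t ^ u : ℝ) : ℂ)) *
      (((t * η : ℝ) : ℂ) ^ d' * ((s⁻¹ : ℝ) * a + ((η ^ (W' - d') : ℝ) : ℂ) * L)) =
    ((η ^ v * t ^ v₀ : ℝ) : ℂ) * (y * (((η ^ (W' + w' - v) * t ^ (d' + u - v₀) : ℝ) : ℂ) *
      (L + ((s⁻¹ * η ^ (-(W' - d')) : ℝ) : ℂ) * a))) := by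
  have h1 : η ^ v * t ^ v₀ * (η ^ (W' + w' - v) * t ^ (d' + u - v₀)) =
      η ^ w' * t ^ u * (t * η) ^ d' * η ^ (W' - d') := by
    have e1 : η ^ v * η ^ (W' + w' - v) = η ^ w' * η ^ d' * η ^ (W' - d') := by
      rw [← Real.rpow_add hη, ← Real.rpow_natCast, ← Real.rpow_add hη, ← Real.rpow_add hη]
      ring_nf
    have e2 : t ^ v₀ * t ^ (d' + u - v₀) = t ^ u * t ^ d' := by
      rw [← Real.rpow_add ht, ← Real.rpow_natCast, ← Real.rpow_add ht]
      ring_nf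
    rw [mul_mul_mul_comm, e1, e2, mul_pow]
    ring
  have h2 : η ^ (W' - d') * η ^ (-(W' - d')) = 1 := by
    rw [← Real.rpow_add hη, add_neg_cancel, Real.rpow_zero]
  have h1' := congrArg (fun x : ℝ => (x : ℂ)) h1
  have h2' := congrArg (fun x : ℝ => (x : ℂ)) h2
  simp only [Complex.ofReal_mul, Complex.ofReal_pow, Complex.ofReal_one] at h1' h2' ⊢
  linear_combination (-y * (L + ((s⁻¹ : ℝ) : ℂ) * ((η ^ (-(W' - d')) : ℝ) : ℂ) * a)) * h1' +
    (-y * ((η ^ w' : ℝ) : ℂ) * ((t ^ u : ℝ) : ℂ) * (t * η) ^ d' * ((s⁻¹ : ℝ) : ℂ) * a) * h2'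

variable {c : ∀ i j, Fin (d i j) → ℂ}

theorem exists_radius_prodForm (hmk : m + ν = k) {W : Fin (ν + 1) → Fin k → ℝ}
    (hW : LinearIndependent ℚ fun p : Fin (ν + 1) × Fin k => W p.1 p.2)
    (hc : IndependentConstants c) {a : Fin (ν + 1) → Fin k → (Fin m → ℂ) → ℂ}
    (had : ∀ i j, ContDiff ℂ 1 (a i j)) {Q : Finset (Fin k)} {w : Fin (ν + 1) → ℝ}
    (hQν : Q.card = ν) (hw : IsTiePoint W Q w)
    {p : Fin m → ℂ} (hp : ∀ j ∉ Q, ∃ s, momentForm m j p = c (argRow W w j) j s)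
    {V : Set (Fin m → ℂ)} (hV : V ∈ nhds p) :
    ∀ᶠ ρ in nhdsWithin (0 : ℝ) (Ioi 0), ∀ θ κ : Fin (ν + 1) → Fin k → ℂ,
      (∀ j, ∀ i ∈ tightRows W w j, θ i j = 1) → (∀ j, ∀ i ∉ tightRows W w j, ‖θ i j‖ < ρ) →
      (∀ i j, ‖κ i j‖ < ρ) → ∃ z ∈ V, ∃ y : Fin (ν + 1) → ℂ, y ≠ 0 ∧
        ∀ j, ∑ i, y i * (θ i j * (prodForm m c i j z + κ i j * a i j z)) = 0 := by
  obtain ⟨ρ₀, hρ₀, h⟩ := Metric.eventually_nhds_iff.1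
    (eventually_exists_solution_prodForm hmk hW hc had hQν hw hp hV)
  filter_upwards [Ioo_mem_nhdsGT hρ₀] with ρ hρ θ κ h1 h2 h3
  refine h (y := (θ, κ)) ?_
  rw [Prod.dist_eq, max_lt_iff]
  constructor
  · refine (dist_pi_lt_iff hρ₀).2 fun i => (dist_pi_lt_iff hρ₀).2 fun j => ?_
    by_cases hi : i ∈ tightRows W w j
    · simpa [hi, h1 j i hi] using hρ₀
    · simpa [hi] using (h2 j i hi).trans hρ.2
  · refine (dist_pi_lt_iff hρ₀).2 fun i => (dist_pi_lt_iff hρ₀).2 fun j => ?_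
    simpa using (h3 i j).trans hρ.2

/-- The perturbed matrix degenerates, at all small scales, near the points given by the tie
points. -/
theorem exists_degeneration_points (hmk : m + ν = k) {W : Fin (ν + 1) → Fin k → ℝ}
    (hW : LinearIndependent ℚ fun p : Fin (ν + 1) × Fin k => W p.1 p.2)
    {δ : ℝ} (hδ : 0 ≤ δ) (hνδ : (2 * ν + 1) * δ ≤ 1)
    (hdW : ∀ i j, (d i j : ℝ) ≤ W i j ∧ W i j < d i j + δ)
    (hc : IndependentConstants c) {a : Fin (ν + 1) → Fin k → (Fin m → ℂ) → ℂ}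
    (had : ∀ i j, ContDiff ℂ 1 (a i j)) {ι : Type} [Finite ι] {Q : ι → Finset (Fin k)}
    {w : ι → Fin (ν + 1) → ℝ} (hQν : ∀ π, (Q π).card = ν) (hw : ∀ π, IsTiePoint W (Q π) (w π))
    {p : ι → Fin m → ℂ} (hpinj : Function.Injective p)
    (hp : ∀ π, ∀ j ∉ Q π, ∃ s, momentForm m j (p π) = c (argRow W (w π) j) j s) :
    ∃ η : ℝ, 0 < η ∧ ∀ᶠ s : ℝ in Filter.atTop, ∀ t : ℝ, 0 < t → t ≤ 1 →
      ∃ z : ι → Fin m → ℂ, Function.Injective z ∧ (∀ π, ‖z π - p π‖ < 1) ∧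
        ∀ π, ∃ y : Fin (ν + 1) → ℂ, y ≠ 0 ∧ ∀ j, ∑ i, y i * (((t * η : ℝ) : ℂ) ^ d i j *
          ((s⁻¹ : ℝ) * a i j (z π) + ((η ^ (W i j - d i j) : ℝ) : ℂ) *
            prodForm m c i j (z π))) = 0 := by
  obtain ⟨U, hU, hdisj⟩ := (Set.toFinite (range p)).t2_separation
  obtain ⟨ρ, hρ0, hρ⟩ := ((eventually_mem_nhdsWithin (a := (0 : ℝ)) (s := Ioi 0)).and
    (Filter.eventually_all.2 fun π => exists_radius_prodForm hmk hW hc had (hQν π) (hw π) (hp π)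
      (V := U (p π) ∩ Metric.ball (p π) 1) (Filter.inter_mem ((hU _).2.mem_nhds (hU _).1)
        (Metric.ball_mem_nhds _ one_pos)))).exists
  have hη : ∀ᶠ η in nhdsWithin (0 : ℝ) (Ioi 0), ∀ π i j, i ∉ tightRows W (w π) j →
      η ^ (W i j + w π i - (W (argRow W (w π) j) j + w π (argRow W (w π) j))) < ρ := by
    refine Filter.eventually_all.2 fun π => Filter.eventually_all.2 fun i =>
      Filter.eventually_all.2 fun j => ?_
    by_cases hi : i ∈ tightRows W (w π) j
    · exact Filter.Eventually.of_forall fun _ h => absurd hi h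
    have hpos : 0 < W i j + w π i - (W (argRow W (w π) j) j + w π (argRow W (w π) j)) := by
      by_contra! hle
      exact hi (mem_tightRows.2 fun l =>
        (sub_nonpos.1 hle).trans (mem_tightRows.1 (argRow_mem W (w π) j) l))
    have hlim := ((Real.continuous_rpow_const hpos.le).tendsto 0).mono_left
      (nhdsWithin_le_nhds (s := Ioi 0))
    rw [Real.zero_rpow hpos.ne'] at hlim
    exact (hlim.eventually (gt_mem_nhds hρ0)).mono fun _ h _ => h
  obtain ⟨η, hη0, hη⟩ := ((eventually_mem_nhdsWithin (a := (0 : ℝ)) (s := Ioi 0)).and hη).exists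
  rw [mem_Ioi] at hη0
  have hs : ∀ᶠ s : ℝ in Filter.atTop, ∀ i j, s⁻¹ * η ^ (-(W i j - d i j)) < ρ :=
    Filter.eventually_all.2 fun i => Filter.eventually_all.2 fun j => by
      have hlim := (tendsto_inv_atTop_zero (𝕜 := ℝ)).mul_const (η ^ (-(W i j - d i j)))
      rw [zero_mul] at hlim
      exact hlim.eventually (gt_mem_nhds hρ0)
  refine ⟨η, hη0, ?_⟩
  filter_upwards [hs, Filter.eventually_gt_atTop 0] with s hs hs0 t ht0 ht1
  have hz : ∀ π, ∃ z ∈ U (p π) ∩ Metric.ball (p π) 1, ∃ y : Fin (ν + 1) → ℂ, y ≠ 0 ∧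
      ∀ j, ∑ i, y i * (((t * η : ℝ) : ℂ) ^ d i j * ((s⁻¹ : ℝ) * a i j z +
        ((η ^ (W i j - d i j) : ℝ) : ℂ) * prodForm m c i j z)) = 0 := by
    intro π
    obtain ⟨u, hu⟩ := exists_weights_of_isTiePoint hW hδ hνδ hdW (hQν π) (hw π)
    set f := argRow W (w π) with hf
    have hfm : ∀ j, f j ∈ tightRows W (w π) j := argRow_mem W (w π)
    have hle : ∀ i j, t ^ ((d i j : ℝ) + u i - (d (f j) j + u (f j))) ≤ 1 := fun i j =>
      Real.rpow_le_one ht0.le ht1 (sub_nonneg.2 (hu j _ (hfm j) i))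
    obtain ⟨z, hz, y, hy, h⟩ := hρ π
      (fun i j => ((η ^ (W i j + w π i - (W (f j) j + w π (f j))) *
        t ^ ((d i j : ℝ) + u i - (d (f j) j + u (f j))) : ℝ) : ℂ))
      (fun i j => ((s⁻¹ * η ^ (-(W i j - d i j)) : ℝ) : ℂ))
      (fun j i hi => by
        rw [sub_eq_zero.2 (le_antisymm (mem_tightRows.1 hi _) (mem_tightRows.1 (hfm j) _)),
          sub_eq_zero.2 (le_antisymm (hu j i hi _) (hu j _ (hfm j) _)),
          Real.rpow_zero, Real.rpow_zero, mul_one, Complex.ofReal_one])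
      (fun j i hi => by
        rw [Complex.norm_real, Real.norm_of_nonneg (by positivity)]
        exact (mul_le_of_le_one_right (by positivity) (hle i j)).trans_lt (hη π i j hi))
      (fun i j => by
        rw [Complex.norm_real, Real.norm_of_nonneg (by positivity)]
        exact hs i j)
    refine ⟨z, hz, fun i => y i * ((η ^ w π i * t ^ u i : ℝ) : ℂ), fun h0 => ?_, fun j => ?_⟩
    · refine hy (funext fun i => (mul_eq_zero.1 (congrFun h0 i)).resolve_right ?_)
      exact Complex.ofReal_ne_zero.2 (by positivity)
    · rw [Finset.sum_congr rfl fun i _ => rescaling_identity (v := W (f j) j + w π (f j))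
        (v₀ := d (f j) j + u (f j)) hη0 ht0 (d i j) (y i) (prodForm m c i j z) (a i j z),
        ← Finset.mul_sum, h j, mul_zero]
  choose z hzU y hy h using hz
  refine ⟨z, fun π π' he => ?_, fun π => ?_, fun π => ⟨y π, hy π, h π⟩⟩
  · by_contra hne
    have := hdisj (mem_range_self π) (mem_range_self π') (hpinj.ne hne)
    exact Set.disjoint_left.1 this (hzU π).1 (he ▸ (hzU π').1)
  · rw [← dist_eq_norm]
    exact (hzU π).2

end Perturbation

section Degeneration

theorem eval_eq_zero_of_mem_maxMinors {m n k : ℕ} {g : Fin n → Fin k → MvPolynomial (Fin m) ℂ}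
    {x : Fin m → ℂ} {y : Fin n → ℂ} (hy : y ≠ 0)
    (h : ∀ j, ∑ i, y i * MvPolynomial.eval x (g i j) = 0) {f : MvPolynomial (Fin m) ℂ}
    (hf : f ∈ maxMinors g) : MvPolynomial.eval x f = 0 := by
  have hle : maxMinors g ≤ RingHom.ker (MvPolynomial.eval x) := by
    refine Ideal.span_le.2 ?_
    rintro _ ⟨σ, -, rfl⟩
    rw [SetLike.mem_coe, RingHom.mem_ker, RingHom.map_det]
    exact Matrix.exists_vecMul_eq_zero_iff.1 ⟨y, hy, funext fun j => h (σ j)⟩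
  exact hle hf

theorem MvPolynomial.IsHomogeneous.eval_smul {σ R : Type*} [CommSemiring R]
    {f : MvPolynomial σ R} {d : ℕ} (hf : f.IsHomogeneous d) (t : R) (x : σ → R) :
    MvPolynomial.eval (t • x) f = t ^ d * MvPolynomial.eval x f := by
  rw [MvPolynomial.eval_eq, MvPolynomial.eval_eq, Finset.mul_sum]
  refine Finset.sum_congr rfl fun α hα => ?_
  have hd : ∑ i ∈ α.support, α i = d := by
    have := hf (MvPolynomial.mem_support_iff.1 hα)
    rwa [Finsupp.weight_apply, Finsupp.sum, Finset.sum_congr rfl fun i _ => by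
      rw [Pi.one_apply, smul_eq_mul, mul_one]] at this
  simp_rw [Pi.smul_apply, smul_eq_mul, mul_pow]
  rw [Finset.prod_mul_distrib, Finset.prod_pow_eq_pow_sum, hd]
  ring

theorem maxMinors_C_mul {m n k : ℕ} (g : Fin n → Fin k → MvPolynomial (Fin m) ℂ) {ε : ℂ}
    (hε : ε ≠ 0) : maxMinors (fun i j => MvPolynomial.C ε * g i j) = maxMinors g := by
  have hle : ∀ (g : Fin n → Fin k → MvPolynomial (Fin m) ℂ) (ε : ℂ),
      maxMinors (fun i j => MvPolynomial.C ε * g i j) ≤ maxMinors g := fun g ε => by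
    refine Ideal.span_le.2 ?_
    rintro _ ⟨σ, hσ, rfl⟩
    have : (Matrix.of fun i i' => MvPolynomial.C ε * g i (σ i')) =
        (MvPolynomial.C ε : MvPolynomial (Fin m) ℂ) • Matrix.of fun i i' => g i (σ i') := by
      ext1
      rfl
    rw [this, Matrix.det_smul]
    exact Ideal.mul_mem_left _ _ (Ideal.subset_span ⟨σ, hσ, rfl⟩)
  refine (hle g ε).antisymm ?_
  convert hle (fun i j => MvPolynomial.C ε * g i j) ε⁻¹ using 2
  funext i j
  rw [← mul_assoc, ← MvPolynomial.C_mul, inv_mul_cancel₀ hε, MvPolynomial.C_1, one_mul]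

/-- The linear form of the moment curve with parameter `j`, as a polynomial. -/
def momentPoly (m j : ℕ) : MvPolynomial (Fin m) ℂ :=
  ∑ l : Fin m, MvPolynomial.C ((j : ℂ) ^ (l : ℕ)) * MvPolynomial.X l

theorem eval_momentPoly (m j : ℕ) (z : Fin m → ℂ) :
    MvPolynomial.eval z (momentPoly m j) = momentForm m j z := by
  simp [momentPoly, momentForm]

theorem MvPolynomial.map_evalRingHom_map_C {σ : Type*} (s : ℂ) (f : MvPolynomial σ ℂ) :
    MvPolynomial.map (Polynomial.evalRingHom s) (MvPolynomial.map Polynomial.C f) = f := by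
  rw [MvPolynomial.map_map]
  convert MvPolynomial.map_id f using 2
  ext c <;> simp

variable {m ν k : ℕ} {d : Fin (ν + 1) → Fin k → ℕ}

/-- The pencil of matrices spanned by `a` and a matrix of products of linear forms. -/
def pencil (d : Fin (ν + 1) → Fin k → ℕ) (a : Fin (ν + 1) → Fin k → MvPolynomial (Fin m) ℂ)
    (wt : Fin (ν + 1) → Fin k → ℂ) :
    Fin (ν + 1) → Fin k → MvPolynomial (Fin m) (Polynomial ℂ) := fun i j =>
  MvPolynomial.map Polynomial.C (a i j) + MvPolynomial.C (Polynomial.X * Polynomial.C (wt i j)) *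
    MvPolynomial.map Polynomial.C (momentPoly m j) ^ d i j

theorem famAt_pencil (a : Fin (ν + 1) → Fin k → MvPolynomial (Fin m) ℂ)
    (wt : Fin (ν + 1) → Fin k → ℂ) (s : ℂ) : famAt (pencil d a wt) s = fun i j =>
      a i j + MvPolynomial.C (s * wt i j) * momentPoly m j ^ d i j := by
  funext i j
  simp only [famAt, pencil, map_add, map_mul, map_pow, MvPolynomial.map_C,
    MvPolynomial.map_evalRingHom_map_C, Polynomial.coe_evalRingHom, Polynomial.eval_C,
    Polynomial.eval_X]

/-- A perturbation of a member of the pencil, in which the linear forms are translated. -/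
def translatedFamily (c : ∀ i j, Fin (d i j) → ℂ)
    (a : Fin (ν + 1) → Fin k → MvPolynomial (Fin m) ℂ) (wt : Fin (ν + 1) → Fin k → ℂ) (ε : ℂ) :
    Fin (ν + 1) → Fin k → MvPolynomial (Fin m) (Polynomial ℂ) := fun i j =>
  MvPolynomial.map Polynomial.C (MvPolynomial.C ε * a i j) +
    MvPolynomial.C (Polynomial.C (wt i j)) *
      ∏ s, (MvPolynomial.map Polynomial.C (momentPoly m j) -
        MvPolynomial.C (Polynomial.X * Polynomial.C (c i j s)))

theorem famAt_translatedFamily (c : ∀ i j, Fin (d i j) → ℂ)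
    (a : Fin (ν + 1) → Fin k → MvPolynomial (Fin m) ℂ) (wt : Fin (ν + 1) → Fin k → ℂ) (ε t : ℂ) :
    famAt (translatedFamily c a wt ε) t = fun i j => MvPolynomial.C ε * a i j +
      MvPolynomial.C (wt i j) * ∏ s, (momentPoly m j - MvPolynomial.C (t * c i j s)) := by
  funext i j
  simp only [famAt, translatedFamily, map_add, map_mul, map_prod, map_sub, MvPolynomial.map_C,
    MvPolynomial.map_evalRingHom_map_C, Polynomial.coe_evalRingHom, Polynomial.eval_C,
    Polynomial.eval_X]

theorem maxMinors_famAt_translatedFamily_zero (c : ∀ i j, Fin (d i j) → ℂ)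
    (a : Fin (ν + 1) → Fin k → MvPolynomial (Fin m) ℂ) (wt : Fin (ν + 1) → Fin k → ℂ) {s : ℂ}
    (hs : s ≠ 0) : maxMinors (famAt (translatedFamily c a wt s⁻¹) 0) =
      maxMinors (famAt (pencil d a wt) s) := by
  rw [← maxMinors_C_mul (famAt (pencil d a wt) s) (inv_ne_zero hs), famAt_translatedFamily,
    famAt_pencil]
  congr 1
  funext i j
  rw [mul_add, ← mul_assoc, ← MvPolynomial.C_mul, inv_mul_cancel_left₀ hs]
  simp

theorem eval_smul_famAt_translatedFamily (c : ∀ i j, Fin (d i j) → ℂ)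
    {a : Fin (ν + 1) → Fin k → MvPolynomial (Fin m) ℂ} (hhom : ∀ i j, (a i j).IsHomogeneous (d i j))
    (wt : Fin (ν + 1) → Fin k → ℂ) (ε t : ℂ) (z : Fin m → ℂ) (i : Fin (ν + 1)) (j : Fin k) :
    MvPolynomial.eval (t • z) (famAt (translatedFamily c a wt ε) t i j) =
      t ^ d i j * (ε * MvPolynomial.eval z (a i j) + wt i j * prodForm m c i j z) := by
  rw [famAt_translatedFamily]
  have hprod : ∏ s, (t * momentForm m j z - t * c i j s) = t ^ d i j * prodForm m c i j z := by
    simp_rw [← mul_sub]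
    rw [Finset.prod_mul_distrib, Finset.prod_const, Finset.card_univ, Fintype.card_fin, prodForm]
  simp only [map_add, map_mul, map_prod, map_sub, MvPolynomial.eval_C, eval_momentPoly,
    (hhom i j).eval_smul, momentForm_smul]
  rw [hprod]
  ring

theorem contDiff_eval {m : ℕ} (f : MvPolynomial (Fin m) ℂ) :
    ContDiff ℂ 1 fun z => MvPolynomial.eval z f := by
  simp_rw [MvPolynomial.eval_eq]
  exact ContDiff.sum fun α _ => contDiff_const.mul
    (contDiff_prod fun i _ => (contDiff_apply ℂ ℂ i).pow _)

/-- The number of tie points, counted with the number of solutions they give rise to, bounds the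
length of the degeneracy locus from below. -/
theorem card_le_finrank_of_tiePoints (hmk : m + ν = k) {W : Fin (ν + 1) → Fin k → ℝ}
    (hW : LinearIndependent ℚ fun p : Fin (ν + 1) × Fin k => W p.1 p.2)
    {δ : ℝ} (hδ : 0 ≤ δ) (hνδ : (2 * ν + 1) * δ ≤ 1)
    (hdW : ∀ i j, (d i j : ℝ) ≤ W i j ∧ W i j < d i j + δ)
    {a : Fin (ν + 1) → Fin k → MvPolynomial (Fin m) ℂ}
    (hhom : ∀ i j, (a i j).IsHomogeneous (d i j))
    (hrank : ∀ x : Fin m → ℂ, x ≠ 0 →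
      (Matrix.of fun i j => MvPolynomial.eval x (a i j)).rank = ν + 1)
    {c : ∀ i j, Fin (d i j) → ℂ} (hc : IndependentConstants c)
    {ι : Type} [Fintype ι] {Q : ι → Finset (Fin k)}
    {w : ι → Fin (ν + 1) → ℝ} (hQν : ∀ π, (Q π).card = ν) (hw : ∀ π, IsTiePoint W (Q π) (w π))
    {p : ι → Fin m → ℂ} (hpinj : Function.Injective p)
    (hp : ∀ π, ∀ j ∉ Q π, ∃ s, momentForm m j (p π) = c (argRow W (w π) j) j s) :
    Fintype.card ι ≤ Module.finrank ℂ (MvPowerSeries (Fin m) ℂ ⧸ minorsIdeal a) := by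
  obtain ⟨η, hη0, hη⟩ := exists_degeneration_points hmk hW hδ hνδ hdW hc
    (a := fun i j z => MvPolynomial.eval z (a i j)) (fun i j => contDiff_eval _) hQν hw hpinj hp
  set wt : Fin (ν + 1) → Fin k → ℂ := fun i j => ((η ^ (W i j - d i j) : ℝ) : ℂ)
  have hfin := (finite_setOf_not_finrank_le (pencil d a wt) (Fintype.card ι)).preimage
    (Complex.ofReal_injective.injOn)
  obtain ⟨s, ⟨hs, hs0⟩, hsfin⟩ := ((hη.and (Filter.eventually_gt_atTop 0)).and
    (Filter.atTop_le_cofinite hfin.compl_mem_cofinite)).exists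
  rw [mem_preimage, mem_ofPred_eq, not_not] at hsfin
  have ht : ∀ r : ℕ, 0 < 1 / ((r : ℝ) + 1) ∧ 1 / ((r : ℝ) + 1) ≤ 1 := fun r =>
    ⟨Nat.one_div_pos_of_nat, (div_le_one₀ (by positivity)).2 (by linarith [r.cast_nonneg (α := ℝ)])⟩
  choose z hzinj hz y hy h using fun r : ℕ => hs _ (ht r).1 (ht r).2
  set t : ℕ → ℝ := fun r => 1 / ((r : ℝ) + 1) * η with ht_def
  have htlim : Filter.Tendsto t Filter.atTop (nhds 0) := by
    have h0 := (tendsto_one_div_add_atTop_nhds_zero_nat (𝕜 := ℝ)).mul_const η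
    rwa [zero_mul] at h0
  have htpos : ∀ r, 0 < t r := fun r => mul_pos (ht r).1 hη0
  have hcard : Fintype.card ι ≤ Module.finrank ℂ (MvPolynomial (Fin m) ℂ ⧸
      maxMinors (famAt (translatedFamily c a wt (s : ℂ)⁻¹) 0) ⊔
        MvPolynomial.idealOfVars (Fin m) ℂ ^ Fintype.card ι) := by
    refine card_le_finrank_of_tendsto _ (fun r => (t r : ℂ)) ?_ (fun r π => (t r : ℂ) • z r π)
      (fun π l => ?_) (fun r π π' he => ?_) (fun r π f hf => ?_)
    · exact (Complex.continuous_ofReal.tendsto' 0 0 Complex.ofReal_zero).comp htlim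
    · have hlim := htlim.mul_const (‖p π‖ + 1)
      rw [zero_mul] at hlim
      refine squeeze_zero_norm (fun r => ?_) hlim
      rw [Pi.smul_apply, smul_eq_mul, norm_mul, Complex.norm_real, Real.norm_of_nonneg (htpos r).le]
      refine mul_le_mul_of_nonneg_left ((norm_le_pi_norm _ l).trans ?_) (htpos r).le
      have h1 := norm_le_norm_add_norm_sub' (z r π) (p π)
      linarith [hz r π]
    · exact hzinj r (smul_right_injective _ (Complex.ofReal_ne_zero.2 (htpos r).ne') he)
    · refine eval_eq_zero_of_mem_maxMinors (hy r π) (fun j => ?_) hf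
      have := h r π j
      simp_rw [eval_smul_famAt_translatedFamily c hhom]
      simpa [wt, t] using this
  rw [maxMinors_famAt_translatedFamily_zero c a wt (Complex.ofReal_ne_zero.2 hs0.ne')] at hcard
  have h0 : famAt (pencil d a wt) 0 = a := by
    rw [famAt_pencil]
    funext i j
    simp
  rw [h0] at hsfin
  rw [← extendedIdeal_maxMinors]
  exact (hcard.trans hsfin).trans
    (finrank_sup_le_finrank_extendedIdeal _ (exists_X_pow_mem_maxMinors a hrank) _)

end Degeneration

section Count

variable {m ν k : ℕ} {d : Fin (ν + 1) → Fin k → ℕ}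

/-- The solutions of the system of products of linear forms attached to the tie points: a choice
of a factor in each column which has no tie. -/
abbrev TieSolution (d : Fin (ν + 1) → Fin k → ℕ) (W : Fin (ν + 1) → Fin k → ℝ) : Type :=
  Σ Q : vertexSets W, ∀ j : {j // j ∈ (Q.1)ᶜ}, Fin (d (argRow W (vertexPoint W Q.1) j.1) j.1)

theorem card_tieSolution (W : Fin (ν + 1) → Fin k → ℝ) : Fintype.card (TieSolution d W) =
    ∑ Q ∈ vertexSets W, ∏ j ∈ Qᶜ, d (argRow W (vertexPoint W Q) j) j := by
  rw [Fintype.card_sigma, ← Finset.sum_coe_sort (vertexSets W)]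
  refine Finset.sum_congr rfl fun Q _ => ?_
  rw [Fintype.card_pi, ← Finset.prod_coe_sort Q.1ᶜ]
  simp_rw [Fintype.card_fin]

theorem exists_points_tieSolution (hmk : m + ν = k) {W : Fin (ν + 1) → Fin k → ℝ}
    {c : ∀ i j, Fin (d i j) → ℂ} (hc : IndependentConstants c) :
    ∃ p : TieSolution d W → Fin m → ℂ, Function.Injective p ∧ ∀ π, ∀ j : Fin k, j ∉ π.1.1 →
      ∃ s, momentForm m j (p π) = c (argRow W (vertexPoint W π.1.1) j) j s := by
  have hcard : ∀ Q : vertexSets W, (Q.1)ᶜ.card = m := fun Q => by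
    rw [Finset.card_compl, card_of_mem_vertexSets Q.2, Fintype.card_fin]
    omega
  have hex : ∀ π : TieSolution d W, ∃ z : Fin m → ℂ, ∀ (j : Fin k) (h : j ∈ (π.1.1)ᶜ),
      momentForm m j z = c (argRow W (vertexPoint W π.1.1) j) j (π.2 ⟨j, h⟩) := fun π => by
    obtain ⟨z, hz⟩ := exists_momentForm_eq (hcard π.1) fun j =>
      if h : j ∈ (π.1.1)ᶜ then c (argRow W (vertexPoint W π.1.1) j) j (π.2 ⟨j, h⟩) else 0
    exact ⟨z, fun j h => by rw [hz j h, dif_pos h]⟩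
  choose p hp using hex
  refine ⟨p, ?_, fun π j hj => ⟨_, hp π j (Finset.mem_compl.2 hj)⟩⟩
  rintro ⟨Q, s⟩ ⟨Q', s'⟩ he
  have hQ : Q = Q' := by
    refine Subtype.ext (Finset.eq_of_subset_of_card_le (fun q hq => ?_) ?_)
    · by_contra hq'
      refine hc.momentForm_ne (hcard Q) (z := p ⟨Q, s⟩) (q := q)
        (fun j hj => ⟨_, _, hp ⟨Q, s⟩ j hj⟩) (by simpa using hq)
        (argRow W (vertexPoint W Q'.1) q) (s' ⟨q, Finset.mem_compl.2 hq'⟩) ?_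
      rw [he]
      exact hp ⟨Q', s'⟩ q (Finset.mem_compl.2 hq')
    · rw [card_of_mem_vertexSets Q.2, card_of_mem_vertexSets Q'.2]
  subst hQ
  congr 1
  funext j
  refine hc.injective _ j.1 ?_
  rw [← hp ⟨Q, s⟩ j.1 j.2, ← hp ⟨Q, s'⟩ j.1 j.2, he]

theorem sum_choose_le_finrank (hm : 0 < m) (hmk : m + ν = k)
    (a : Fin (ν + 1) → Fin k → MvPolynomial (Fin m) ℂ)
    (hhom : ∀ i j, (a i j).IsHomogeneous (d i j))
    (hrank : ∀ x : Fin m → ℂ, x ≠ 0 →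
      (Matrix.of fun i j => MvPolynomial.eval x (a i j)).rank = ν + 1) :
    ∑ J ∈ Finset.univ.filter (fun J : Finset (Fin k) => J.Nonempty),
      ∑ b ∈ Finset.Nat.antidiagonalTuple (ν + 1) J.card,
        (-1 : ℤ) ^ (k - J.card) * (Nat.choose (m + dMin d J b - 1) m : ℤ) ≤
      (Module.finrank ℂ (MvPowerSeries (Fin m) ℂ ⧸ minorsIdeal a) : ℤ) := by
  set δ : ℝ := 1 / (2 * ν + 1 + k) with hδ_def
  have hpos : (0 : ℝ) < 2 * ν + 1 + k := by positivity
  have hδ : 0 < δ := by positivity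
  have hkδ : k * δ ≤ 1 := by
    rw [hδ_def, mul_one_div, div_le_one₀ hpos]
    linarith [ν.cast_nonneg (α := ℝ)]
  have hνδ : (2 * ν + 1) * δ ≤ 1 := by
    rw [hδ_def, mul_one_div, div_le_one₀ hpos]
    linarith [k.cast_nonneg (α := ℝ)]
  obtain ⟨b, hb, hdb⟩ := exists_linearIndependent_rat_near (Fin (ν + 1) × Fin k)
    (fun q => d q.1 q.2) hδ
  have hdW : ∀ i j, (d i j : ℝ) ≤ b (i, j) ∧ b (i, j) < d i j + δ := fun i j =>
    ⟨(hdb (i, j)).1.le, (hdb (i, j)).2⟩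
  obtain ⟨c, hc⟩ := exists_independentConstants d
  obtain ⟨p, hpinj, hp⟩ := exists_points_tieSolution hmk (W := fun i j => b (i, j)) hc
  have hcount := card_le_finrank_of_tiePoints hmk (W := fun i j => b (i, j)) hb hδ.le hνδ hdW
    hhom hrank hc (fun π => card_of_mem_vertexSets π.1.2)
    (fun π => isTiePoint_vertexPoint π.1.2) hpinj hp
  rw [card_tieSolution] at hcount
  rw [sum_choose_eq_sum_vertexSets (W := fun i j => b (i, j)) hb hkδ hdW hm hmk]
  exact_mod_cast hcount

end Count

theorem multiplicity_ge_homogeneous {m n k : ℕ} (hnk : n ≤ k) (hm : m = k - n + 1)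
    (d : Fin n → Fin k → ℕ) (a : Fin n → Fin k → MvPolynomial (Fin m) ℂ)
    (hne : ∀ i j, a i j ≠ 0)
    (hhom : ∀ i j, (a i j).IsHomogeneous (d i j))
    (hrank : ∀ x : Fin m → ℂ, x ≠ 0 →
      (Matrix.of fun i j => MvPolynomial.eval x (a i j)).rank = n) :
    (Module.finrank ℂ (MvPowerSeries (Fin m) ℂ ⧸ minorsIdeal a) : ℤ) ≥
      ∑ J ∈ Finset.univ.filter (fun J : Finset (Fin k) => J.Nonempty),
        ∑ b ∈ Finset.Nat.antidiagonalTuple n J.card,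
          (-1 : ℤ) ^ (k - J.card) * (Nat.choose (m + dMin d J b - 1) m : ℤ) := by
  rcases n with _ | ν
  · refine le_trans (le_of_eq (Finset.sum_eq_zero fun J hJ => ?_)) (Int.natCast_nonneg _)
    obtain ⟨j, hj⟩ := (Finset.mem_filter.1 hJ).2
    refine Finset.sum_eq_zero fun b hb => ?_
    rw [Finset.Nat.mem_antidiagonalTuple, Fin.sum_univ_zero] at hb
    exact absurd hb.symm (Finset.card_ne_zero_of_mem hj)
  · exact sum_choose_le_finrank (by omega) (by omega) a hhom hrank
end
end

section
/- Let n ≤ k, m = k − n + 1, and let B_{i,j} ⊂ ℝ^m (i = 1,…,n, j = 1,…,k) be bounded lattice polytopes, some of which may be empty. Then Σ_{∅ ≠ S ⊆ {1,…,k}} (−1)^{k−|S|} · #( ℤ^{n−1+m} ∩ Σ_{j ∈ S} (B_{1,j} * … * B_{n,j}) ) = Σ (−1)^{k−|J|} · #( ℤ^m ∩ ⋁_{J_1 ⊔ … ⊔ J_n = J, |J_1| = b_1, …, |J_n| = b_n} Σ_{i = 1,…,n, j ∈ J_i} B_{i,j} ), where on the right the sum is over all nonempty subsets J ⊆ {1,…,k}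 and all n-tuples of nonnegative integers (b_1,…,b_n) with b_1 + … + b_n = |J|, a Minkowski sum over an empty index set equals {0}, any Minkowski sum involving an empty polytope is empty, the join over an empty family is empty, and #(∅) = 0. (Both sides equal k! times the mixed volume of the Cayley polytopes B_{1,j} * … * B_{n,j}, j = 1,…,k.) -/
/-!
STATEMENT 6 (lattice point identity for Cayley polytopes).
For bounded lattice polytopes `B_{i,j} ⊂ ℝ^m` (`i = 1,…,n`, `j = 1,…,k`, possibly empty),
with `n ≤ k` and `m = k − n + 1`:
`Σ_{∅≠S⊆{1,…,k}} (−1)^{k−|S|} #(ℤ^{n−1+m} ∩ Σ_{j∈S} (B_{1,j}*…*B_{n,j}))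
 = Σ_{∅≠J, b_1+…+b_n=|J|} (−1)^{k−|J|} #(ℤ^m ∩ ⋁_{J_1⊔…⊔J_n=J, |J_i|=b_i} Σ_{i,j∈J_i} B_{i,j})`.
The ambient space `ℝ^{n−1} ⊕ ℝ^m` is modelled as `(Fin (n−1) → ℝ) × (Fin m → ℝ)`.
-/

open Set

noncomputable section

/-- Minkowski sum of the sets `Δ j`, `j ∈ J` (`{0}` when `J = ∅`, empty as soon as one
of the summands indexed by `J` is empty). -/
def minkSum {ι E : Type*} [AddCommMonoid E] (J : Finset ι) (Δ : ι → Set E) : Set E :=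
  {y | ∃ x : ι → E, (∀ j ∈ J, x j ∈ Δ j) ∧ y = ∑ j ∈ J, x j}

/-- The Cayley points `b_1,…,b_n ∈ ℝ^{n−1}`: the standard basis vectors and `b_n = 0`. -/
def cayleyPt (n : ℕ) (i : Fin n) : Fin (n - 1) → ℝ :=
  fun l => if (i : ℕ) = (l : ℕ) then 1 else 0

/-- The Cayley polytope `Δ_1 * … * Δ_n ⊂ ℝ^{n−1} ⊕ ℝ^m`: the convex hull of
`⋃_i {b_i} × Δ_i` (terms with `Δ_i = ∅` contribute nothing). -/
def cayley (n m : ℕ) (Δ : Fin n → Set (Fin m → ℝ)) :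
    Set ((Fin (n - 1) → ℝ) × (Fin m → ℝ)) :=
  convexHull ℝ (⋃ i, {cayleyPt n i} ×ˢ Δ i)

/-- The number of points of `ℤ^{n−1+m}` in a subset of `ℝ^{n−1} ⊕ ℝ^m`. -/
def latticeCountProd {a b : ℕ} (X : Set ((Fin a → ℝ) × (Fin b → ℝ))) : ℕ :=
  Set.ncard {z : (Fin a → ℤ) × (Fin b → ℤ) |
    ((fun l => (z.1 l : ℝ)), (fun l => (z.2 l : ℝ))) ∈ X}

/-- The number of points of `ℤ^m` in a subset of `ℝ^m`. -/
def latticeCount {m : ℕ} (X : Set (Fin m → ℝ)) : ℕ :=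
  Set.ncard {z : Fin m → ℤ | (fun l => (z l : ℝ)) ∈ X}

/-- The join `⋁_{J_1⊔…⊔J_n=J, |J_i|=b_i} Σ_{i, j∈J_i} B_{i,j}` (empty when there is no
such decomposition, and any Minkowski sum involving an empty polytope is empty). -/
def joinOfDecompositions {m n k : ℕ} (B : Fin n → Fin k → Set (Fin m → ℝ))
    (J : Finset (Fin k)) (b : Fin n → ℕ) : Set (Fin m → ℝ) :=
  convexHull ℝ (⋃ f ∈ {f : Fin k → Fin n | ∀ i, (J.filter (fun j => f j = i)).card = b i},
    minkSum J (fun j => B (f j) j))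

theorem Convex.minkSum {ι E : Type*} [AddCommGroup E] [Module ℝ E] {J : Finset ι}
    {Δ : ι → Set E} (hΔ : ∀ j ∈ J, Convex ℝ (Δ j)) : Convex ℝ (minkSum J Δ) := by
  rintro _ ⟨x, hx, rfl⟩ _ ⟨y, hy, rfl⟩ a b ha hb hab
  refine ⟨fun j => a • x j + b • y j, fun j hj => hΔ j hj (hx j hj) (hy j hj) ha hb hab, ?_⟩
  rw [Finset.sum_add_distrib, Finset.smul_sum, Finset.smul_sum]

/-- Points of the convex hull of a union of convex sets, as convex combinations using one point of
each set of positive weight. -/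
theorem exists_weights_of_mem_convexHull_iUnion {ι E : Type*} [Fintype ι] [AddCommGroup E]
    [Module ℝ E] {s : ι → Set E} (hs : ∀ i, Convex ℝ (s i)) {x : E}
    (hx : x ∈ convexHull ℝ (⋃ i, s i)) :
    ∃ (w : ι → ℝ) (z : ι → E), (∀ i, 0 ≤ w i) ∧ ∑ i, w i = 1 ∧ (∀ i, w i ≠ 0 → z i ∈ s i) ∧
      ∑ i, w i • z i = x := by
  classical
  obtain ⟨κ, _, w, z, hw, hw1, hz, rfl⟩ := mem_convexHull_iff_exists_fintype.1 hx
  simp only [mem_iUnion] at hz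
  choose c hc using hz
  have hnn : ∀ i, 0 ≤ ∑ t with c t = i, w t := fun i => Finset.sum_nonneg fun t _ => hw t
  refine ⟨fun i => ∑ t with c t = i, w t,
    fun i => (Finset.univ.filter (fun t => c t = i)).centerMass w z, hnn, ?_, ?_, ?_⟩
  · rw [← hw1]
    exact Finset.sum_fiberwise _ _ _
  · intro i hi
    refine (hs i).centerMass_mem (fun t _ => hw t) (lt_of_le_of_ne (hnn i) (Ne.symm hi)) ?_
    intro t ht
    obtain rfl := (Finset.mem_filter.1 ht).2
    exact hc t
  · rw [← Finset.sum_fiberwise Finset.univ c (fun t => w t • z t)]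
    refine Finset.sum_congr rfl fun i _ => ?_
    beta_reduce
    by_cases hi : ∑ t with c t = i, w t = 0
    · rw [hi, zero_smul, eq_comm]
      refine Finset.sum_eq_zero fun t ht => ?_
      rw [(Finset.sum_eq_zero_iff_of_nonneg fun t _ => hw t).1 hi t ht, zero_smul]
    · unfold Finset.centerMass
      rw [smul_smul, mul_inv_cancel₀ hi, one_smul]

theorem sum_smul_cayleyPt {n : ℕ} (w : Fin n → ℝ) (l : Fin (n - 1)) :
    (∑ i, w i • cayleyPt n i) l = w ⟨l, by omega⟩ := by
  rw [Finset.sum_apply, Finset.sum_eq_single (⟨l, by omega⟩ : Fin n)]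
  · simp [cayleyPt]
  · intro i _ hi
    have : (i : ℕ) ≠ l := fun h => hi (Fin.ext h)
    simp [cayleyPt, this]
  · simp

/-- A point of a Minkowski sum of Cayley polytopes comes from a matrix of weights with row sums one,
whose column sums give the Cayley coordinates. -/
theorem exists_weights_of_mem_minkSum_cayley {ι : Type*} {m n : ℕ}
    {B : Fin n → ι → Set (Fin m → ℝ)} (hB : ∀ i j, Convex ℝ (B i j)) {S : Finset ι}
    {p : Fin (n - 1) → ℝ} {v : Fin m → ℝ}
    (h : (p, v) ∈ minkSum S (fun j => cayley n m (fun i => B i j))) :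
    ∃ (w : ι → Fin n → ℝ) (x : ι → Fin n → Fin m → ℝ), (∀ j i, 0 ≤ w j i) ∧
      (∀ j ∈ S, ∑ i, w j i = 1) ∧ (∀ j ∈ S, ∀ i, w j i ≠ 0 → x j i ∈ B i j) ∧
      (∀ l : Fin (n - 1), ∑ j ∈ S, w j ⟨l, by omega⟩ = p l) ∧
      ∑ j ∈ S, ∑ i, w j i • x j i = v := by
  classical
  obtain ⟨y, hy, hpv⟩ := h
  have key : ∀ j, ∃ (w : Fin n → ℝ) (z : Fin n → (Fin (n - 1) → ℝ) × (Fin m → ℝ)),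
      (∀ i, 0 ≤ w i) ∧ (j ∈ S → ∑ i, w i = 1 ∧
        (∀ i, w i ≠ 0 → z i ∈ {cayleyPt n i} ×ˢ B i j) ∧ ∑ i, w i • z i = y j) := by
    intro j
    by_cases hj : j ∈ S
    · obtain ⟨w, z, h0, h1⟩ := exists_weights_of_mem_convexHull_iUnion
        (fun i => (convex_singleton (cayleyPt n i)).prod (hB i j)) (hy j hj)
      exact ⟨w, z, h0, fun _ => h1⟩
    · exact ⟨0, 0, fun _ => le_rfl, fun h => absurd h hj⟩
  choose w z h0 h1 using key
  refine ⟨w, fun j i => (z j i).2, h0, fun j hj => (h1 j hj).1,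
    fun j hj i hi => ((h1 j hj).2.1 i hi).2, fun l => ?_, ?_⟩
  · have hp : p = (∑ j ∈ S, y j).1 := congrArg Prod.fst hpv
    rw [hp, Prod.fst_sum, Finset.sum_apply]
    refine Finset.sum_congr rfl fun j hj => ?_
    rw [← (h1 j hj).2.2, Prod.fst_sum, ← sum_smul_cayleyPt (w j) l]
    refine congrFun (Finset.sum_congr rfl fun i _ => ?_) l
    by_cases hi : w j i = 0
    · simp [hi]
    · rw [Prod.smul_fst, ((h1 j hj).2.1 i hi).1]
  · have hv : v = (∑ j ∈ S, y j).2 := congrArg Prod.snd hpv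
    rw [hv, Prod.snd_sum]
    refine Finset.sum_congr rfl fun j hj => ?_
    rw [← (h1 j hj).2.2, Prod.snd_sum]
    rfl

/-- Integrality of transportation polytopes: a nonnegative matrix with row sums one and integral
column sums `b` is a convex combination of zero-one matrices of the same kind. -/
theorem exists_convex_combination_of_integral_column_sums {α β : Type*} [Fintype α] [Fintype β]
    [DecidableEq β] (w : α → β → ℝ) (b : β → ℕ) (hw : ∀ j i, 0 ≤ w j i)
    (hrow : ∀ j, ∑ i, w j i = 1) (hcol : ∀ i, ∑ j, w j i = b i) :
    ∃ (κ : Type) (_ : Fintype κ) (μ : κ → ℝ) (g : κ → α → β), (∀ t, 0 ≤ μ t) ∧ ∑ t, μ t = 1 ∧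
      (∀ t, μ t ≠ 0 → ∀ j, w j (g t j) ≠ 0) ∧
      (∀ t i, (Finset.univ.filter (fun j => g t j = i)).card = b i) ∧
      ∀ j i, w j i = ∑ t, if g t j = i then μ t else 0 := by
  classical
  have hcard : Fintype.card (Σ i, Fin (b i)) = Fintype.card α := by
    have : ((∑ i, b i : ℕ) : ℝ) = Fintype.card α := by
      push_cast
      rw [← Finset.sum_congr rfl fun i _ => hcol i, Finset.sum_comm,
        Finset.sum_congr rfl fun j _ => hrow j]
      simp
    rw [Fintype.card_sigma]
    simpa only [Fintype.card_fin] using Nat.cast_injective this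
  set N := Fintype.card α with hN
  let e : α ≃ Fin N := Fintype.equivFin α
  let d : Fin N ≃ (Σ i, Fin (b i)) := (Fintype.equivFinOfCardEq hcard).symm
  have hzero : ∀ j i, b i = 0 → w j i = 0 := by
    intro j i hi
    have h := hcol i
    rw [hi, Nat.cast_zero] at h
    exact (Finset.sum_eq_zero_iff_of_nonneg fun j _ => hw j i).1 h j (Finset.mem_univ _)
  let M : Matrix (Fin N) (Fin N) ℝ := fun r c => w (e.symm r) (d c).1 / b (d c).1
  have hsum : ∀ (j : α) (P : β → Prop) [DecidablePred P],
      ∑ c, (if P (d c).1 then w j (d c).1 / b (d c).1 else 0) = ∑ i, if P i then w j i else 0 := by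
    intro j P _
    rw [d.sum_comp (fun s => if P s.1 then w j s.1 / b s.1 else 0), Fintype.sum_sigma]
    refine Finset.sum_congr rfl fun i _ => ?_
    by_cases hb : b i = 0
    · simp [hb, hzero j i hb]
    · have : (b i : ℝ) ≠ 0 := by exact_mod_cast hb
      split_ifs
      · simp [mul_div_cancel₀ _ this]
      · simp
  have hM : M ∈ doublyStochastic ℝ (Fin N) := by
    rw [mem_doublyStochastic_iff_sum]
    refine ⟨fun r c => div_nonneg (hw _ _) (Nat.cast_nonneg _), fun r => ?_, fun c => ?_⟩
    · have := hsum (e.symm r) (fun _ => True)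
      simp only [if_true] at this
      exact this.trans (hrow _)
    · have hb : (b (d c).1 : ℝ) ≠ 0 := by
        have := (d c).2.pos
        exact_mod_cast this.ne'
      change ∑ r, w (e.symm r) (d c).1 / b (d c).1 = 1
      rw [← Finset.sum_div, e.symm.sum_comp (fun j => w j (d c).1), hcol, div_self hb]
  obtain ⟨μ, hμ0, hμ1, hμM⟩ := exists_eq_sum_perm_of_mem_doublyStochastic hM
  have hentry : ∀ r c, M r c = ∑ σ, if σ r = c then μ σ else 0 := by
    intro r c
    rw [← hμM, Matrix.sum_apply]
    refine Finset.sum_congr rfl fun σ _ => ?_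
    simp [Matrix.smul_apply, Equiv.Perm.permMatrix, PEquiv.toMatrix_apply]
  refine ⟨Equiv.Perm (Fin N), inferInstance, μ, fun σ j => (d (σ (e j))).1, hμ0, hμ1, ?_, ?_, ?_⟩
  · intro σ hσ j hj
    have h : M (e j) (σ (e j)) = 0 := by simp [M, hj]
    rw [hentry, Finset.sum_eq_zero_iff_of_nonneg
      (fun τ _ => by split_ifs <;> simp [hμ0])] at h
    exact hσ (by simpa using h σ (Finset.mem_univ _))
  · intro σ i
    have : (Finset.univ.filter (fun s : Σ i, Fin (b i) => s.1 = i)).card = b i := by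
      rw [Finset.card_filter, Fintype.sum_sigma, Finset.sum_eq_single i]
      · simp
      · intro i' _ hi'
        simp [hi']
      · simp
    rw [← this]
    exact Finset.card_equiv ((e.trans σ).trans d) (by simp)
  · intro j i
    have h1 := hsum j (fun i' => i' = i)
    rw [Finset.sum_ite_eq' Finset.univ i, if_pos (Finset.mem_univ _)] at h1
    rw [← h1]
    have h2 : ∀ c, w j (d c).1 / b (d c).1 = ∑ σ, if σ (e j) = c then μ σ else 0 := by
      intro c
      rw [← hentry]
      simp [M]
    simp only [h2]
    simp only [← Finset.sum_filter]
    rw [Finset.sum_comm' (t' := Finset.univ.filter (fun σ => (d (σ (e j))).1 = i))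
      (s' := fun σ => {σ (e j)})]
    · simp
    · intro c σ
      simp only [Finset.mem_filter, Finset.mem_univ, true_and, Finset.mem_singleton]
      constructor
      · rintro ⟨h, rfl⟩
        exact ⟨rfl, h⟩
      · rintro ⟨rfl, h⟩
        exact ⟨h, rfl⟩

theorem eq_of_sum_eq_of_forall_lt_pred {n : ℕ} {a a' : Fin n → ℝ} (hsum : ∑ i, a i = ∑ i, a' i)
    (h : ∀ l : Fin (n - 1), a ⟨l, by omega⟩ = a' ⟨l, by omega⟩) : a = a' := by
  cases n with
  | zero => exact Subsingleton.elim _ _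
  | succ p =>
    have h' : ∀ l : Fin p, a l.castSucc = a' l.castSucc := h
    rw [Fin.sum_univ_castSucc, Fin.sum_univ_castSucc, Finset.sum_congr rfl fun l _ => h' l,
      add_right_inj] at hsum
    funext i
    exact Fin.lastCases hsum h' i

theorem exists_nat_of_sum_eq_of_forall_lt_pred {n N : ℕ} {a : Fin n → ℝ} (ha : ∀ i, 0 ≤ a i)
    (hsum : ∑ i, a i = N) {z : Fin (n - 1) → ℤ}
    (h : ∀ l : Fin (n - 1), a ⟨l, by omega⟩ = z l) : ∃ b : Fin n → ℕ, ∀ i, a i = b i := by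
  suffices H : ∀ i, ∃ c : ℕ, a i = c by
    choose b hb using H
    exact ⟨b, hb⟩
  suffices H : ∀ i, ∃ c : ℤ, a i = c by
    intro i
    obtain ⟨c, hc⟩ := H i
    have h0 : 0 ≤ c := by exact_mod_cast hc ▸ ha i
    lift c to ℕ using h0
    exact ⟨c, by simpa using hc⟩
  cases n with
  | zero => exact fun i => i.elim0
  | succ p =>
    have h' : ∀ l : Fin p, a l.castSucc = z l := h
    rw [Fin.sum_univ_castSucc, Finset.sum_congr rfl fun l _ => h' l] at hsum
    intro i
    refine Fin.lastCases ⟨N - ∑ l : Fin p, z l, ?_⟩ (fun l => ⟨z l, h' l⟩) i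
    push_cast
    exact eq_sub_of_add_eq' hsum

theorem sum_column_sums {ι β : Type*} [Fintype β] {S : Finset ι} {w : ι → β → ℝ}
    (hrow : ∀ j ∈ S, ∑ i, w j i = 1) : ∑ i, ∑ j ∈ S, w j i = S.card := by
  rw [Finset.sum_comm, Finset.sum_congr rfl hrow]
  simp

/-- The slices of a Minkowski sum of Cayley polytopes over integer points are the joins of
decompositions. -/
theorem mem_minkSum_cayley_iff_mem_joinOfDecompositions {m n k : ℕ}
    {B : Fin n → Fin k → Set (Fin m → ℝ)} (hB : ∀ i j, Convex ℝ (B i j)) {S : Finset (Fin k)}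
    (hS : S.Nonempty) {b : Fin n → ℕ} (hb : ∑ i, b i = S.card) {v : Fin m → ℝ} :
    ((fun l : Fin (n - 1) => (b ⟨l, by omega⟩ : ℝ)), v) ∈
        minkSum S (fun j => cayley n m (fun i => B i j)) ↔
      v ∈ joinOfDecompositions B S b := by
  classical
  constructor
  · intro h
    obtain ⟨w, x, hw, hrow, hx, hp, rfl⟩ := exists_weights_of_mem_minkSum_cayley hB h
    have hcol : (fun i => ∑ j ∈ S, w j i) = fun i => (b i : ℝ) :=
      eq_of_sum_eq_of_forall_lt_pred (by rw [sum_column_sums hrow, ← hb]; push_cast; rfl) hp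
    obtain ⟨κ, _, μ, g, hμ0, hμ1, hg, hgb, hμw⟩ :=
      exists_convex_combination_of_integral_column_sums (fun (j : S) i => w j i) b
        (fun j i => hw j i) (fun j => hrow j j.2)
        (fun i => by rw [← congrFun hcol i]; exact Finset.sum_coe_sort S (fun j => w j i))
    have hsum : ∑ j ∈ S, ∑ i, w j i • x j i = ∑ t, μ t • ∑ j : S, x j (g t j) := by
      rw [← Finset.sum_coe_sort S]
      simp only [hμw, Finset.sum_smul, ite_smul, zero_smul, Finset.smul_sum]
      rw [Finset.sum_comm (s := (Finset.univ : Finset κ))]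
      refine Finset.sum_congr rfl fun j _ => ?_
      rw [Finset.sum_comm]
      simp
    rw [hsum, ← Finset.sum_filter_of_ne (p := fun t => μ t ≠ 0)
      (fun t _ ht h0 => ht (by rw [h0, zero_smul]))]
    refine (convex_convexHull ℝ _).sum_mem (fun t _ => hμ0 t)
      (by rw [Finset.sum_filter_ne_zero, hμ1]) fun t ht => subset_convexHull ℝ _ ?_
    have ht0 := (Finset.mem_filter.1 ht).2
    obtain ⟨j₀, hj₀⟩ := hS
    let f : Fin k → Fin n := fun j => if hj : j ∈ S then g t ⟨j, hj⟩ else g t ⟨j₀, hj₀⟩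
    have hf : ∀ j : S, f j = g t j := fun j => dif_pos j.2
    refine mem_iUnion₂.2 ⟨f, fun i => ?_, fun j => x j (f j), fun j hj => ?_, ?_⟩
    · rw [← hgb t i, Finset.card_filter, Finset.card_filter, ← Finset.sum_coe_sort S]
      simp only [hf]
    · refine hx j hj _ ?_
      rw [hf ⟨j, hj⟩]
      exact hg t ht0 ⟨j, hj⟩
    · rw [← Finset.sum_coe_sort S]
      simp only [hf]
  · have hconv : Convex ℝ (minkSum S (fun j => cayley n m (fun i => B i j))) :=
      Convex.minkSum fun j _ => convex_convexHull ℝ _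
    intro hv
    refine convexHull_min (t := {v | ((fun l : Fin (n - 1) => (b ⟨l, by omega⟩ : ℝ)), v) ∈
        minkSum S (fun j => cayley n m (fun i => B i j))}) ?_ ?_ hv
    · refine iUnion₂_subset fun f hf => ?_
      rintro _ ⟨y, hy, rfl⟩
      refine ⟨fun j => (cayleyPt n (f j), y j), fun j hj => subset_convexHull ℝ _
        (mem_iUnion.2 ⟨f j, rfl, hy j hj⟩), Prod.ext ?_ (by rw [Prod.snd_sum])⟩
      rw [Prod.fst_sum]
      funext l
      change (b ⟨l, by omega⟩ : ℝ) = _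
      rw [Finset.sum_apply, ← hf ⟨l, by omega⟩, Finset.card_filter]
      push_cast
      refine Finset.sum_congr rfl fun j _ => ?_
      simp [cayleyPt, Fin.ext_iff]
    · intro v hv v' hv' a a' ha ha' haa
      have := hconv hv hv' ha ha' haa
      simpa [Prod.smul_mk, ← add_smul, ← add_mul, haa] using this

theorem finite_latticePoints_joinOfDecompositions {m n k : ℕ}
    {B : Fin n → Fin k → Set (Fin m → ℝ)} (hB : ∀ i j, Bornology.IsBounded (B i j))
    (S : Finset (Fin k)) (b : Fin n → ℕ) :
    {z : Fin m → ℤ | (fun l => (z l : ℝ)) ∈ joinOfDecompositions B S b}.Finite := by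
  obtain ⟨R, hR⟩ := (Bornology.isBounded_iUnion.2 fun i =>
    Bornology.isBounded_iUnion.2 (hB i)).subset_closedBall (0 : Fin m → ℝ)
  have hsub : joinOfDecompositions B S b ⊆ Metric.closedBall 0 (S.card * R) := by
    refine convexHull_min (iUnion₂_subset fun f _ => ?_) (convex_closedBall _ _)
    rintro _ ⟨y, hy, rfl⟩
    rw [mem_closedBall_zero_iff, ← nsmul_eq_mul]
    refine (norm_sum_le _ _).trans (Finset.sum_le_card_nsmul _ _ _ fun j hj => ?_)
    exact mem_closedBall_zero_iff.1 (hR (mem_iUnion₂.2 ⟨f j, j, hy j hj⟩))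
  refine (Set.finite_Icc (fun _ => -⌈(S.card * R : ℝ)⌉) (fun _ => ⌈(S.card * R : ℝ)⌉)).subset ?_
  intro z hz
  have hz' : ∀ l, |(z l : ℝ)| ≤ ⌈(S.card * R : ℝ)⌉ := fun l =>
    ((norm_le_pi_norm (fun l => (z l : ℝ)) l).trans
      (mem_closedBall_zero_iff.1 (hsub hz))).trans (Int.le_ceil _)
  have hz'' : ∀ l, |z l| ≤ ⌈(S.card * R : ℝ)⌉ := fun l => by exact_mod_cast hz' l
  exact ⟨fun l => (abs_le.1 (hz'' l)).1, fun l => (abs_le.1 (hz'' l)).2⟩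

theorem latticeCountProd_minkSum_cayley {m n k : ℕ} {B : Fin n → Fin k → Set (Fin m → ℝ)}
    (hB : ∀ i j, Convex ℝ (B i j)) (hbdd : ∀ i j, Bornology.IsBounded (B i j))
    {S : Finset (Fin k)} (hS : S.Nonempty) :
    latticeCountProd (minkSum S (fun j => cayley n m (fun i => B i j))) =
      ∑ b ∈ Finset.Nat.antidiagonalTuple n S.card,
        latticeCount (joinOfDecompositions B S b) := by
  classical
  have hfin := finite_latticePoints_joinOfDecompositions hbdd S
  let A : (Fin n → ℕ) → Finset (Fin m → ℤ) := fun b => (hfin b).toFinset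
  let F : (Σ _ : Fin n → ℕ, Fin m → ℤ) → (Fin (n - 1) → ℤ) × (Fin m → ℤ) :=
    fun s => (fun l => (s.1 ⟨l, by omega⟩ : ℤ), s.2)
  let T := (Finset.Nat.antidiagonalTuple n S.card).sigma A
  have hF : InjOn F T := by
    rintro ⟨b, v⟩ h ⟨b', v'⟩ h' heq
    rw [Finset.mem_coe, Finset.mem_sigma, Finset.Nat.mem_antidiagonalTuple] at h h'
    obtain ⟨h1, rfl⟩ := Prod.ext_iff.1 heq
    have hbb : (fun i => (b i : ℝ)) = fun i => (b' i : ℝ) := by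
      refine eq_of_sum_eq_of_forall_lt_pred ?_ fun l => ?_
      · exact_mod_cast h.1.trans h'.1.symm
      · have h2 : (b ⟨l, by omega⟩ : ℤ) = b' ⟨l, by omega⟩ := congrFun h1 l
        exact_mod_cast h2
    obtain rfl : b = b' := funext fun i => by exact_mod_cast congrFun hbb i
    rfl
  have himage : {z : (Fin (n - 1) → ℤ) × (Fin m → ℤ) |
      ((fun l => (z.1 l : ℝ)), (fun l => (z.2 l : ℝ))) ∈
        minkSum S (fun j => cayley n m (fun i => B i j))} = F '' T := by
    ext ⟨p, v⟩
    constructor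
    · intro h
      obtain ⟨w, x, hw, hrow, hx, hp, hv⟩ := exists_weights_of_mem_minkSum_cayley hB h
      obtain ⟨b, hb⟩ := exists_nat_of_sum_eq_of_forall_lt_pred
        (fun i => Finset.sum_nonneg fun j _ => hw j i) (sum_column_sums hrow) hp
      have hbS : ∑ i, b i = S.card := by
        have := sum_column_sums hrow
        simp only [hb] at this
        exact_mod_cast this
      have hpb : ∀ l : Fin (n - 1), (p l : ℝ) = b ⟨l, by omega⟩ := fun l => by
        rw [← hb]
        exact (hp l).symm
      refine ⟨⟨b, v⟩, ?_, Prod.ext (funext fun l => ?_) rfl⟩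
      · rw [Finset.mem_coe, Finset.mem_sigma, Finset.Nat.mem_antidiagonalTuple]
        refine ⟨hbS, (hfin b).mem_toFinset.2 ?_⟩
        refine (mem_minkSum_cayley_iff_mem_joinOfDecompositions hB hS hbS).1 ?_
        simpa only [mem_ofPred_eq, hpb] using h
      · exact_mod_cast (hpb l).symm
    · rintro ⟨⟨b, u⟩, h, heq⟩
      rw [Finset.mem_coe, Finset.mem_sigma, Finset.Nat.mem_antidiagonalTuple] at h
      rw [← heq]
      have := (mem_minkSum_cayley_iff_mem_joinOfDecompositions hB hS h.1).2
        ((hfin b).mem_toFinset.1 h.2)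
      simpa [F] using this
  rw [latticeCountProd, himage, hF.ncard_image, ncard_coe_finset, Finset.card_sigma]
  exact Finset.sum_congr rfl fun b _ => (ncard_eq_toFinset_card _ (hfin b)).symm

theorem cayley_lattice_point_identity {m n k : ℕ} (hnk : n ≤ k) (hm : m = k - n + 1)
    (B : Fin n → Fin k → Set (Fin m → ℝ))
    (hlattice : ∀ i j, ∃ F : Finset (Fin m → ℤ),
      B i j = convexHull ℝ ((fun (v : Fin m → ℤ) (l : Fin m) => (v l : ℝ)) '' ↑F)) :
    ∑ S ∈ Finset.univ.filter (fun S : Finset (Fin k) => S.Nonempty),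
      (-1 : ℤ) ^ (k - S.card) *
        (latticeCountProd (minkSum S (fun j => cayley n m (fun i => B i j))) : ℤ) =
    ∑ J ∈ Finset.univ.filter (fun J : Finset (Fin k) => J.Nonempty),
      ∑ b ∈ Finset.Nat.antidiagonalTuple n J.card,
        (-1 : ℤ) ^ (k - J.card) * (latticeCount (joinOfDecompositions B J b) : ℤ) := by
  have hB : ∀ i j, Convex ℝ (B i j) := by
    intro i j
    obtain ⟨F, hF⟩ := hlattice i j
    rw [hF]
    exact convex_convexHull ℝ _
  have hbdd : ∀ i j, Bornology.IsBounded (B i j) := by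
    intro i j
    obtain ⟨F, hF⟩ := hlattice i j
    rw [hF, isBounded_convexHull]
    exact (F.finite_toSet.image _).isBounded
  refine Finset.sum_congr rfl fun S hS => ?_
  rw [latticeCountProd_minkSum_cayley hB hbdd (Finset.mem_filter.1 hS).2, ← Finset.mul_sum]
  push_cast
  rfl
end
end
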